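/- Let τ₀ ∈ ℍ and k ∈ {1,2,3}, and set τ_k = 2τ₀ if k = 1, τ_k = τ₀/2 if k = 2, and τ_k = (1+τ₀)/2 if k = 3. Then equation (★_k) on E_{τ₀} has an even family of solutions if and only if there exists (r,s) ∈ ℝ² ∖ (1/2)ℤ² such that Z(r,s,τ_k) = 0. -/

import Mathlib

open Metric Set Filter Topology

noncomputable section

/-- The lattice `Λ_τ = ℤ + τℤ` as a set of complex numbers. -/
def lat (τ : ℂ) : Set ℂ := {z | ∃ m n : ℤ, z = (m : ℂ) + (n : ℂ) * τ}

/-- The lattice point `m + nτ` attached to a pair of integers. -/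
def latPt (τ : ℂ) (p : ℤ × ℤ) : ℂ := (p.1 : ℂ) + (p.2 : ℂ) * τ

/-- The Weierstrass elliptic function `℘(z|τ)`. -/
def wp (τ z : ℂ) : ℂ :=
  1 / z ^ 2 + ∑' p : {p : ℤ × ℤ // p ≠ 0},
    (1 / (z - latPt τ p.1) ^ 2 - 1 / latPt τ p.1 ^ 2)

/-- `℘′(z|τ)`. -/
def wpd (τ z : ℂ) : ℂ := deriv (wp τ) z

/-- `℘″(z|τ)`. -/
def wpdd (τ z : ℂ) : ℂ := deriv (deriv (wp τ)) z

/-- The Weierstrass zeta function `ζ(z|τ)` (odd primitive of `-℘`). -/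
def wzeta (τ z : ℂ) : ℂ :=
  1 / z + ∑' p : {p : ℤ × ℤ // p ≠ 0},
    (1 / (z - latPt τ p.1) + 1 / latPt τ p.1 + z / latPt τ p.1 ^ 2)

/-- The Weierstrass sigma function `σ(z|τ)`. -/
def wsigma (τ z : ℂ) : ℂ :=
  z * ∏' p : {p : ℤ × ℤ // p ≠ 0},
    ((1 - z / latPt τ p.1) * Complex.exp (z / latPt τ p.1 + z ^ 2 / (2 * latPt τ p.1 ^ 2)))

/-- The periods `ω₀ = 0, ω₁ = 1, ω₂ = τ, ω₃ = 1 + τ`. -/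
def per (τ : ℂ) : ℕ → ℂ
  | 0 => 0
  | 1 => 1
  | 2 => τ
  | 3 => 1 + τ
  | _ => 0

/-- `e_k(τ) = ℘(ω_k/2|τ)`. -/
def eper (τ : ℂ) (k : ℕ) : ℂ := wp τ (per τ k / 2)

/-- The quasi-period `η₁(τ) = 2ζ(1/2|τ)`. -/
def eta1 (τ : ℂ) : ℂ := 2 * wzeta τ (1 / 2)

/-- The quasi-period `η₂(τ) = 2ζ(τ/2|τ)`. -/
def eta2 (τ : ℂ) : ℂ := 2 * wzeta τ (τ / 2)

/-- `η_k(τ)`, with `η₃ = η₁ + η₂`. -/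
def etaq (τ : ℂ) : ℕ → ℂ
  | 1 => eta1 τ
  | 2 => eta2 τ
  | 3 => eta1 τ + eta2 τ
  | _ => 0

/-- The Hecke form `Z(r,s,τ) = ζ(r+sτ|τ) - r η₁(τ) - s η₂(τ)`. -/
def heckeZ (r s τ : ℂ) : ℂ := wzeta τ (r + s * τ) - r * eta1 τ - s * eta2 τ

/-- The pre-modular form `Z^{(𝐦_k)}(r,s,τ) = Z(r,s,τ)² - ℘(r+sτ|τ) + e_k(τ)`. -/
def heckeZm (k : ℕ) (r s τ : ℂ) : ℂ := heckeZ r s τ ^ 2 - wp τ (r + s * τ) + eper τ k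

/-- First component of `(r_k, s_k)`. -/
def rkr (k : ℕ) (r : ℂ) : ℂ := if k = 2 then r else r + 1 / 2

/-- Second component of `(r_k, s_k)`. -/
def rks (k : ℕ) (s : ℂ) : ℂ := if k = 1 then s else s + 1 / 2

/-- `(r,s)` is a half-integer pair, i.e. belongs to `(1/2)ℤ²`. -/
def IsHalfIntPair (r s : ℂ) : Prop := ∃ m n : ℤ, r = (m : ℂ) / 2 ∧ s = (n : ℂ) / 2

/-- The singular set of the curvature equation: lattice translates of the points `ω_k/2`
with `m_k ≥ 1`. -/
def singSet (τ : ℂ) (m : Fin 4 → ℕ) : Set ℂ :=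
  {z | ∃ k : Fin 4, 1 ≤ m k ∧ ∃ l ∈ lat τ, z = per τ (k : ℕ) / 2 + l}

/-- The Laplacian of a real-valued function on `ℂ ≃ ℝ²`. -/
def lapl (u : ℂ → ℝ) (z : ℂ) : ℝ :=
  fderiv ℝ (fun w => fderiv ℝ u w (1 : ℂ)) z (1 : ℂ) +
  fderiv ℝ (fun w => fderiv ℝ u w Complex.I) z Complex.I

/-- `u` is a solution of the curvature equation `Δu + e^u = 8π Σ m_k δ_{ω_k/2}` on `E_τ`. -/
def IsCurvatureSolution (τ : ℂ) (m : Fin 4 → ℕ) (u : ℂ → ℝ) : Prop :=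
  (∀ z, u (z + 1) = u z) ∧ (∀ z, u (z + τ) = u z) ∧
  (∀ z ∉ singSet τ m, (∀ n : ℕ, ContDiffAt ℝ n u z) ∧ lapl u z + Real.exp (u z) = 0) ∧
  (∀ k : Fin 4, 1 ≤ m k → ∀ l ∈ lat τ,
    ∃ C ε : ℝ, 0 < ε ∧ ∀ z : ℂ, z ≠ per τ (k : ℕ) / 2 + l →
      dist z (per τ (k : ℕ) / 2 + l) < ε →
      |u z - 4 * (m k : ℝ) * Real.log (dist z (per τ (k : ℕ) / 2 + l))| ≤ C)

/-- Multiplicities for equation `(★_k)`: `m₀ = m_k = 1`, the others `0`. -/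
def starM (k : ℕ) : Fin 4 → ℕ := fun j => if (j : ℕ) = 0 ∨ (j : ℕ) = k then 1 else 0

/-- `f` is a developing map of `u`: `f` is meromorphic on `ℂ` and
`u = log (8|f′|²/(1+|f|²)²)` wherever `f` is analytic with nonvanishing derivative. -/
def IsDevelopingMapOf (u : ℂ → ℝ) (f : ℂ → ℂ) : Prop :=
  (∀ z : ℂ, MeromorphicAt f z) ∧
  ∀ z : ℂ, AnalyticAt ℂ f z → deriv f z ≠ 0 →
    u z = Real.log (8 * ‖deriv f z‖ ^ 2 / (1 + ‖f z‖ ^ 2) ^ 2)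

/-- `f` satisfies the type II constraint for the torus `E_τ`. -/
def IsTypeII (τ : ℂ) (f : ℂ → ℂ) : Prop :=
  ∃ θ₁ θ₂ : ℝ,
    (∀ z, f (z + 1) = Complex.exp (2 * Complex.I * (θ₁ : ℂ)) * f z) ∧
    (∀ z, f (z + τ) = Complex.exp (2 * Complex.I * (θ₂ : ℂ)) * f z)

/-- The one-parameter family of solutions generated by the developing map `f`
(with members `u_β` having developing map `e^β f`) contains an even solution. -/
def FamilyHasEven (τ : ℂ) (m : Fin 4 → ℕ) (f : ℂ → ℂ) : Prop :=
  ∃ (β : ℝ) (v : ℂ → ℝ), IsCurvatureSolution τ m v ∧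
    IsDevelopingMapOf v (fun z => (Real.exp β : ℂ) * f z) ∧ ∀ z, v (-z) = v z

/-- `u`, with type II developing map `f`, generates a non-even family of solutions. -/
def GeneratesNonEvenFamily (τ : ℂ) (m : Fin 4 → ℕ) (u : ℂ → ℝ) (f : ℂ → ℂ) : Prop :=
  IsCurvatureSolution τ m u ∧ IsDevelopingMapOf u f ∧ IsTypeII τ f ∧ ¬ FamilyHasEven τ m f

/-- The curvature equation has a non-even family of solutions. -/
def HasNonEvenFamily (τ : ℂ) (m : Fin 4 → ℕ) : Prop :=
  ∃ u f, GeneratesNonEvenFamily τ m u f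

/-- The curvature equation has an even family of solutions. -/
def HasEvenFamily (τ : ℂ) (m : Fin 4 → ℕ) : Prop :=
  ∃ (u : ℂ → ℝ) (f : ℂ → ℂ), IsCurvatureSolution τ m u ∧ IsDevelopingMapOf u f ∧
    IsTypeII τ f ∧ FamilyHasEven τ m f

/-- `y` is a (meromorphic, global) solution of `y″ = q·y` away from the singular set `S`. -/
def SolvesODEOn (q : ℂ → ℂ) (S : Set ℂ) (y : ℂ → ℂ) : Prop :=
  (∀ z : ℂ, MeromorphicAt y z) ∧
  ∀ z ∉ S, AnalyticAt ℂ y z ∧ deriv (deriv y) z = q z * y z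

/-- Linear independence of two functions, tested away from the singular set `S`. -/
def LinIndepOn (S : Set ℂ) (y₁ y₂ : ℂ → ℂ) : Prop :=
  ∀ a b : ℂ, (∀ z ∉ S, a * y₁ z + b * y₂ z = 0) → a = 0 ∧ b = 0

/-- The equation `y″ = q·y` (with singular set `S`) on `E_τ` has unitary monodromy: there is a
fundamental system of solutions whose monodromy matrices w.r.t. `z ↦ z+1` and `z ↦ z+τ`
lie in `SU(2)`. -/
def HasUnitaryMonodromy (q : ℂ → ℂ) (S : Set ℂ) (τ : ℂ) : Prop :=
  ∃ y₁ y₂ : ℂ → ℂ, SolvesODEOn q S y₁ ∧ SolvesODEOn q S y₂ ∧ LinIndepOn S y₁ y₂ ∧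
    ∃ M₁ M₂ : Matrix (Fin 2) (Fin 2) ℂ,
      M₁ ∈ Matrix.unitaryGroup (Fin 2) ℂ ∧ M₁.det = 1 ∧
      M₂ ∈ Matrix.unitaryGroup (Fin 2) ℂ ∧ M₂.det = 1 ∧
      (∀ z, y₁ (z + 1) = M₁ 0 0 * y₁ z + M₁ 0 1 * y₂ z) ∧
      (∀ z, y₂ (z + 1) = M₁ 1 0 * y₁ z + M₁ 1 1 * y₂ z) ∧
      (∀ z, y₁ (z + τ) = M₂ 0 0 * y₁ z + M₂ 0 1 * y₂ z) ∧
      (∀ z, y₂ (z + τ) = M₂ 1 0 * y₁ z + M₂ 1 1 * y₂ z)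

/-- The potential of the Fuchsian equation `L(𝐦_k, T, E, τ)`. -/
def LPot (k : ℕ) (T E τ : ℂ) (z : ℂ) : ℂ :=
  2 * wp τ z + 2 * wp τ (z - per τ k / 2) +
    T * (wzeta τ (z - per τ k / 2) - wzeta τ z) - E

/-- The singular set of `L(𝐦_k, T, E, τ)`: lattice translates of `0` and `ω_k/2`. -/
def LSing (τ : ℂ) (k : ℕ) : Set ℂ := {z | ∃ l ∈ lat τ, z = l ∨ z = per τ k / 2 + l}

/-- The equation `y″ = q·y` is apparent (free of logarithmic singularity) at `p`: there are two
linearly independent single-valued solutions on a punctured neighborhood of `p`, both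
meromorphic at `p`. -/
def ApparentAt (q : ℂ → ℂ) (p : ℂ) : Prop :=
  ∃ (y₁ y₂ : ℂ → ℂ) (ε : ℝ), 0 < ε ∧
    (∀ z ∈ Metric.ball p ε, z ≠ p →
      AnalyticAt ℂ y₁ z ∧ AnalyticAt ℂ y₂ z ∧
      deriv (deriv y₁) z = q z * y₁ z ∧ deriv (deriv y₂) z = q z * y₂ z) ∧
    MeromorphicAt y₁ p ∧ MeromorphicAt y₂ p ∧
    ∀ a b : ℂ, (∀ z ∈ Metric.ball p ε, z ≠ p → a * y₁ z + b * y₂ z = 0) → a = 0 ∧ b = 0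

/-- The translated (even) potential `q_k(z;T,E)` of `L(𝐦_k, T, E, τ)`. -/
def qPot (k : ℕ) (T E τ : ℂ) (z : ℂ) : ℂ :=
  2 * (wp τ (z + per τ k / 4) + wp τ (z - per τ k / 4)) +
    T * (wzeta τ (z + per τ k / 4) - wzeta τ (z - per τ k / 4)) - E

/-- The singular set of the translated potential: lattice translates of `±ω_k/4`. -/
def qSing (τ : ℂ) (k : ℕ) : Set ℂ :=
  {z | ∃ l ∈ lat τ, z = per τ k / 4 + l ∨ z = -(per τ k / 4) + l}

/-- The even elliptic solution `Φ_e(z;T,E)` of the second symmetric product equation. -/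
def PhiE (τ : ℂ) (k : ℕ) (T E : ℂ) (z : ℂ) : ℂ :=
  (wpd τ (per τ k / 4)) ^ 4 / (wp τ z - wp τ (per τ k / 4)) ^ 2 +
  (wpd τ (per τ k / 4)) ^ 2 * (wpd τ (per τ k / 4) * T + wpdd τ (per τ k / 4)) /
      (wp τ z - wp τ (per τ k / 4)) +
  (1 / 4) * (4 * (wpd τ (per τ k / 4)) ^ 2 * E + 3 * (wpd τ (per τ k / 4)) ^ 2 * T ^ 2
    - 8 * wzeta τ (per τ k / 4) * (wpd τ (per τ k / 4)) ^ 2 * T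
    + 32 * wp τ (per τ k / 4) * (wpd τ (per τ k / 4)) ^ 2
    - 3 * (wpdd τ (per τ k / 4)) ^ 2)

/-- For `k ∈ {1,2,3}`, the other two indices, so that `{k, i, i′} = {1,2,3}`. -/
def otherTwo : ℕ → ℕ × ℕ
  | 1 => (2, 3)
  | 2 => (1, 3)
  | 3 => (1, 2)
  | _ => (0, 0)

/-- The Wirtinger derivative `∂_z g = (1/2)(∂_x g - i ∂_y g)`. -/
def wirt (g : ℂ → ℂ) (z : ℂ) : ℂ :=
  (1 / 2) * (fderiv ℝ g z (1 : ℂ) - Complex.I * fderiv ℝ g z Complex.I)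

/-- The potential `q(z) = -(1/2)(u_zz - (1/2) u_z²)` associated with a solution `u`. -/
def uPot (u : ℂ → ℝ) (z : ℂ) : ℂ :=
  -(1 / 2) * (wirt (wirt (fun w => ((u w : ℝ) : ℂ))) z -
    (1 / 2) * (wirt (fun w => ((u w : ℝ) : ℂ)) z) ^ 2)

/-- All lattice translates of the four half-periods. -/
def fullSing (τ : ℂ) : Set ℂ := {z | ∃ k : Fin 4, ∃ l ∈ lat τ, z = per τ (k : ℕ) / 2 + l}

/-- The potential of the general Fuchsian equation (with residues `T₁, T₂, T₃`). -/
def q8 (τ : ℂ) (m : Fin 4 → ℕ) (T₁ T₂ T₃ E : ℂ) (z : ℂ) : ℂ :=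
  (∑ k : Fin 4, (m k : ℂ) * ((m k : ℂ) + 1) * wp τ (z - per τ (k : ℕ) / 2)) +
  T₁ * (wzeta τ (z - per τ 1 / 2) - wzeta τ z) +
  T₂ * (wzeta τ (z - per τ 2 / 2) - wzeta τ z) +
  T₃ * (wzeta τ (z - per τ 3 / 2) - wzeta τ z) - E

/-- The elliptic-of-the-second-kind ansatz built from sigma functions. -/
def sigY (τ : ℂ) (k : ℕ) (a₁ a₂ c : ℂ) (z : ℂ) : ℂ :=
  Complex.exp (c * z) * wsigma τ (z - a₁) * wsigma τ (z - a₂) /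
    (wsigma τ (z - per τ k / 4) * wsigma τ (z + per τ k / 4))

end

open Metric Set Filter Topology

/-- elementary factor -/
noncomputable def pE (u : ℂ) : ℂ := (1 - u) * Complex.exp (u + u ^ 2 / 2)

lemma pE_hasDerivAt (u : ℂ) : HasDerivAt pE (-(u ^ 2 * Complex.exp (u + u ^ 2 / 2))) u := by
  have h1 : HasDerivAt (fun u : ℂ => 1 - u) (-1) u := by
    simpa using (hasDerivAt_id u).const_sub 1
  have h2 : HasDerivAt (fun u : ℂ => u + u ^ 2 / 2) (1 + u) u := by
    have := (hasDerivAt_id u).add (((hasDerivAt_id u).pow 2).div_const 2)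
    convert! this using 1
    simp
  have := h1.mul h2.cexp
  convert! this using 1
  ring

lemma pE_bound (u : ℂ) (hu : ‖u‖ ≤ 1) : ‖pE u - 1‖ ≤ Real.exp 2 * ‖u‖ ^ 3 := by
  have h := (convex_closedBall (0 : ℂ) ‖u‖).norm_image_sub_le_of_norm_hasDerivWithin_le
    (f := pE) (f' := fun u => -(u ^ 2 * Complex.exp (u + u ^ 2 / 2)))
    (C := Real.exp 2 * ‖u‖ ^ 2) (x := 0) (y := u)
    (fun x _ => (pE_hasDerivAt x).hasDerivWithinAt) (fun x hx => by
      have hx' : ‖x‖ ≤ ‖u‖ := by simpa using hx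
      rw [norm_neg, norm_mul, norm_pow, mul_comm]
      gcongr
      rw [Complex.norm_exp]
      apply Real.exp_le_exp.mpr
      refine (Complex.re_le_norm _).trans ((norm_add_le _ _).trans ?_)
      rw [norm_div, norm_pow]
      simp only [Complex.norm_ofNat]
      have : ‖x‖ ^ 2 ≤ 1 := by
        have := norm_nonneg x
        nlinarith
      linarith) (by simp) (by simp)
  have h0 : pE 0 = 1 := by simp [pE]
  rw [h0, sub_zero] at h
  calc _ ≤ _ := h
    _ = _ := by ring

namespace PeriodPair
variable (L : PeriodPair)

noncomputable def pz (z : ℂ) : ℂ := ∑' l : L.lattice, (1 / (z - l) + 1 / (l : ℂ) + z / (l : ℂ) ^ 2)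

noncomputable def pg (z : ℂ) : ℂ := ∏' l : L.lattice, (1 + (pE (z / l) - 1))

noncomputable def ps (z : ℂ) : ℂ := z * L.pg z

lemma pz_bound (r : ℝ) (hr : 0 < r) (s : ℂ) (hs : ‖s‖ < r) (l : ℂ) (h : 2 * r ≤ ‖l‖) :
    ‖1 / (s - l) + 1 / l + s / l ^ 2‖ ≤ 2 * r ^ 2 * ‖l‖ ^ (-3 : ℝ) := by
  have h1 : s - l ≠ 0 := by
    intro h0
    rw [sub_eq_zero] at h0
    rw [h0] at hs; linarith
  have hl : 0 < ‖l‖ := by linarith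
  have hl0 : l ≠ 0 := norm_pos_iff.mp hl
  have e : 1 / (s - l) + 1 / l + s / l ^ 2 = s ^ 2 / (l ^ 2 * (s - l)) := by
    field_simp; ring
  rw [e, norm_div, norm_mul, norm_pow, norm_pow]
  have h2 : ‖l‖ / 2 ≤ ‖s - l‖ := by
    rw [norm_sub_rev]
    exact .trans (by linarith) (norm_sub_norm_le l s)
  calc ‖s‖ ^ 2 / (‖l‖ ^ 2 * ‖s - l‖) ≤ r ^ 2 / (‖l‖ ^ 2 * (‖l‖ / 2)) := by gcongr
    _ = 2 * r ^ 2 / ‖l‖ ^ 3 := by field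
    _ = _ := by norm_cast

lemma hasSumLU_pz : HasSumLocallyUniformly
    (fun (l : L.lattice) (z : ℂ) => 1 / (z - l) + 1 / (l : ℂ) + z / (l : ℂ) ^ 2) L.pz := by
  refine L.hasSumLocallyUniformly_aux (u := fun r l => 2 * r ^ 2 * ‖l‖ ^ (-3 : ℝ)) _
    (fun _ _ ↦ (ZLattice.summable_norm_rpow _ _ (by simp; norm_num)).mul_left _) fun r hr ↦
    Filter.eventually_atTop.mpr ⟨2 * r, ?_⟩
  rintro _ h s hs l rfl
  exact pz_bound r hr s hs l h

lemma hasSum_pz (z : ℂ) : HasSum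
    (fun (l : L.lattice) => 1 / (z - l) + 1 / (l : ℂ) + z / (l : ℂ) ^ 2) (L.pz z) :=
  L.hasSumLU_pz.hasSum

lemma isOpen_compl : IsOpen ((L.lattice : Set ℂ)ᶜ) := L.isClosed_lattice.isOpen_compl

lemma sub_ne {z : ℂ} (hz : z ∉ L.lattice) (l : L.lattice) : z - l ≠ 0 := by
  intro h
  rw [sub_eq_zero] at h
  exact hz (h ▸ l.2)

lemma term_hasDerivAt {z : ℂ} (hz : z ∉ L.lattice) (l : L.lattice) :
    HasDerivAt (fun z : ℂ => 1 / (z - l) + 1 / (l : ℂ) + z / (l : ℂ) ^ 2)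
      (-(1 / (z - l) ^ 2 - 1 / (l : ℂ) ^ 2)) z := by
  have h1 : HasDerivAt (fun z : ℂ => z - l) 1 z := (hasDerivAt_id z).sub_const _
  have h2 := h1.inv (L.sub_ne hz l)
  have h3 := (h2.add_const (1 / (l : ℂ))).add ((hasDerivAt_id z).div_const ((l : ℂ) ^ 2))
  simp only [one_div]
  convert! h3 using 1
  · ext w; simp
  · simp; ring

lemma pz_hasDerivAt {z : ℂ} (hz : z ∉ L.lattice) : HasDerivAt L.pz (-L.weierstrassP z) z := by
  have hd : ∀ᶠ s : Finset L.lattice in atTop, DifferentiableOn ℂ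
      (fun z => ∑ l ∈ s, (1 / (z - l) + 1 / (l : ℂ) + z / (l : ℂ) ^ 2)) ((L.lattice : Set ℂ)ᶜ) :=
    .of_forall fun s ↦ .fun_sum fun l _ ↦ fun x hx =>
      (L.term_hasDerivAt hx l).differentiableAt.differentiableWithinAt
  have hlu := L.hasSumLU_pz.hasSumLocallyUniformlyOn (s := (L.lattice : Set ℂ)ᶜ)
  have hdiff : DifferentiableOn ℂ L.pz ((L.lattice : Set ℂ)ᶜ) :=
    hlu.differentiableOn hd L.isOpen_compl
  have h1 := (hdiff z hz).differentiableAt (L.isOpen_compl.mem_nhds hz)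
  have h2 := (hasSumLocallyUniformlyOn_iff_tendstoLocallyUniformlyOn.mp hlu).deriv hd L.isOpen_compl
  have h3 := h2.tendsto_at hz
  have h4 : Tendsto (fun s : Finset L.lattice => ∑ l ∈ s, (-(1 / (z - l) ^ 2 - 1 / (l : ℂ) ^ 2)))
      atTop (𝓝 (-L.weierstrassP z)) := (L.hasSum_weierstrassP z).neg
  have h5 : deriv L.pz z = -L.weierstrassP z := by
    refine tendsto_nhds_unique h3 (h4.congr fun s => ?_)
    simp only [Function.comp]
    rw [(HasDerivAt.fun_sum fun l _ => L.term_hasDerivAt hz l).deriv]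
  rw [← h5]
  exact h1.hasDerivAt

lemma pz_neg (z : ℂ) : L.pz (-z) = -L.pz z := by
  simp only [pz]
  rw [← (Equiv.neg L.lattice).tsum_eq, ← tsum_neg]
  congr 1
  ext l
  simp only [Equiv.neg_apply, Submodule.coe_neg]
  rw [show -z - -(l : ℂ) = -(z - l) by ring, neg_sq]
  simp only [one_div, inv_neg]
  ring

lemma finite_small (r : ℝ) : {l : L.lattice | ‖(l : ℂ)‖ ≤ r}.Finite := by
  refine (isCompact_iff_finite.mp (isCompact_closedBall (0 : L.lattice) r)).subset ?_
  intro l hl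
  simpa using! hl

lemma pE_term_bound (r : ℝ) (hr : 0 < r) : ∀ᶠ l : L.lattice in cofinite, ∀ z ∈ ball (0 : ℂ) r,
    ‖pE (z / l) - 1‖ ≤ Real.exp 2 * r ^ 3 * ‖l‖ ^ (-3 : ℝ) := by
  have := (L.finite_small r).compl_mem_cofinite
  filter_upwards [this] with l hl z hz
  have hl' : r < ‖(l : ℂ)‖ := by simpa using hl
  have hz' : ‖z‖ < r := by simpa using hz
  have hl0 : 0 < ‖(l : ℂ)‖ := by linarith
  refine (pE_bound _ ?_).trans ?_
  · rw [norm_div, div_le_one hl0]; linarith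
  · rw [norm_div, div_pow]
    calc Real.exp 2 * (‖z‖ ^ 3 / ‖(l : ℂ)‖ ^ 3) ≤ Real.exp 2 * (r ^ 3 / ‖(l : ℂ)‖ ^ 3) := by gcongr
      _ = Real.exp 2 * r ^ 3 / ‖(l : ℂ)‖ ^ 3 := by ring
      _ = _ := by norm_cast

lemma summ3 (c : ℝ) : Summable fun l : L.lattice => c * ‖l‖ ^ (-3 : ℝ) :=
  (ZLattice.summable_norm_rpow _ _ (by simp; norm_num)).mul_left _

lemma pE_diff (l : ℂ) : Differentiable ℂ (fun z => pE (z / l)) := fun z =>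
  (HasDerivAt.comp (h₂ := pE) (h := fun z => z / l) z (pE_hasDerivAt (z / l))
    ((hasDerivAt_id z).div_const l)).differentiableAt

lemma pg_mult (r : ℝ) (hr : 0 < r) : MultipliableLocallyUniformlyOn
    (fun (l : L.lattice) z => 1 + (pE (z / l) - 1)) (ball (0 : ℂ) r) :=
  Summable.multipliableLocallyUniformlyOn_one_add isOpen_ball (L.summ3 _) (L.pE_term_bound r hr)
    (fun l => ((pE_diff l).continuous.sub continuous_const).continuousOn)

lemma pg_diff : Differentiable ℂ L.pg := by
  intro z
  have hr : 0 < ‖z‖ + 1 := by positivity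
  have h := (L.pg_mult _ hr).hasProdLocallyUniformlyOn
  have h2 := hasProdLocallyUniformlyOn_iff_tendstoLocallyUniformlyOn.mp h
  have h3 := h2.differentiableOn (.of_forall fun s => by
    refine DifferentiableOn.fun_finsetProd fun l _ => ?_
    exact (((pE_diff l).sub_const 1).const_add 1).differentiableOn) isOpen_ball
  exact (h3 z (by simp)).differentiableAt (isOpen_ball.mem_nhds (by simp))

lemma pg_zero : L.pg 0 = 1 := by simp [pg, pE]

lemma pE_ne {u : ℂ} (hu : u ≠ 1) : pE u ≠ 0 :=
  mul_ne_zero (sub_ne_zero.mpr (Ne.symm hu)) (Complex.exp_ne_zero _)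

lemma pE_fac_ne {z : ℂ} (hz : z ∉ L.lattice) (l : L.lattice) : pE (z / l) ≠ 0 := by
  apply pE_ne
  intro h
  by_cases hl : (l : ℂ) = 0
  · simp [hl] at h
  · rw [div_eq_one_iff_eq hl] at h
    exact hz (h ▸ l.2)

lemma pE_summ (z : ℂ) : Summable fun l : L.lattice => ‖pE (z / l) - 1‖ := by
  have hr : 0 < ‖z‖ + 1 := by positivity
  refine Summable.of_norm_bounded_eventually (L.summ3 (Real.exp 2 * (‖z‖ + 1) ^ 3)) ?_
  filter_upwards [L.pE_term_bound _ hr] with l hl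
  rw [norm_norm]
  exact hl z (by simp)

lemma pg_ne {z : ℂ} (hz : z ∉ L.lattice) : L.pg z ≠ 0 := by
  refine tprod_one_add_ne_zero_of_summable (fun l => ?_) (L.pE_summ z)
  rw [add_sub_cancel]
  exact L.pE_fac_ne hz l

lemma ps_ne {z : ℂ} (hz : z ∉ L.lattice) : L.ps z ≠ 0 :=
  mul_ne_zero (by rintro rfl; exact hz (zero_mem _)) (L.pg_ne hz)

lemma ps_eq_zero {z : ℂ} (hz : z ∈ L.lattice) : L.ps z = 0 := by
  by_cases h0 : z = 0
  · simp [ps, h0]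
  · have : L.pg z = 0 := by
      refine tprod_of_exists_eq_zero ⟨⟨z, hz⟩, ?_⟩
      simp [pE, div_self h0]
    simp [ps, this]

lemma ps_eq_zero_iff {z : ℂ} : L.ps z = 0 ↔ z ∈ L.lattice :=
  ⟨fun h => by by_contra hz; exact L.ps_ne hz h, L.ps_eq_zero⟩

lemma ps_diff : Differentiable ℂ L.ps := differentiable_id.mul L.pg_diff

lemma ps_neg (z : ℂ) : L.ps (-z) = -L.ps z := by
  have : L.pg (-z) = L.pg z := by
    simp only [pg]
    rw [← (Equiv.neg L.lattice).tprod_eq]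
    congr 1
    ext l
    simp
  simp [ps, this]

lemma ps_hasDerivAt_zero : HasDerivAt L.ps 1 0 := by
  have := (hasDerivAt_id (0 : ℂ)).mul (L.pg_diff 0).hasDerivAt
  convert! this using 1
  simp [pg_zero]

lemma pE_logDeriv {z : ℂ} (hz : z ∉ L.lattice) (l : L.lattice) :
    logDeriv (fun z => 1 + (pE (z / l) - 1)) z =
      if l = 0 then 0 else 1 / (z - l) + 1 / (l : ℂ) + z / (l : ℂ) ^ 2 := by
  split_ifs with h
  · subst h; simp [logDeriv, pE]
  have hl : (l : ℂ) ≠ 0 := by simpa using h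
  have h1 := (pE_hasDerivAt (z / l)).comp z ((hasDerivAt_id z).div_const (l : ℂ))
  have h2 : (fun z => 1 + (pE (z / l) - 1)) = pE ∘ (fun z => z / (l : ℂ)) := by ext; simp
  rw [h2, logDeriv_apply]
  rw [show deriv (pE ∘ fun z => z / (l : ℂ)) z = _ from h1.deriv]
  simp only [Function.comp, pE, id]
  have h3 := L.sub_ne hz l
  have h4 : (l : ℂ) - z ≠ 0 := by rw [← neg_sub]; exact neg_ne_zero.mpr h3
  have h5 : 1 - z / l ≠ 0 := by
    rw [one_sub_div hl]; exact div_ne_zero h4 hl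
  rw [neg_mul, mul_assoc, mul_comm (Complex.exp _), neg_div, ← mul_assoc]
  rw [mul_div_mul_right _ _ (Complex.exp_ne_zero _), one_sub_div hl]
  field_simp
  ring

lemma ps_hasDerivAt {z : ℂ} (hz : z ∉ L.lattice) : HasDerivAt L.ps (L.pz z * L.ps z) z := by
  have hr : 0 < ‖z‖ + 1 := by positivity
  have hz0 : z ≠ 0 := by rintro rfl; exact hz (zero_mem _)
  have hs := (L.hasSum_pz z).summable
  have hsplit := hs.tsum_eq_add_tsum_ite (0 : L.lattice)
  have hsum : Summable fun l : L.lattice => logDeriv (fun z => 1 + (pE (z / l) - 1)) z := by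
    simp_rw [L.pE_logDeriv hz]
    refine hs.congr_cofinite ?_
    filter_upwards [(Set.finite_singleton (0 : L.lattice)).compl_mem_cofinite] with l hl
    have : l ≠ 0 := by simpa using hl
    simp [this]
  have h := logDeriv_tprod_eq_tsum (s := ball (0 : ℂ) (‖z‖ + 1)) isOpen_ball (x := z) (by simp)
    (f := fun (l : L.lattice) z => 1 + (pE (z / l) - 1)) (fun l => by
      simpa using L.pE_fac_ne hz l)
    (fun l => (((pE_diff l).sub_const 1).const_add 1).differentiableOn) hsum (L.pg_mult _ hr)
    (L.pg_ne hz)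
  simp_rw [L.pE_logDeriv hz] at h
  have h6 : L.pz z = 1 / z + logDeriv L.pg z := by
    have : logDeriv L.pg z = _ := h
    rw [this, pz, hsplit]
    simp
  have h7 := (hasDerivAt_id z).mul (L.pg_diff z).hasDerivAt
  rw [logDeriv_apply] at h6
  have := L.pg_ne hz
  convert! h7 using 1
  rw [h6, ps, id]
  field_simp

end PeriodPair

open Metric Set Filter Topology

/-- removable singularity -/
def RemAt (g : ℂ → ℂ) (p : ℂ) : Prop := ∃ φ : ℂ → ℂ, AnalyticAt ℂ φ p ∧ ∀ᶠ z in 𝓝[≠] p, g z = φ z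

lemma RemAt.of_analytic {g : ℂ → ℂ} {p : ℂ} (h : AnalyticAt ℂ g p) : RemAt g p :=
  ⟨g, h, .of_forall fun _ => rfl⟩

lemma RemAt.congr {g h : ℂ → ℂ} {p : ℂ} (H : RemAt g p) (e : ∀ᶠ z in 𝓝[≠] p, h z = g z) :
    RemAt h p := by
  obtain ⟨φ, h1, h2⟩ := H
  exact ⟨φ, h1, by filter_upwards [h2, e] with z a b; rw [b, a]⟩

lemma tendsto_punct_comp {f : ℂ → ℂ} (hf : Continuous f) (hi : Function.Injective f) (p : ℂ) :
    Tendsto f (𝓝[≠] p) (𝓝[≠] (f p)) := by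
  refine tendsto_nhdsWithin_iff.mpr ⟨hf.continuousAt.tendsto.mono_left nhdsWithin_le_nhds, ?_⟩
  filter_upwards [self_mem_nhdsWithin] with z hz
  exact fun h => hz (hi h)

lemma RemAt.comp_add {g : ℂ → ℂ} {p w : ℂ} (H : RemAt g (p + w)) : RemAt (fun z => g (z + w)) p := by
  obtain ⟨φ, h1, h2⟩ := H
  refine ⟨fun z => φ (z + w), ?_, ?_⟩
  · exact AnalyticAt.fun_comp (f := fun z : ℂ => z + w) h1 (by fun_prop)
  · exact (tendsto_punct_comp (f := fun z : ℂ => z + w) (by fun_prop)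
      (add_left_injective w) p).eventually h2

lemma RemAt.comp_sub {g : ℂ → ℂ} {p w : ℂ} (H : RemAt g (w - p)) : RemAt (fun z => g (w - z)) p := by
  obtain ⟨φ, h1, h2⟩ := H
  refine ⟨fun z => φ (w - z), ?_, ?_⟩
  · exact AnalyticAt.fun_comp (f := fun z : ℂ => w - z) h1 (by fun_prop)
  · exact (tendsto_punct_comp (f := fun z : ℂ => w - z) (by fun_prop)
      (fun x y h => by simpa using h) p).eventually h2

lemma RemAt.add {g h : ℂ → ℂ} {p : ℂ} (H : RemAt g p) (K : RemAt h p) :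
    RemAt (fun z => g z + h z) p := by
  obtain ⟨φ, h1, h2⟩ := H
  obtain ⟨ψ, k1, k2⟩ := K
  exact ⟨fun z => φ z + ψ z, h1.add k1, by filter_upwards [h2, k2] with z a b; rw [a, b]⟩

lemma RemAt.mul {g h : ℂ → ℂ} {p : ℂ} (H : RemAt g p) (K : RemAt h p) :
    RemAt (fun z => g z * h z) p := by
  obtain ⟨φ, h1, h2⟩ := H
  obtain ⟨ψ, k1, k2⟩ := K
  exact ⟨fun z => φ z * ψ z, h1.mul k1, by filter_upwards [h2, k2] with z a b; rw [a, b]⟩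

lemma RemAt.sub {g h : ℂ → ℂ} {p : ℂ} (H : RemAt g p) (K : RemAt h p) :
    RemAt (fun z => g z - h z) p := by
  obtain ⟨φ, h1, h2⟩ := H
  obtain ⟨ψ, k1, k2⟩ := K
  exact ⟨fun z => φ z - ψ z, h1.sub k1, by filter_upwards [h2, k2] with z a b; rw [a, b]⟩

/-- a vanishing analytic function factors -/
lemma analytic_factor {φ : ℂ → ℂ} {p : ℂ} (h : AnalyticAt ℂ φ p) (h0 : φ p = 0) :
    ∃ ψ : ℂ → ℂ, AnalyticAt ℂ ψ p ∧ (∀ z, φ z = (z - p) * ψ z) ∧ ψ p = deriv φ p := by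
  refine ⟨dslope φ p, ?_, ?_, dslope_same φ p⟩
  · obtain ⟨s, hs⟩ := h
    exact ⟨_, HasFPowerSeriesAt.has_fpower_series_dslope_fslope hs⟩
  · intro z
    have := sub_smul_dslope φ p z
    rw [h0, sub_zero] at this
    exact this.symm

lemma RemAt.parity {g φ : ℂ → ℂ} {p : ℂ} (hφ : AnalyticAt ℂ φ p)
    (hg : ∀ᶠ z in 𝓝[≠] p, g z = φ z / (z - p))
    (hs : ∀ᶠ z in 𝓝[≠] p, g (2 * p - z) = g z) : RemAt g p := by
  have ht : Tendsto (fun z : ℂ => 2 * p - z) (𝓝[≠] p) (𝓝[≠] p) := by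
    have := tendsto_punct_comp (f := fun z : ℂ => 2 * p - z) (by fun_prop)
      (fun x y h => by simpa using h) p
    rwa [show 2 * p - p = p by ring] at this
  have h1 : ∀ᶠ z in 𝓝[≠] p, φ (2 * p - z) = - φ z := by
    filter_upwards [hg, ht.eventually hg, hs, self_mem_nhdsWithin] with z a b c d
    have d' : z - p ≠ 0 := sub_ne_zero.mpr d
    rw [c, a, show 2 * p - z - p = -(z - p) by ring, div_neg] at b
    field_simp at b
    rw [b, neg_neg, mul_comm]
  have h2 : Tendsto (fun z => φ (2 * p - z)) (𝓝[≠] p) (𝓝 (φ p)) :=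
    (hφ.continuousAt.tendsto.mono_left nhdsWithin_le_nhds).comp ht
  have h3 : Tendsto (fun z => - φ z) (𝓝[≠] p) (𝓝 (- φ p)) :=
    (hφ.continuousAt.tendsto.mono_left nhdsWithin_le_nhds).neg
  have h4 : φ p = - φ p := tendsto_nhds_unique (h2.congr' h1) h3
  have h5 : φ p = 0 := by
    have : 2 * φ p = 0 := by linear_combination h4
    simpa using this
  obtain ⟨ψ, k1, k2, -⟩ := analytic_factor hφ h5
  refine ⟨ψ, k1, ?_⟩
  filter_upwards [hg, self_mem_nhdsWithin] with z a d
  have d' : z - p ≠ 0 := sub_ne_zero.mpr d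
  rw [a, k2]; field_simp

namespace PeriodPair
variable (L : PeriodPair)

lemma coords (z : ℂ) : ∃ x y : ℝ, z = x * L.ω₁ + y * L.ω₂ := by
  have := L.basis.sum_repr z
  refine ⟨L.basis.repr z 0, L.basis.repr z 1, ?_⟩
  conv_lhs => rw [← this]
  simp [Fin.sum_univ_two]

lemma bdd_of_periodic {h : ℂ → ℝ} (hc : Continuous h) (h1 : ∀ z, h (z + L.ω₁) = h z)
    (h2 : ∀ z, h (z + L.ω₂) = h z) : ∃ C, ∀ z, h z ≤ C := by
  have hK : IsCompact ((fun p : ℝ × ℝ => h (p.1 * L.ω₁ + p.2 * L.ω₂)) '' (Icc 0 1 ×ˢ Icc 0 1)) := by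
    apply (isCompact_Icc.prod isCompact_Icc).image
    fun_prop
  obtain ⟨C, hC⟩ := hK.bddAbove
  refine ⟨C, fun z => ?_⟩
  obtain ⟨x, y, rfl⟩ := L.coords z
  have p1 : Function.Periodic h L.ω₁ := h1
  have p2 : Function.Periodic h L.ω₂ := h2
  have e : h (x * L.ω₁ + y * L.ω₂) = h (Int.fract x * L.ω₁ + Int.fract y * L.ω₂) := by
    have e1 := (p1.int_mul ⌊x⌋) (Int.fract x * L.ω₁ + Int.fract y * L.ω₂)
    have e2 := (p2.int_mul ⌊y⌋) (Int.fract x * L.ω₁ + Int.fract y * L.ω₂ + ⌊x⌋ * L.ω₁)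
    rw [← e1, ← e2]
    congr 1
    have fx := Int.fract_add_floor x
    have fy := Int.fract_add_floor y
    conv_lhs => rw [← fx, ← fy]
    push_cast
    ring
  rw [e]
  apply hC
  exact ⟨(Int.fract x, Int.fract y), ⟨⟨Int.fract_nonneg _, (Int.fract_lt_one _).le⟩,
    ⟨Int.fract_nonneg _, (Int.fract_lt_one _).le⟩⟩, rfl⟩

lemma liouville {g : ℂ → ℂ} (hr : ∀ p, RemAt g p)
    (h1 : ∀ p, ∀ᶠ z in 𝓝[≠] p, g (z + L.ω₁) = g z)
    (h2 : ∀ p, ∀ᶠ z in 𝓝[≠] p, g (z + L.ω₂) = g z) :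
    ∃ c, ∀ p, ∀ᶠ z in 𝓝[≠] p, g z = c := by
  choose φ ha he using hr
  set G : ℂ → ℂ := fun p => φ p p with hG
  have hev : ∀ p, ∀ᶠ z in 𝓝 p, G z = φ p z := by
    intro p
    have h3 := (ha p).eventually_analyticAt
    have h4 := eventually_eventually_nhdsWithin.mpr (he p)
    rw [eventually_nhdsWithin_iff] at h4
    filter_upwards [h3, h4] with z a b
    by_cases hz : z = p
    · subst hz; rfl
    have b := b hz
    have b' : ∀ᶠ w in 𝓝[≠] z, g w = φ p w := by
      have : ({p}ᶜ : Set ℂ) ∈ 𝓝 z := isOpen_compl_singleton.mem_nhds hz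
      rw [nhdsWithin_eq_nhds.mpr this] at b
      exact b.filter_mono nhdsWithin_le_nhds
    have t1 : Tendsto (φ z) (𝓝[≠] z) (𝓝 (φ z z)) :=
      (ha z).continuousAt.tendsto.mono_left nhdsWithin_le_nhds
    have t2 : Tendsto (φ p) (𝓝[≠] z) (𝓝 (φ p z)) :=
      a.continuousAt.tendsto.mono_left nhdsWithin_le_nhds
    refine tendsto_nhds_unique (t1.congr' ?_) t2
    filter_upwards [he z, b'] with w x y
    rw [← x, y]
  have hd : Differentiable ℂ G := fun p =>
    ((ha p).congr (by filter_upwards [hev p] with z hz using hz.symm)).differentiableAt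
  have hgG : ∀ p, ∀ᶠ z in 𝓝[≠] p, g z = G z := by
    intro p
    filter_upwards [he p, (hev p).filter_mono nhdsWithin_le_nhds] with z a b
    rw [a, b]
  have hper : ∀ w, (∀ p, ∀ᶠ z in 𝓝[≠] p, g (z + w) = g z) → ∀ z, G (z + w) = G z := by
    intro w hw z
    have t1 : Tendsto G (𝓝[≠] z) (𝓝 (G z)) :=
      (hd z).continuousAt.tendsto.mono_left nhdsWithin_le_nhds
    have tw := tendsto_punct_comp (f := fun z : ℂ => z + w) (by fun_prop) (add_left_injective w) z
    have t2 : Tendsto (fun z => G (z + w)) (𝓝[≠] z) (𝓝 (G (z + w))) :=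
      ((hd (z + w)).continuousAt.tendsto.mono_left nhdsWithin_le_nhds).comp tw
    refine tendsto_nhds_unique t2 (t1.congr' ?_)
    filter_upwards [hgG z, tw.eventually (hgG (z + w)), hw z] with u a b c
    rw [← a, ← b, c]
  obtain ⟨C, hC⟩ := L.bdd_of_periodic (h := fun z => ‖G z‖) hd.continuous.norm
    (fun z => by rw [hper _ h1]) (fun z => by rw [hper _ h2])
  have hb : Bornology.IsBounded (range G) := by
    rw [isBounded_iff_forall_norm_le]
    exact ⟨C, by rintro _ ⟨z, rfl⟩; exact hC z⟩
  obtain ⟨c, hc⟩ := hd.exists_const_forall_eq_of_bounded hb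
  refine ⟨c, fun p => ?_⟩
  filter_upwards [hgG p] with z hz
  rw [hz, hc]

/-- value form -/
lemma liouville' {g : ℂ → ℂ} (hr : ∀ p, RemAt g p)
    (h1 : ∀ p, ∀ᶠ z in 𝓝[≠] p, g (z + L.ω₁) = g z)
    (h2 : ∀ p, ∀ᶠ z in 𝓝[≠] p, g (z + L.ω₂) = g z) :
    ∃ c, ∀ p, ContinuousAt g p → g p = c := by
  obtain ⟨c, hc⟩ := L.liouville hr h1 h2
  refine ⟨c, fun p hp => ?_⟩
  have t1 : Tendsto g (𝓝[≠] p) (𝓝 (g p)) := hp.tendsto.mono_left nhdsWithin_le_nhds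
  refine tendsto_nhds_unique (t1.congr' (hc p)) tendsto_const_nhds

lemma countable_lat : (L.lattice : Set ℂ).Countable := by
  have : Countable L.lattice := L.latticeEquivProd.toEquiv.countable_iff.mpr inferInstance
  exact Set.countable_coe_iff.mp this

lemma preconn {S : Set ℂ} (hS : S.Countable) : IsPreconnected Sᶜ := by
  have : 1 < Module.rank ℝ ℂ := by simp
  exact (hS.isPathConnected_compl_of_one_lt_rank this).isConnected.isPreconnected

/-- functions with zero derivative off the lattice are constant -/
lemma const_off {f : ℂ → ℂ} (h : ∀ z ∉ L.lattice, HasDerivAt f 0 z) {z w : ℂ} (hz : z ∉ L.lattice)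
    (hw : w ∉ L.lattice) : f z = f w := by
  refine L.isOpen_compl.is_const_of_deriv_eq_zero (preconn L.countable_lat)
    (fun x hx => (h x hx).differentiableAt.differentiableWithinAt) (fun x hx => (h x hx).deriv)
    hz hw

lemma punct (p : ℂ) : ∀ᶠ z in 𝓝[≠] p, z ∉ L.lattice := by
  have := L.compl_lattice_sdiff_singleton_mem_nhds p
  filter_upwards [mem_nhdsWithin_of_mem_nhds this, self_mem_nhdsWithin] with z a b
  intro h
  exact a ⟨h, b⟩

noncomputable def pet (l : ℂ) : ℂ := L.pz (L.ω₁ / 2 + l) - L.pz (L.ω₁ / 2)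

lemma add_nmem {z l : ℂ} (hl : l ∈ L.lattice) (hz : z ∉ L.lattice) : z + l ∉ L.lattice :=
  fun h => hz (by simpa using sub_mem h hl)

lemma neg_nmem {z : ℂ} (hz : z ∉ L.lattice) : -z ∉ L.lattice :=
  fun h => hz (by simpa using neg_mem h)

lemma pz_add {l : ℂ} (hl : l ∈ L.lattice) {z : ℂ} (hz : z ∉ L.lattice) :
    L.pz (z + l) = L.pz z + L.pet l := by
  have h : ∀ z ∉ L.lattice, HasDerivAt (fun z => L.pz (z + l) - L.pz z) 0 z := by
    intro z hz
    have h1 := (L.pz_hasDerivAt (L.add_nmem hl hz)).comp_add_const z l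
    have h2 := h1.sub (L.pz_hasDerivAt hz)
    convert! h2 using 1
    rw [show z + l = z + (⟨l, hl⟩ : L.lattice) from rfl, L.weierstrassP_add_coe]
    ring
  have := L.const_off h hz L.ω₁_div_two_notMem_lattice
  simp only [pet]
  linear_combination this

lemma pet_add {l m : ℂ} (hl : l ∈ L.lattice) (hm : m ∈ L.lattice) :
    L.pet (l + m) = L.pet l + L.pet m := by
  have h0 := L.ω₁_div_two_notMem_lattice
  have h1 := L.pz_add (add_mem hl hm) h0
  have h2 := L.pz_add hm (L.add_nmem hl h0)
  have h3 := L.pz_add hl h0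
  rw [add_assoc] at h2
  linear_combination h2 - h1 + h3

lemma pet_eq {a : ℂ} (h2 : 2 * a ∈ L.lattice) (ha : a ∉ L.lattice) : L.pet (2 * a) = 2 * L.pz a := by
  have := L.pz_add h2 (L.neg_nmem ha)
  rw [L.pz_neg, show -a + 2 * a = a by ring] at this
  linear_combination -this

lemma ps_add {l : ℂ} (hl : l ∈ L.lattice) :
    ∃ K : ℂ, K ≠ 0 ∧ ∀ z, L.ps (z + l) = K * Complex.exp (L.pet l * z) * L.ps z := by
  have h : ∀ z ∉ L.lattice, HasDerivAt
      (fun z => L.ps (z + l) / (Complex.exp (L.pet l * z) * L.ps z)) 0 z := by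
    intro z hz
    have h1 := (L.ps_hasDerivAt (L.add_nmem hl hz)).comp_add_const z l
    have h2 : HasDerivAt (fun z => Complex.exp (L.pet l * z)) _ z :=
      ((hasDerivAt_id z).const_mul (L.pet l)).cexp
    have hn : Complex.exp (L.pet l * z) * L.ps z ≠ 0 :=
      mul_ne_zero (Complex.exp_ne_zero _) (L.ps_ne hz)
    have h3 := h1.div (h2.mul (L.ps_hasDerivAt hz)) hn
    convert! h3 using 1
    rw [eq_comm, div_eq_zero_iff]
    left
    simp only [id, Pi.mul_apply]
    rw [L.pz_add hl hz]
    ring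
  have h0 := L.ω₁_div_two_notMem_lattice
  refine ⟨L.ps (L.ω₁ / 2 + l) / (Complex.exp (L.pet l * (L.ω₁ / 2)) * L.ps (L.ω₁ / 2)), ?_, ?_⟩
  · exact div_ne_zero (L.ps_ne (L.add_nmem hl h0))
      (mul_ne_zero (Complex.exp_ne_zero _) (L.ps_ne h0))
  · intro z
    by_cases hz : z ∈ L.lattice
    · rw [L.ps_eq_zero hz, L.ps_eq_zero (add_mem hz hl), mul_zero]
    · have := L.const_off h h0 hz
      rw [this, mul_assoc, div_mul_cancel₀]
      exact mul_ne_zero (Complex.exp_ne_zero _) (L.ps_ne hz)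

lemma legendre {l m : ℂ} (hl : l ∈ L.lattice) (hm : m ∈ L.lattice) :
    Complex.exp (L.pet l * m - L.pet m * l) = 1 := by
  obtain ⟨K, hK, h1⟩ := L.ps_add hl
  obtain ⟨M, hM, h2⟩ := L.ps_add hm
  have h0 := L.ps_ne L.ω₁_div_two_notMem_lattice
  set z := L.ω₁ / 2
  have e1 : L.ps (z + m + l) = L.ps (z + l + m) := by ring_nf
  rw [h1, h2, h2, h1, mul_add, mul_add, Complex.exp_add, Complex.exp_add] at e1
  rw [Complex.exp_sub, div_eq_one_iff_eq (Complex.exp_ne_zero _)]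
  have hc : K * M * Complex.exp (L.pet l * z) * Complex.exp (L.pet m * z) * L.ps z ≠ 0 := by
    simp [hK, hM, h0]
  apply mul_left_cancel₀ hc
  linear_combination e1

lemma exists_re (c₁ c₂ : ℝ) : ∃ b : ℂ, (b * L.ω₁).re = c₁ ∧ (b * L.ω₂).re = c₂ := by
  let φ : ℂ →ₗ[ℝ] ℝ := L.basis.constr ℝ ![c₁, c₂]
  have e : ∀ x : ℂ, ((⟨φ 1, -φ Complex.I⟩ : ℂ) * x).re = φ x := by
    intro x
    have : x = x.re • (1 : ℂ) + x.im • Complex.I := by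
      simp [Complex.re_add_im]
    conv_rhs => rw [this, map_add, map_smul, map_smul]
    simp [Complex.mul_re]; ring
  refine ⟨⟨φ 1, -φ Complex.I⟩, ?_, ?_⟩
  · rw [e]
    have := L.basis.constr_basis ℝ ![c₁, c₂] 0
    rwa [L.basis_zero] at this
  · rw [e]
    have := L.basis.constr_basis ℝ ![c₁, c₂] 1
    rwa [L.basis_one] at this

lemma nonprop (e : ℂ) (h1 : L.pet L.ω₁ = e * L.ω₁) (h2 : L.pet L.ω₂ = e * L.ω₂) : False := by
  obtain ⟨K, hK, k1⟩ := L.ps_add L.ω₁_mem_lattice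
  obtain ⟨M, hM, k2⟩ := L.ps_add L.ω₂_mem_lattice
  obtain ⟨b, b1, b2⟩ := L.exists_re (-Real.log ‖K‖ + (e * L.ω₁ ^ 2 / 2).re)
    (-Real.log ‖M‖ + (e * L.ω₂ ^ 2 / 2).re)
  set G : ℂ → ℂ := fun z => L.ps z * Complex.exp (-e * z ^ 2 / 2 + b * z) with hG
  have hGd : Differentiable ℂ G := by
    have := L.ps_diff
    fun_prop
  have key : ∀ (w K : ℂ), K ≠ 0 → (∀ z, L.ps (z + w) = K * Complex.exp (e * w * z) * L.ps z) →
      (b * w).re = -Real.log ‖K‖ + (e * w ^ 2 / 2).re → ∀ z, ‖G (z + w)‖ = ‖G z‖ := by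
    intro w K hK k hb z
    have : G (z + w) = (K * Complex.exp (-(e * w ^ 2 / 2) + b * w)) * G z := by
      simp only [hG, k]
      rw [show -e * (z + w) ^ 2 / 2 + b * (z + w) =
        -(e * w * z) + (-(e * w ^ 2 / 2) + b * w) + (-e * z ^ 2 / 2 + b * z) by ring,
        Complex.exp_add, Complex.exp_add, Complex.exp_neg]
      have := Complex.exp_ne_zero (e * w * z)
      field_simp
    rw [this, norm_mul, norm_mul, Complex.norm_exp, Complex.add_re, hb, Complex.neg_re]
    rw [show ∀ x : ℝ, -x + (-Real.log ‖K‖ + x) = -Real.log ‖K‖ from fun x => by ring,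
      Real.exp_neg, Real.exp_log (norm_pos_iff.mpr hK), mul_inv_cancel₀ (norm_ne_zero_iff.mpr hK),
      one_mul]
  rw [h1] at k1
  rw [h2] at k2
  obtain ⟨C, hC⟩ := L.bdd_of_periodic (h := fun z => ‖G z‖) hGd.continuous.norm
    (key _ K hK k1 b1) (key _ M hM k2 b2)
  have hb : Bornology.IsBounded (range G) := by
    rw [isBounded_iff_forall_norm_le]
    exact ⟨C, by rintro _ ⟨z, rfl⟩; exact hC z⟩
  obtain ⟨c, hc⟩ := hGd.exists_const_forall_eq_of_bounded hb
  have g0 : G 0 = 0 := by simp [hG, ps]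
  have g1 : G (L.ω₁ / 2) ≠ 0 :=
    mul_ne_zero (L.ps_ne L.ω₁_div_two_notMem_lattice) (Complex.exp_ne_zero _)
  rw [hc] at g0 g1
  exact g1 g0

end PeriodPair

open Metric Set Filter Topology

namespace PeriodPair
variable (L : PeriodPair)

lemma wp_rem {p : ℂ} (hp : p ∈ L.lattice) :
    RemAt (fun z => L.weierstrassP z - 1 / (z - p) ^ 2) p := by
  refine ⟨fun z => L.weierstrassPExcept p z - 1 / p ^ 2,
    (L.analyticAt_weierstrassPExcept p).sub analyticAt_const, .of_forall fun z => ?_⟩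
  have := L.weierstrassPExcept_add ⟨p, hp⟩ z
  simp only at this ⊢
  rw [← this]; ring

lemma wp_an {z : ℂ} (hz : z ∉ L.lattice) : AnalyticAt ℂ L.weierstrassP z :=
  L.analyticOnNhd_weierstrassP z hz

lemma pz_an {z : ℂ} (hz : z ∉ L.lattice) : AnalyticAt ℂ L.pz z := by
  rw [Complex.analyticAt_iff_eventually_differentiableAt]
  filter_upwards [L.isOpen_compl.mem_nhds hz] with w hw
  exact (L.pz_hasDerivAt hw).differentiableAt

lemma ps_an (z : ℂ) : AnalyticAt ℂ L.ps z := L.ps_diff.analyticAt z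

lemma deriv_ps_ne {p : ℂ} (hp : p ∈ L.lattice) : deriv L.ps p ≠ 0 := by
  obtain ⟨K, hK, h⟩ := L.ps_add hp
  have h1 : HasDerivAt (fun z => L.ps (z + p)) (deriv L.ps (0 + p)) 0 :=
    (L.ps_diff (0 + p)).hasDerivAt.comp_add_const 0 p
  have h2 : HasDerivAt (fun z => Complex.exp (L.pet p * z)) _ 0 :=
      ((hasDerivAt_id (0 : ℂ)).const_mul (L.pet p)).cexp
  have h3 := (h2.const_mul K).mul L.ps_hasDerivAt_zero
  have h4 : (fun z => L.ps (z + p)) = fun z => K * Complex.exp (L.pet p * z) * L.ps z := funext h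
  rw [h4] at h1
  have := h1.unique h3
  simp [ps] at this
  rw [this]; exact hK

lemma pz_zero : ∃ ψ : ℂ → ℂ, AnalyticAt ℂ ψ 0 ∧ ψ 0 = 0 ∧
    ∀ᶠ z in 𝓝[≠] (0 : ℂ), L.pz z = 1 / z + ψ z := by
  have hg : AnalyticAt ℂ L.pg 0 := L.pg_diff.analyticAt 0
  refine ⟨fun z => deriv L.pg z / L.pg z, hg.deriv.div hg (by simp [pg_zero]), ?_, ?_⟩
  · have ev : (fun z => L.pg (-z)) = L.pg := by
      funext z
      simp only [pg]
      rw [← (Equiv.neg L.lattice).tprod_eq]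
      congr 1
      ext l
      simp
    have h1 := deriv_comp_neg L.pg 0
    rw [ev] at h1
    have : deriv L.pg 0 = 0 := by
      have : 2 * deriv L.pg 0 = 0 := by
        rw [neg_zero] at h1
        linear_combination h1
      simpa using this
    simp [this]
  · filter_upwards [L.punct 0, self_mem_nhdsWithin] with z hz hz0
    have hz0 : z ≠ 0 := hz0
    have h1 := (L.ps_hasDerivAt hz).unique ((hasDerivAt_id z).mul (L.pg_diff z).hasDerivAt)
    have := L.pg_ne hz
    simp only [ps, id, one_mul] at h1
    field_simp
    linear_combination h1

noncomputable def ell (a z : ℂ) : ℂ := L.pz a + L.pz (z - a) - L.pz z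

noncomputable def eF (a z : ℂ) : ℂ :=
  L.ell a z ^ 2 - L.weierstrassP z - L.weierstrassP (z - a)

lemma sub_nmem {z l : ℂ} (hl : l ∈ L.lattice) (hz : z ∉ L.lattice) : z - l ∉ L.lattice :=
  fun h => hz (by simpa using add_mem h hl)

lemma punct' (p a : ℂ) : ∀ᶠ z in 𝓝[≠] p, z - a ∉ L.lattice := by
  have := tendsto_punct_comp (f := fun z : ℂ => z - a) (by fun_prop) (sub_left_injective) p
  exact this.eventually (L.punct _)

lemma ell_add {a l z : ℂ} (hl : l ∈ L.lattice) (hz : z ∉ L.lattice) (hza : z - a ∉ L.lattice) :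
    L.ell a (z + l) = L.ell a z := by
  simp only [ell]
  rw [L.pz_add hl hz, show z + l - a = z - a + l by ring, L.pz_add hl hza]; ring

lemma wp_add {l : ℂ} (hl : l ∈ L.lattice) (z : ℂ) : L.weierstrassP (z + l) = L.weierstrassP z :=
  L.weierstrassP_add_coe z ⟨l, hl⟩

lemma eF_add {a l z : ℂ} (hl : l ∈ L.lattice) (hz : z ∉ L.lattice) (hza : z - a ∉ L.lattice) :
    L.eF a (z + l) = L.eF a z := by
  simp only [eF]
  rw [L.ell_add hl hz hza, L.wp_add hl, show z + l - a = z - a + l by ring, L.wp_add hl]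

lemma eF_refl (a z : ℂ) : L.eF a (a - z) = L.eF a z := by
  simp only [eF, ell]
  rw [show a - z - a = -z by ring, ← neg_sub z a, L.pz_neg, L.pz_neg, L.weierstrassP_neg,
    L.weierstrassP_neg]
  ring

lemma eF_an {a z : ℂ} (hz : z ∉ L.lattice) (hza : z - a ∉ L.lattice) :
    AnalyticAt ℂ (L.eF a) z := by
  have h1 : AnalyticAt ℂ (fun z : ℂ => z - a) z := by fun_prop
  have h2 := AnalyticAt.fun_comp (f := fun z : ℂ => z - a) (L.pz_an hza) h1
  have h3 := AnalyticAt.fun_comp (f := fun z : ℂ => z - a) (L.wp_an hza) h1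
  exact ((((analyticAt_const (v := L.pz a)).add h2).sub (L.pz_an hz)).pow 2 |>.sub
    (L.wp_an hz)).sub h3

lemma eF_rem0 {a : ℂ} (ha : a ∉ L.lattice) : RemAt (L.eF a) 0 := by
  obtain ⟨ψ, h1, h2, h3⟩ := L.pz_zero
  have hna : (0 : ℂ) - a ∉ L.lattice := by simpa using ha
  have hs : AnalyticAt ℂ (fun z : ℂ => z - a) 0 := by fun_prop
  have k2 := AnalyticAt.fun_comp (f := fun z : ℂ => z - a) (L.pz_an hna) hs
  have k3 := AnalyticAt.fun_comp (f := fun z : ℂ => z - a) (L.wp_an hna) hs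
  have k4 : AnalyticAt ℂ (fun z => L.pz a + L.pz (z - a) - ψ z) 0 :=
    ((analyticAt_const (v := L.pz a)).add k2).sub h1
  obtain ⟨χ, c1, c2, -⟩ := analytic_factor k4 (by simp [h2, L.pz_neg])
  obtain ⟨P, p1, p2⟩ := L.wp_rem (zero_mem _)
  refine ⟨fun z => -2 * χ z + z ^ 2 * χ z ^ 2 - P z - L.weierstrassP (z - a), by fun_prop, ?_⟩
  filter_upwards [h3, p2, self_mem_nhdsWithin] with z a1 a2 hz0
  have hz0 : z ≠ 0 := hz0
  have a3 := c2 z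
  simp only [sub_zero] at a2 a3
  have e1 : L.ell a z = -(1 / z) + z * χ z := by
    rw [ell, a1]
    linear_combination a3
  rw [eF, e1, ← a2]
  field_simp
  ring

lemma eF_const {a : ℂ} (ha : a ∉ L.lattice) :
    ∃ c, ∀ z ∉ L.lattice, z - a ∉ L.lattice → L.eF a z = c := by
  have hl : ∀ p ∈ L.lattice, RemAt (L.eF a) p := by
    intro p hp
    have h1 : RemAt (fun z => L.eF a (z + -p)) p := by
      apply RemAt.comp_add
      rw [add_neg_cancel]
      exact L.eF_rem0 ha
    refine h1.congr ?_
    filter_upwards [L.punct p, L.punct' p a] with z h2 h3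
    rw [L.eF_add (neg_mem hp) h2 h3]
  have hr : ∀ p, RemAt (L.eF a) p := by
    intro p
    by_cases hp : p ∈ L.lattice
    · exact hl p hp
    by_cases hpa : p - a ∈ L.lattice
    · have h1 : RemAt (fun z => L.eF a (a - z)) p := by
        apply RemAt.comp_sub
        apply hl
        simpa using neg_mem hpa
      refine h1.congr (.of_forall fun z => ?_)
      rw [L.eF_refl]
    · exact .of_analytic (L.eF_an hp hpa)
  have hper : ∀ w ∈ L.lattice, ∀ p, ∀ᶠ z in 𝓝[≠] p, L.eF a (z + w) = L.eF a z := by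
    intro w hw p
    filter_upwards [L.punct p, L.punct' p a] with z h2 h3
    rw [L.eF_add hw h2 h3]
  obtain ⟨c, hc⟩ := L.liouville' hr (hper _ L.ω₁_mem_lattice) (hper _ L.ω₂_mem_lattice)
  exact ⟨c, fun z hz hza => hc z (L.eF_an hz hza).continuousAt⟩

lemma eF_univ : ∃ c, ∀ a ∉ L.lattice, ∀ z ∉ L.lattice, z - a ∉ L.lattice →
    L.eF a z = L.weierstrassP a + c := by
  have sym : ∀ a z, L.eF a z - L.weierstrassP a = L.eF z a - L.weierstrassP z := by
    intro a z
    simp only [eF, ell]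
    rw [← neg_sub z a, L.pz_neg, L.weierstrassP_neg]
    ring
  have h0 := L.ω₁_div_two_notMem_lattice
  set b := L.ω₁ / 2
  obtain ⟨c, hc⟩ := L.eF_const h0
  refine ⟨c - L.weierstrassP b, fun a ha z hz hza => ?_⟩
  obtain ⟨d, hd⟩ := L.eF_const ha
  -- choose w generic
  obtain ⟨w, w1, w2, w3⟩ := ((L.punct 0).and ((L.punct' 0 a).and (L.punct' 0 b))).exists
  have e1 := hc w w1 w3
  have e2 := hd w w1 w2
  have e3 := hd z hz hza
  obtain ⟨f, hf⟩ := L.eF_const w1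
  have nn : ∀ x, w - x ∉ L.lattice → x - w ∉ L.lattice := fun x hx h => hx (by simpa using neg_mem h)
  have f1 := hf b h0 (nn _ w3)
  have f2 := hf a ha (nn _ w2)
  have s1 := sym b w
  have s2 := sym a w
  rw [e3]
  rw [e1, f1] at s1
  rw [e2, f2] at s2
  linear_combination s2 - s1

lemma wp_surj (B : ℂ) : ∃ a ∉ L.lattice, L.weierstrassP a = B := by
  by_contra hcon
  push Not at hcon
  have hne : ∀ z ∉ L.lattice, L.weierstrassP z - B ≠ 0 := fun z hz => sub_ne_zero.mpr (hcon z hz)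
  set g : ℂ → ℂ := fun z => (L.weierstrassP z - B)⁻¹ with hg
  have hrl : ∀ p ∈ L.lattice, ∃ φ : ℂ → ℂ, AnalyticAt ℂ φ p ∧ φ p = 0 ∧ ∀ᶠ z in 𝓝[≠] p, g z = φ z := by
    intro p hp
    obtain ⟨P, p1, p2⟩ := L.wp_rem hp
    refine ⟨fun z => (z - p) ^ 2 / (1 + (z - p) ^ 2 * (P z - B)), ?_, by simp, ?_⟩
    · have : AnalyticAt ℂ (fun z : ℂ => (z - p) ^ 2) p := by fun_prop
      refine this.div (analyticAt_const.add (this.mul (p1.sub analyticAt_const))) (by simp)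
    · filter_upwards [p2, self_mem_nhdsWithin] with z h1 h2
      have h2 : z - p ≠ 0 := sub_ne_zero.mpr h2
      have : L.weierstrassP z - B = (1 + (z - p) ^ 2 * (P z - B)) / (z - p) ^ 2 := by
        rw [← h1]; field_simp; ring
      rw [hg]; simp only
      rw [this, inv_div]
  have han : ∀ p ∉ L.lattice, AnalyticAt ℂ g p := fun p hp =>
    ((L.wp_an hp).sub analyticAt_const).inv (hne p hp)
  have hr : ∀ p, RemAt g p := by
    intro p
    by_cases hp : p ∈ L.lattice
    · obtain ⟨φ, h1, -, h2⟩ := hrl p hp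
      exact ⟨φ, h1, h2⟩
    · exact .of_analytic (han p hp)
  obtain ⟨c, hc⟩ := L.liouville hr
    (fun p => .of_forall fun z => by rw [hg]; simp only; rw [L.wp_add L.ω₁_mem_lattice])
    (fun p => .of_forall fun z => by rw [hg]; simp only; rw [L.wp_add L.ω₂_mem_lattice])
  obtain ⟨φ, h1, h0, h2⟩ := hrl 0 (zero_mem _)
  have hc0 : c = 0 := by
    have t : Tendsto φ (𝓝[≠] 0) (𝓝 0) := by
      have := h1.continuousAt.tendsto.mono_left (nhdsWithin_le_nhds (s := {0}ᶜ))
      rwa [h0] at this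
    have : Tendsto φ (𝓝[≠] 0) (𝓝 c) := by
      refine tendsto_const_nhds.congr' ?_
      filter_upwards [h2, hc 0] with z a b
      rw [← a, b]
    exact tendsto_nhds_unique this t
  obtain ⟨z, hz, hzc⟩ := ((L.punct 0).and (hc 0)).exists
  rw [hc0] at hzc
  exact inv_ne_zero (hne z hz) hzc

noncomputable def py (a z : ℂ) : ℂ := Complex.exp (L.pz a * z) * L.ps (z - a) / L.ps z

lemma py_an (a : ℂ) {z : ℂ} (hz : z ∉ L.lattice) : AnalyticAt ℂ (L.py a) z := by
  have h1 : AnalyticAt ℂ (fun z : ℂ => z - a) z := by fun_prop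
  have h2 := AnalyticAt.fun_comp (f := fun z : ℂ => z - a) (L.ps_an (z - a)) h1
  have h3 : AnalyticAt ℂ (fun z : ℂ => Complex.exp (L.pz a * z)) z := by fun_prop
  exact (h3.mul h2).div (L.ps_an z) (L.ps_ne hz)

lemma py_ne {a z : ℂ} (hz : z ∉ L.lattice) (hza : z - a ∉ L.lattice) : L.py a z ≠ 0 :=
  div_ne_zero (mul_ne_zero (Complex.exp_ne_zero _) (L.ps_ne hza)) (L.ps_ne hz)

lemma py_hasDerivAt {a z : ℂ} (hz : z ∉ L.lattice) (hza : z - a ∉ L.lattice) :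
    HasDerivAt (L.py a) (L.ell a z * L.py a z) z := by
  have h1 := (L.ps_hasDerivAt hza).comp_sub_const z a
  have h2 : HasDerivAt (fun z => Complex.exp (L.pz a * z)) _ z :=
    ((hasDerivAt_id z).const_mul (L.pz a)).cexp
  have h3 := (h2.mul h1).div (L.ps_hasDerivAt hz) (L.ps_ne hz)
  convert! h3 using 1
  have := L.ps_ne hz
  simp only [py, ell, id, Pi.mul_apply]
  field_simp

lemma ell_hasDerivAt {a z : ℂ} (hz : z ∉ L.lattice) (hza : z - a ∉ L.lattice) :
    HasDerivAt (L.ell a) (L.weierstrassP z - L.weierstrassP (z - a)) z := by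
  have h1 := (L.pz_hasDerivAt hza).comp_sub_const z a
  have h2 := (h1.const_add (L.pz a)).sub (L.pz_hasDerivAt hz)
  convert! h2 using 1
  ring

lemma py_ode : ∃ c, ∀ a ∉ L.lattice, ∀ z ∉ L.lattice,
    deriv (deriv (L.py a)) z = (2 * L.weierstrassP z + L.weierstrassP a + c) * L.py a z := by
  obtain ⟨c, hc⟩ := L.eF_univ
  refine ⟨c, fun a ha => ?_⟩
  have h1 : ∀ z ∉ L.lattice, z - a ∉ L.lattice →
    deriv (deriv (L.py a)) z = (2 * L.weierstrassP z + L.weierstrassP a + c) * L.py a z := by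
    intro z hz hza
    have ev : deriv (L.py a) =ᶠ[𝓝 z] fun z => L.ell a z * L.py a z := by
      have o2 : IsOpen {z | z - a ∉ L.lattice} :=
        L.isOpen_compl.preimage (f := fun z => z - a) (by fun_prop)
      filter_upwards [L.isOpen_compl.mem_nhds hz, o2.mem_nhds hza] with w w1 w2
      exact (L.py_hasDerivAt w1 w2).deriv
    rw [ev.deriv_eq, ((L.ell_hasDerivAt hz hza).fun_mul (L.py_hasDerivAt hz hza)).deriv]
    have := hc a ha z hz hza
    simp only [eF] at this
    linear_combination this * L.py a z
  intro z hz
  have c1 : ContinuousAt (deriv (deriv (L.py a))) z := (L.py_an a hz).deriv.deriv.continuousAt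
  have c2 : ContinuousAt (fun z => (2 * L.weierstrassP z + L.weierstrassP a + c) * L.py a z) z := by
    have i1 := (L.wp_an hz).continuousAt
    have i2 := (L.py_an a hz).continuousAt
    fun_prop
  refine tendsto_nhds_unique (c1.tendsto.mono_left (nhdsWithin_le_nhds (s := {z}ᶜ)))
    ((c2.tendsto.mono_left nhdsWithin_le_nhds).congr' ?_)
  filter_upwards [L.punct z, L.punct' z a] with w w1 w2
  exact (h1 w w1 w2).symm

lemma py_add {a l : ℂ} (hl : l ∈ L.lattice) (z : ℂ) :
    L.py a (z + l) = Complex.exp (L.pz a * l - L.pet l * a) * L.py a z := by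
  obtain ⟨K, hK, h⟩ := L.ps_add hl
  simp only [py]
  rw [show z + l - a = z - a + l by ring, h, h]
  by_cases hz : z ∈ L.lattice
  · simp [L.ps_eq_zero hz]
  have := L.ps_ne hz
  rw [show L.pz a * (z + l) = L.pz a * z + (L.pz a * l - L.pet l * a) + L.pet l * a by ring,
    Complex.exp_add, Complex.exp_add, mul_sub, Complex.exp_sub (L.pet l * z)]
  field_simp

lemma deriv_py_self {a : ℂ} (ha : a ∉ L.lattice) : deriv (L.py a) a ≠ 0 := by
  have h1 : HasDerivAt (fun z => L.ps (z - a)) 1 a := by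
    have := L.ps_hasDerivAt_zero
    rw [← sub_self a] at this
    exact this.comp_sub_const a a
  have h2 : HasDerivAt (fun z => Complex.exp (L.pz a * z)) _ a :=
    ((hasDerivAt_id a).const_mul (L.pz a)).cexp
  have h3 := (h2.mul h1).div (L.ps_hasDerivAt ha) (L.ps_ne ha)
  have h4 : HasDerivAt (L.py a) _ a := h3
  have := L.ps_ne ha
  rw [h4.deriv]
  have : L.ps 0 = 0 := by simp [ps]
  simp [this, L.ps_ne ha, Complex.exp_ne_zero]

lemma py_self (a : ℂ) : L.py a a = 0 := by simp [py, ps]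

end PeriodPair

open Metric Set Filter Topology

noncomputable def wl (a b : ℂ) : ℂ →L[ℝ] ℂ :=
  a • (ContinuousLinearMap.id ℝ ℂ) + b • (Complex.conjCLE : ℂ →L[ℝ] ℂ)

lemma wl_apply (a b h : ℂ) : wl a b h = a * h + b * (starRingEnd ℂ) h := by
  simp [wl]

/-- `g` is real differentiable with Wirtinger derivatives `a`, `b` -/
def HW (g : ℂ → ℂ) (a b z : ℂ) : Prop := HasFDerivAt (𝕜 := ℝ) g (wl a b) z

lemma HW.continuousAt {g : ℂ → ℂ} {a b z : ℂ} (h : HW g a b z) : ContinuousAt g z :=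
  HasFDerivAt.continuousAt h

lemma HW.cast {g : ℂ → ℂ} {a b a' b' z : ℂ} (h : HW g a b z) (ha : a' = a) (hb : b' = b) :
    HW g a' b' z := by rw [ha, hb]; exact h

lemma HW.congr {g k : ℂ → ℂ} {a b z : ℂ} (h : HW g a b z) (e : k =ᶠ[𝓝 z] g) : HW k a b z :=
  HasFDerivAt.congr_of_eventuallyEq h e

lemma hw_const (c z : ℂ) : HW (fun _ => c) 0 0 z := by
  have := hasFDerivAt_const (𝕜 := ℝ) c z
  unfold HW
  convert! this using 1
  ext1 x
  simp [wl_apply]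

lemma HW.add {g k : ℂ → ℂ} {a b a' b' z : ℂ} (h : HW g a b z) (h' : HW k a' b' z) :
    HW (fun w => g w + k w) (a + a') (b + b') z := by
  have := HasFDerivAt.add h h'
  unfold HW
  convert! this using 1
  ext1 x
  simp [wl_apply]; ring

lemma HW.mul {g k : ℂ → ℂ} {a b a' b' z : ℂ} (h : HW g a b z) (h' : HW k a' b' z) :
    HW (fun w => g w * k w) (a * k z + g z * a') (b * k z + g z * b') z := by
  have := HasFDerivAt.mul h h'
  unfold HW
  convert! this using 1
  ext1 x
  simp [wl_apply]; ring

lemma HW.neg {g : ℂ → ℂ} {a b z : ℂ} (h : HW g a b z) : HW (fun w => - g w) (-a) (-b) z := by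
  have := HasFDerivAt.neg h
  unfold HW
  convert! this using 1
  ext1 x
  simp [wl_apply]; ring

lemma HW.sub {g k : ℂ → ℂ} {a b a' b' z : ℂ} (h : HW g a b z) (h' : HW k a' b' z) :
    HW (fun w => g w - k w) (a - a') (b - b') z := by
  have := HasFDerivAt.sub h h'
  unfold HW
  convert! this using 1
  ext1 x
  simp [wl_apply]; ring

lemma HW.conj {g : ℂ → ℂ} {a b z : ℂ} (h : HW g a b z) :
    HW (fun w => (starRingEnd ℂ) (g w)) ((starRingEnd ℂ) b) ((starRingEnd ℂ) a) z := by
  have := (Complex.conjCLE : ℂ →L[ℝ] ℂ).hasFDerivAt.comp z h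
  unfold HW
  convert! this using 1
  ext1 x
  simp [wl_apply]; ring

lemma HW.of_deriv {g : ℂ → ℂ} {a z : ℂ} (h : HasDerivAt g a z) : HW g a 0 z := by
  have := h.hasFDerivAt.restrictScalars ℝ
  unfold HW
  convert! this using 1
  ext1 x
  simp [wl_apply]; ring

lemma HW.hasDerivAt {g : ℂ → ℂ} {a z : ℂ} (h : HW g a 0 z) : HasDerivAt g a z := by
  have h' : HasFDerivAt (𝕜 := ℝ) g (wl a 0) z := h
  have e : (ContinuousLinearMap.restrictScalars ℝ
    (ContinuousLinearMap.toSpanSingleton ℂ a : ℂ →L[ℂ] ℂ)) = wl a 0 := by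
    ext1 x
    simp [wl_apply]; ring
  rw [hasDerivAt_iff_hasFDerivAt]
  exact hasFDerivAt_of_restrictScalars ℝ h' e

lemma HW.compL {f g : ℂ → ℂ} {f' a b z : ℂ} (h : HW g a b z) (hf : HasDerivAt f f' (g z)) :
    HW (fun w => f (g w)) (f' * a) (f' * b) z := by
  have := (hf.hasFDerivAt.restrictScalars ℝ).comp z h
  unfold HW
  convert! this using 1
  ext1 x
  simp [wl_apply]; ring

lemma HW.compR {g φ : ℂ → ℂ} {φ' a b z : ℂ} (h : HW g a b (φ z)) (hf : HasDerivAt φ φ' z) :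
    HW (fun w => g (φ w)) (a * φ') (b * (starRingEnd ℂ) φ') z := by
  have := HasFDerivAt.comp z h (hf.hasFDerivAt.restrictScalars ℝ)
  unfold HW
  convert! this using 1
  ext1 x
  simp [wl_apply]; ring

lemma HW.unique {g : ℂ → ℂ} {a b a' b' z : ℂ} (h : HW g a b z) (h' : HW g a' b' z) :
    a = a' ∧ b = b' := by
  have e := HasFDerivAt.unique h h'
  have e1 := congrArg (fun f => f 1) e
  have e2 := congrArg (fun f => f Complex.I) e
  simp only [wl_apply, map_one, Complex.conj_I] at e1 e2
  have e3 : a - b = a' - b' := by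
    have := congrArg (fun x => -Complex.I * x) e2
    ring_nf at this
    simp only [Complex.I_sq] at this
    linear_combination this
  constructor
  · linear_combination (e1 + e3) / 2
  · linear_combination (e1 - e3) / 2

/-- derivative along a real line -/
lemma HW.hasDerivAt_line {g : ℂ → ℂ} {a b : ℂ} {γ : ℝ → ℂ} {γ' : ℂ} {t : ℝ} (h : HW g a b (γ t))
    (hγ : HasDerivAt γ γ' t) :
    HasDerivAt (fun t => g (γ t)) (a * γ' + b * (starRingEnd ℂ) γ') t := by
  have := HasFDerivAt.comp_hasDerivAt t h hγ
  rwa [wl_apply] at this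

noncomputable def wirtb (g : ℂ → ℂ) (z : ℂ) : ℂ :=
  (1 / 2) * (fderiv ℝ g z (1 : ℂ) + Complex.I * fderiv ℝ g z Complex.I)

lemma hw_wirt {g : ℂ → ℂ} {z : ℂ} (h : DifferentiableAt ℝ g z) : HW g (wirt g z) (wirtb g z) z := by
  have := h.hasFDerivAt
  unfold HW
  convert! this using 1
  ext1 x
  have e : fderiv ℝ g z x = x.re * fderiv ℝ g z 1 + x.im * fderiv ℝ g z Complex.I := by
    have h1 : x = x.re • (1 : ℂ) + x.im • Complex.I := by
      apply Complex.ext <;> simp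
    conv_lhs => rw [h1]
    rw [map_add, map_smul, map_smul]
    simp
  have e1 : x = x.re + x.im * Complex.I := (Complex.re_add_im x).symm
  have e2 : (starRingEnd ℂ) x = x.re - x.im * Complex.I := by
    apply Complex.ext <;> simp
  rw [wl_apply, e, e2]
  nth_rewrite 1 [e1]
  simp only [wirt, wirtb]
  linear_combination (-(x.im:ℂ) * fderiv ℝ g z Complex.I) * Complex.I_sq

lemma fderiv_symm {g : ℂ → ℂ} {z : ℂ} (h : ContDiffAt ℝ 2 g z) (a b : ℂ) :
    fderiv ℝ (fun w => fderiv ℝ g w a) z b = fderiv ℝ (fun w => fderiv ℝ g w b) z a := by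
  have hs : IsSymmSndFDerivAt ℝ g z := h.isSymmSndFDerivAt (by simp)
  have hd : DifferentiableAt ℝ (fderiv ℝ g) z :=
    (h.fderiv_right (m := 1) (by norm_num)).differentiableAt (by norm_num)
  have e : ∀ a b, fderiv ℝ (fun w => fderiv ℝ g w a) z b = fderiv ℝ (fderiv ℝ g) z b a := by
    intro a b
    rw [fderiv_clm_apply hd (by fun_prop)]
    simp
  rw [e, e]
  exact hs b a

lemma cd_dir {g : ℂ → ℂ} {z : ℂ} {n : ℕ} (h : ContDiffAt ℝ (n + 1 : ℕ) g z) (a : ℂ) :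
    ContDiffAt ℝ n (fun w => fderiv ℝ g w a) z := by
  have := h.fderiv_right (m := n) (by norm_cast)
  exact this.clm_apply contDiffAt_const

lemma cd_wirt {g : ℂ → ℂ} {z : ℂ} {n : ℕ} (h : ContDiffAt ℝ (n + 1 : ℕ) g z) :
    ContDiffAt ℝ n (wirt g) z :=
  contDiffAt_const.mul ((cd_dir h 1).sub (contDiffAt_const.mul (cd_dir h Complex.I)))

lemma wirt_comm {g : ℂ → ℂ} {z : ℂ} (h : ContDiffAt ℝ (2 : ℕ) g z) :
    wirtb (wirt g) z = (1 / 4) * (fderiv ℝ (fun w => fderiv ℝ g w 1) z 1 +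
      fderiv ℝ (fun w => fderiv ℝ g w Complex.I) z Complex.I) ∧
    wirt (wirtb g) z = (1 / 4) * (fderiv ℝ (fun w => fderiv ℝ g w 1) z 1 +
      fderiv ℝ (fun w => fderiv ℝ g w Complex.I) z Complex.I) := by
  have h1 : DifferentiableAt ℝ (fun w => fderiv ℝ g w 1) z :=
    (cd_dir (n := 1) h 1).differentiableAt (by norm_num)
  have h2 : DifferentiableAt ℝ (fun w => fderiv ℝ g w Complex.I) z :=
    (cd_dir (n := 1) h Complex.I).differentiableAt (by norm_num)
  have sy := fderiv_symm (by exact_mod_cast h) 1 Complex.I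
  have f1 : HasFDerivAt (wirt g) ((1 / 2 : ℂ) • (fderiv ℝ (fun w => fderiv ℝ g w 1) z -
    Complex.I • fderiv ℝ (fun w => fderiv ℝ g w Complex.I) z)) z :=
    (h1.hasFDerivAt.sub (h2.hasFDerivAt.const_mul Complex.I)).const_mul (1 / 2)
  have f2 : HasFDerivAt (wirtb g) ((1 / 2 : ℂ) • (fderiv ℝ (fun w => fderiv ℝ g w 1) z +
    Complex.I • fderiv ℝ (fun w => fderiv ℝ g w Complex.I) z)) z :=
    (h1.hasFDerivAt.add (h2.hasFDerivAt.const_mul Complex.I)).const_mul (1 / 2)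
  constructor
  · simp only [wirtb, f1.fderiv]
    simp only [smul_apply, sub_apply, smul_eq_mul, sy]
    linear_combination (-1 / 4) * fderiv ℝ (fun w => fderiv ℝ g w Complex.I) z Complex.I * Complex.I_sq
  · simp only [wirt, f2.fderiv]
    simp only [smul_apply, add_apply, smul_eq_mul, sy]
    linear_combination (-1 / 4) * fderiv ℝ (fun w => fderiv ℝ g w Complex.I) z Complex.I * Complex.I_sq

lemma wirt_add (g : ℂ → ℂ) (c z : ℂ) : wirt (fun w => g (w + c)) z = wirt g (z + c) := by
  simp only [wirt, fderiv_comp_add_right]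

lemma wirt_refl (g : ℂ → ℂ) (c z : ℂ) : wirt (fun w => g (c - w)) z = -wirt g (c - z) := by
  have h := (ContinuousLinearEquiv.neg ℝ (M := ℂ)).comp_right_fderiv (f := fun w => g (w + c)) (x := z)
  have e : (fun w => g (w + c)) ∘ (ContinuousLinearEquiv.neg ℝ (M := ℂ)) = fun w => g (c - w) := by
    ext w; simp [sub_eq_neg_add]
  rw [e] at h
  simp only [wirt, h, fderiv_comp_add_right]
  simp [sub_eq_neg_add]; ring

/-- package for solutions -/
lemma sol_pkg {v : ℂ → ℝ} {U : Set ℂ} (hU : IsOpen U)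
    (hv : ∀ z ∈ U, (∀ n : ℕ, ContDiffAt ℝ n v z) ∧ lapl v z + Real.exp (v z) = 0) :
    let u : ℂ → ℂ := fun z => (v z : ℂ)
    let p := wirt u
    let s := wirt p
    ∀ z ∈ U, HW u (p z) ((starRingEnd ℂ) (p z)) z ∧ HW p (s z) (-Complex.exp (u z) / 4) z ∧
      HW s (wirt s z) (-Complex.exp (u z) * p z / 4) z := by
  intro u p s
  have hcd : ∀ z ∈ U, ∀ n : ℕ, ContDiffAt ℝ n u z := fun z hz n =>
    Complex.ofRealCLM.contDiff.contDiffAt.comp z ((hv z hz).1 n)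
  have hfd : ∀ z ∈ U, ∀ a, fderiv ℝ u z a = (fderiv ℝ v z a : ℂ) := by
    intro z hz a
    have h1 := ((hv z hz).1 1).differentiableAt (by norm_num)
    have : HasFDerivAt u _ z := Complex.ofRealCLM.hasFDerivAt.comp z h1.hasFDerivAt
    rw [this.fderiv]
    simp
  have hu : ∀ z ∈ U, HW u (p z) ((starRingEnd ℂ) (p z)) z := by
    intro z hz
    refine (hw_wirt ((hcd z hz 1).differentiableAt (by norm_num))).cast rfl ?_
    simp only [p, wirt, wirtb, hfd z hz]
    simp
    left; exact Complex.conj_ofNat 2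
  have hpb : ∀ z ∈ U, wirtb p z = -Complex.exp (u z) / 4 := by
    intro z hz
    rw [show wirtb p z = _ from (wirt_comm (hcd z hz 2)).1]
    have hr : ∀ a, fderiv ℝ (fun w => fderiv ℝ u w a) z a =
        (fderiv ℝ (fun w => fderiv ℝ v w a) z a : ℂ) := by
      intro a
      have ev : (fun w => fderiv ℝ u w a) =ᶠ[𝓝 z] fun w => (fderiv ℝ v w a : ℂ) := by
        filter_upwards [hU.mem_nhds hz] with w hw using hfd w hw a
      rw [ev.fderiv_eq]
      have h2 : DifferentiableAt ℝ (fun w => fderiv ℝ v w a) z := by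
        have := ((hv z hz).1 2).fderiv_right (m := 1) (by norm_num)
        exact (this.clm_apply contDiffAt_const).differentiableAt (by norm_num)
      have : HasFDerivAt (fun w => (fderiv ℝ v w a : ℂ)) _ z :=
        Complex.ofRealCLM.hasFDerivAt.comp z h2.hasFDerivAt
      rw [this.fderiv]
      simp
    rw [hr, hr]
    have := (hv z hz).2
    simp only [lapl] at this
    simp only [u]
    rw [← Complex.ofReal_exp, ← Complex.ofReal_add, eq_neg_of_add_eq_zero_left this]
    push_cast; ring
  have hp : ∀ z ∈ U, HW p (s z) (-Complex.exp (u z) / 4) z := by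
    intro z hz
    have h1 : ContDiffAt ℝ (1 : ℕ) p z := cd_wirt (hcd z hz 2)
    exact (hw_wirt (h1.differentiableAt (by norm_num))).cast rfl (hpb z hz).symm
  intro z hz
  refine ⟨hu z hz, hp z hz, ?_⟩
  have h1 : ContDiffAt ℝ (1 : ℕ) s z := cd_wirt (n := 1) (cd_wirt (n := 2) (hcd z hz 3))
  refine (hw_wirt (h1.differentiableAt (by norm_num))).cast rfl ?_
  have h2 : ContDiffAt ℝ (2 : ℕ) p z := cd_wirt (n := 2) (hcd z hz 3)
  have h3 := wirt_comm h2
  rw [show wirtb s z = _ from h3.1, ← h3.2]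
  have ev : wirtb p =ᶠ[𝓝 z] fun w => -Complex.exp (u w) / 4 := by
    filter_upwards [hU.mem_nhds hz] with w hw using hpb w hw
  have h4 : HW (fun w => -Complex.exp (u w) / 4) (-Complex.exp (u z) * p z / 4)
      (-Complex.exp (u z) * (starRingEnd ℂ) (p z) / 4) z := by
    have h5 := (hu z hz).compL (f := fun w => -Complex.exp w / 4) (f' := -Complex.exp (u z) / 4)
      ((Complex.hasDerivAt_exp (u z)).neg.div_const 4)
    exact h5.cast (by ring) (by ring)
  have h6 : HW (wirtb p) _ _ z := h4.congr ev
  have h7 := h6.unique (hw_wirt (HasFDerivAt.differentiableAt h6))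
  exact h7.1


open Metric Set Filter Topology

def hpl (x1 : ℝ) : Set ℂ := {z | z.re < x1}

lemma hpl_open (x1 : ℝ) : IsOpen (hpl x1) := isOpen_lt Complex.continuous_re continuous_const

/-- the point `x + i y` -/
noncomputable def pt (x y : ℝ) : ℂ := (x : ℂ) + (y : ℂ) * Complex.I

lemma pt_re (x y : ℝ) : (pt x y).re = x := by simp [pt]

lemma pt_mem {x1 x : ℝ} (h : x < x1) (y : ℝ) : pt x y ∈ hpl x1 := by
  simpa [hpl, pt_re] using h

lemma pt_cont : Continuous (fun q : ℝ × ℝ => pt q.1 q.2) := by unfold pt; fun_prop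

noncomputable def Jv (H : ℂ → ℂ) (x : ℝ) : ℂ := ∫ y in (0:ℝ)..(2 * Real.pi), H (pt x y)

lemma Jv_int {H : ℂ → ℂ} {x1 x : ℝ} (h : ContinuousOn H (hpl x1)) (hx : x < x1) (a b : ℝ) :
    IntervalIntegrable (fun y => H (pt x y)) MeasureTheory.volume a b := by
  apply Continuous.intervalIntegrable
  exact h.comp_continuous (by unfold pt; fun_prop) (fun y => pt_mem hx y)

lemma Jv_add {H K : ℂ → ℂ} {x1 x : ℝ} (h : ContinuousOn H (hpl x1)) (h' : ContinuousOn K (hpl x1))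
    (hx : x < x1) : Jv (fun z => H z + K z) x = Jv H x + Jv K x :=
  intervalIntegral.integral_add (Jv_int h hx _ _) (Jv_int h' hx _ _)

lemma Jv_mul (c : ℂ) (H : ℂ → ℂ) (x : ℝ) : Jv (fun z => c * H z) x = c * Jv H x :=
  intervalIntegral.integral_const_mul _ _

lemma Jv_deriv {H a b : ℂ → ℂ} {x1 x : ℝ} (hH : ∀ z ∈ hpl x1, HW H (a z) (b z) z)
    (ha : ContinuousOn a (hpl x1)) (hb : ContinuousOn b (hpl x1)) (hx : x < x1) :
    HasDerivAt (Jv H) (Jv (fun z => a z + b z) x) x := by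
  have hcH : ContinuousOn H (hpl x1) := fun z hz => (hH z hz).continuousAt.continuousWithinAt
  obtain ⟨x2, hx2, hx21⟩ := exists_between hx
  have hcomp : IsCompact (Icc (x - 1) x2 ×ˢ uIcc (0:ℝ) (2 * Real.pi)) :=
    isCompact_Icc.prod isCompact_uIcc
  have hc : ContinuousOn (fun q : ℝ × ℝ => a (pt q.1 q.2) + b (pt q.1 q.2))
      (Icc (x - 1) x2 ×ˢ uIcc (0:ℝ) (2 * Real.pi)) := by
    refine (ha.add hb).comp pt_cont.continuousOn ?_
    rintro ⟨u, y⟩ ⟨hu, -⟩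
    exact pt_mem (lt_of_le_of_lt hu.2 hx21) y
  obtain ⟨C, hC⟩ := hcomp.exists_bound_of_continuousOn hc
  have hs : Icc (x - 1) x2 ∈ 𝓝 x := Icc_mem_nhds (by linarith) hx2
  refine (intervalIntegral.hasDerivAt_integral_of_dominated_loc_of_deriv_le
    (F := fun x y => H (pt x y)) (F' := fun x y => a (pt x y) + b (pt x y))
    (bound := fun _ => C) hs ?_ (Jv_int hcH hx _ _) ?_ ?_ (by simp) ?_).2
  · filter_upwards [hs] with u hu
    exact (Jv_int hcH (lt_of_le_of_lt hu.2 hx21) _ _).def'.aestronglyMeasurable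
  · exact (Jv_int (ha.add hb) hx _ _).def'.aestronglyMeasurable
  · refine Eventually.of_forall fun y hy u hu => hC (u, y) ⟨hu, uIoc_subset_uIcc hy⟩
  · refine Eventually.of_forall fun y hy u hu => ?_
    have h1 := (hH (pt u y) (pt_mem (lt_of_le_of_lt hu.2 hx21) y))
    have h2 : HasDerivAt (fun t : ℝ => pt t y) 1 u := by
      unfold pt
      simpa using (Complex.ofRealCLM.hasDerivAt (x := u)).add_const ((y:ℂ) * Complex.I)
    have h3 := HW.hasDerivAt_line (γ := fun t : ℝ => pt t y) h1 h2
    simpa using h3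

lemma Jv_per {H a b : ℂ → ℂ} {x1 x : ℝ} (hH : ∀ z ∈ hpl x1, HW H (a z) (b z) z)
    (ha : ContinuousOn a (hpl x1)) (hb : ContinuousOn b (hpl x1)) (hx : x < x1)
    (hper : ∀ z, H (z + 2 * Real.pi * Complex.I) = H z) :
    Jv a x = Jv b x := by
  have key : ∫ y in (0:ℝ)..(2 * Real.pi), (a (pt x y) * Complex.I - b (pt x y) * Complex.I) =
      H (pt x (2 * Real.pi)) - H (pt x 0) := by
    refine intervalIntegral.integral_eq_sub_of_hasDerivAt (f := fun y => H (pt x y)) ?_ ?_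
    · intro y _
      have h1 := hH (pt x y) (pt_mem hx y)
      have h2 : HasDerivAt (fun t : ℝ => pt x t) Complex.I y := by
        unfold pt
        simpa using ((Complex.ofRealCLM.hasDerivAt (x := y)).mul_const Complex.I).const_add (x:ℂ)
      have h3 := HW.hasDerivAt_line (γ := fun t : ℝ => pt x t) h1 h2
      convert! h3 using 1
      simp; ring
    · exact ((Jv_int ha hx _ _).mul_const _).sub ((Jv_int hb hx _ _).mul_const _)
  have h0 : H (pt x (2 * Real.pi)) = H (pt x 0) := by
    rw [← hper (pt x 0)]; congr 1; simp [pt]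
  rw [h0, sub_self, intervalIntegral.integral_sub ((Jv_int ha hx _ _).mul_const _)
    ((Jv_int hb hx _ _).mul_const _), intervalIntegral.integral_mul_const,
    intervalIntegral.integral_mul_const, ← sub_mul, mul_eq_zero] at key
  exact sub_eq_zero.1 (key.resolve_right Complex.I_ne_zero)

lemma Jv_d {H a b : ℂ → ℂ} {x1 x : ℝ} (hH : ∀ z ∈ hpl x1, HW H (a z) (b z) z)
    (ha : ContinuousOn a (hpl x1)) (hb : ContinuousOn b (hpl x1)) (hx : x < x1)
    (hper : ∀ z, H (z + 2 * Real.pi * Complex.I) = H z) :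
    HasDerivAt (Jv H) (2 * Jv a x) x ∧ HasDerivAt (Jv H) (2 * Jv b x) x := by
  have h1 := Jv_deriv hH ha hb hx
  have h2 := Jv_per hH ha hb hx hper
  rw [Jv_add ha hb hx] at h1
  constructor
  · convert! h1 using 1; rw [h2]; ring
  · convert! h1 using 1; rw [h2]; ring

lemma Jv_bound {H : ℂ → ℂ} {k : ℂ → ℝ} {x1 x : ℝ} (hk : ContinuousOn k (hpl x1)) (hx : x < x1)
    (hb : ∀ y, ‖H (pt x y)‖ ≤ k (pt x y)) :
    ‖Jv H x‖ ≤ ∫ y in (0:ℝ)..(2 * Real.pi), k (pt x y) := by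
  refine intervalIntegral.norm_integral_le_of_norm_le (by positivity)
    (Eventually.of_forall fun y _ => hb y) ?_
  apply Continuous.intervalIntegrable
  exact hk.comp_continuous (by unfold pt; fun_prop) (fun y => pt_mem hx y)

/-- removable singularity through vanishing of integrals -/
lemma laurent {g : ℂ → ℂ} {R : ℝ} (hR : 0 < R) (hg : ∀ w ∈ ball (0:ℂ) R, w ≠ 0 → DifferentiableAt ℂ g w)
    (hI : ∀ w0 ∈ ball (0:ℂ) R, ∃ r, 0 < r ∧ r < R ∧ (w0 ≠ 0 → r < ‖w0‖) ∧
      (∮ w in C(0, r), (w - w0)⁻¹ * g w) = 0) :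
    ∃ φ : ℂ → ℂ, AnalyticAt ℂ φ 0 ∧ φ 0 = 0 ∧ ∀ᶠ w in 𝓝[≠] 0, g w = φ w := by
  set R' := R / 2 with hR'
  have hR0 : 0 < R' := by positivity
  have hRR : R' < R := by rw [hR']; linarith
  have hgc : ∀ r1 r2, 0 < r1 → r2 < R → ContinuousOn g (closedBall 0 r2 \ ball 0 r1) := by
    intro r1 r2 h1 h2 w hw
    have : w ≠ 0 := by rintro rfl; exact hw.2 (mem_ball_self h1)
    exact (hg w (closedBall_subset_ball h2 hw.1) this).continuousAt.continuousWithinAt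
  have hci : ∀ r, 0 < r → r < R → ContinuousOn g (sphere 0 r) := by
    intro r h1 h2
    refine (hgc r r h1 h2).mono fun w hw => ⟨sphere_subset_closedBall hw, ?_⟩
    simp at hw ⊢; exact hw.ge
  let φ : ℂ → ℂ := fun w0 => (2 * Real.pi * Complex.I : ℂ)⁻¹ • ∮ w in C(0, R'), (w - w0)⁻¹ • g w
  have hφ : AnalyticAt ℂ φ 0 := by
    have := hasFPowerSeriesOn_cauchy_integral (f := g) (c := 0) (R := ⟨R', hR0.le⟩)
      ((hci R' hR0 hRR).circleIntegrable hR0.le) (by exact_mod_cast hR0)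
    exact this.analyticAt
  have h2pi : (2 * Real.pi * Complex.I : ℂ) ≠ 0 := by
    simp [Real.pi_ne_zero, Complex.I_ne_zero]
  refine ⟨φ, hφ, ?_, ?_⟩
  · obtain ⟨r, h0, hr, -, h1⟩ := hI 0 (mem_ball_self hR)
    have key : ∀ r, 0 < r → r < R → ∀ r', 0 < r' → r' ≤ r → (∮ w in C(0, r), (w - 0)⁻¹ • g w) =
        ∮ w in C(0, r'), (w - 0)⁻¹ • g w := by
      intro r h0 hr r' h0' hrr
      refine Complex.circleIntegral_sub_center_inv_smul_eq_of_differentiable_on_annulus_off_countable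
        h0' hrr countable_empty (hgc r' r h0' hr) ?_
      intro w hw
      refine hg w (ball_subset_ball hr.le hw.1.1) ?_
      rintro rfl; exact hw.1.2 (mem_closedBall_self h0'.le)
    have : (∮ w in C(0, R'), (w - 0)⁻¹ • g w) = 0 := by
      rcases le_total r R' with h | h
      · rw [key R' hR0 hRR r h0 h]; exact h1
      · rw [← key r h0 hr R' hR0 h]; exact h1
    simp only [φ, this, smul_zero]
  · have hev : ∀ᶠ w in 𝓝[≠] (0:ℂ), w ∈ ball (0:ℂ) R' ∧ w ≠ 0 := by
      filter_upwards [nhdsWithin_le_nhds (ball_mem_nhds (0:ℂ) hR0), self_mem_nhdsWithin] with w h1 h2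
      exact ⟨h1, h2⟩
    filter_upwards [hev] with w0 hw0
    obtain ⟨hw0, hne⟩ := hw0
    have hw0' : ‖w0‖ < R' := by simpa using hw0
    obtain ⟨r, h0, hr, hrw, h1⟩ := hI w0 (ball_subset_ball hRR.le hw0)
    have hrw := hrw hne
    have hrR' : r < R' := hrw.trans hw0'
    have hgw : DifferentiableAt ℂ g w0 := hg w0 (ball_subset_ball hRR.le hw0) hne
    have hann : (∮ w in C(0, R'), dslope g w0 w) = ∮ w in C(0, r), dslope g w0 w := by
      refine Complex.circleIntegral_eq_of_differentiable_on_annulus_off_countable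
        h0 hrR'.le (countable_singleton w0) ?_ ?_
      · intro w hw
        rcases eq_or_ne w w0 with rfl | h
        · exact (continuousAt_dslope_same.2 hgw).continuousWithinAt
        · exact ((continuousAt_dslope_of_ne h).2 (hg w (closedBall_subset_ball hRR hw.1) (by
            rintro rfl; exact hw.2 (mem_ball_self h0))).continuousAt).continuousWithinAt
      · intro w hw
        have h : w ≠ w0 := hw.2
        rw [differentiableAt_dslope_of_ne h]
        refine hg w (ball_subset_ball hRR.le hw.1.1) (by
            rintro rfl; exact hw.1.2 (mem_closedBall_self h0.le))
    have hsp : ∀ r, 0 < r → r < R → r ≠ ‖w0‖ → (∮ w in C(0, r), dslope g w0 w) =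
        (∮ w in C(0, r), (w - w0)⁻¹ • g w) - (∮ w in C(0, r), (w - w0)⁻¹) * g w0 := by
      intro r h0 hr hrn
      have hn : ∀ w ∈ sphere (0:ℂ) r, w ≠ w0 := by
        rintro w hw rfl; simp at hw; exact hrn hw.symm
      have hc : ContinuousOn (fun w => (w - w0)⁻¹) (sphere (0:ℂ) r) :=
        (continuousOn_id.sub continuousOn_const).inv₀ fun z hz => sub_ne_zero.2 (hn z hz)
      have e : ∀ w ∈ sphere (0:ℂ) r, dslope g w0 w = (w - w0)⁻¹ • g w - (w - w0)⁻¹ • g w0 := by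
        intro w hw
        rw [dslope_of_ne _ (hn w hw), slope_def_field]; simp; ring
      rw [circleIntegral.integral_congr h0.le e, circleIntegral.integral_sub
        (f := fun w => (w - w0)⁻¹ • g w) (g := fun w => (w - w0)⁻¹ • g w0)
        ((hc.smul (hci r h0 hr)).circleIntegrable h0.le)
        ((hc.smul continuousOn_const).circleIntegrable h0.le), circleIntegral.integral_smul_const]
      rfl
    rw [hsp R' hR0 hRR hw0'.ne', hsp r h0 hr hrw.ne] at hann
    have hz : (∮ w in C(0, r), (w - w0)⁻¹) = 0 := by
      refine Complex.circleIntegral_eq_zero_of_differentiable_on_off_countable h0.le countable_empty ?_ ?_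
      · intro w hw
        refine ContinuousAt.continuousWithinAt ?_
        have : w - w0 ≠ 0 := by
          intro h; rw [sub_eq_zero] at h; subst h; simp at hw; linarith
        fun_prop (disch := assumption)
      · intro w hw
        have : w - w0 ≠ 0 := by
          intro h; rw [sub_eq_zero] at h; subst h
          have := hw.1; simp at this; linarith
        fun_prop (disch := assumption)
    rw [hz, circleIntegral.integral_sub_inv_of_mem_ball hw0, zero_mul, sub_zero] at hann
    simp only [smul_eq_mul] at hann
    rw [h1, sub_eq_zero] at hann
    simp only [φ, smul_eq_mul, hann]
    field_simp

open Metric Set Filter Topology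

lemma blow {M N N' : ℝ → ℝ} {X c B : ℝ} (hc : 0 < c) (hM : ∀ x < X, HasDerivAt M (N x) x)
    (hN : ∀ x < X, HasDerivAt N (N' x) x) (h : ∀ x < X, c ≤ N' x) (hB : ∀ x < X, |M x| ≤ B) :
    False := by
  have h1 : ∀ x ∈ Iio X, ∀ y ∈ Iio X, x ≤ y → c * (y - x) ≤ N y - N x := by
    refine (convex_Iio X).mul_sub_le_image_sub_of_le_deriv
      (fun x hx => (hN x hx).continuousAt.continuousWithinAt) ?_ ?_
    · intro x hx; rw [interior_Iio] at hx
      exact (hN x hx).differentiableAt.differentiableWithinAt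
    · intro x hx; rw [interior_Iio] at hx
      rw [(hN x hx).deriv]; exact h x hx
  set x0 := X - 1 with hx0
  set x2 := x0 - (|N x0| + 1) / c with hx2
  have hpos : 0 < (|N x0| + 1) / c := by positivity
  have h2 : ∀ x < x2, N x ≤ -1 := by
    intro x hx
    have := h1 x (by simp; linarith) x0 (by simp [hx0]) (by linarith)
    have h3 : (|N x0| + 1) / c ≤ x0 - x := by linarith
    rw [div_le_iff₀ hc] at h3
    have := le_abs_self (N x0)
    linarith
  have h3 : ∀ x ∈ Iio x2, ∀ y ∈ Iio x2, x ≤ y → 1 * (y - x) ≤ (-M) y - (-M) x := by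
    have hd : ∀ x < x2, HasDerivAt (-M) (- N x) x := fun x hx => (hM x (by linarith)).neg
    refine (convex_Iio x2).mul_sub_le_image_sub_of_le_deriv
      (fun x hx => (hd x hx).continuousAt.continuousWithinAt) ?_ ?_
    · intro x hx; rw [interior_Iio] at hx
      exact (hd x hx).differentiableAt.differentiableWithinAt
    · intro x hx; rw [interior_Iio] at hx
      rw [(hd x hx).deriv]; linarith [h2 x hx]
  have hB0 : 0 ≤ B := (abs_nonneg _).trans (hB x0 (by simp [hx0]))
  have h4 := h3 (x2 - 1 - 2 * B - 1) (by simp; linarith) (x2 - 1) (by simp) (by linarith)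
  have h5 := abs_le.1 (hB (x2 - 1) (by linarith))
  have h6 := abs_le.1 (hB (x2 - 1 - 2 * B - 1) (by linarith))
  simp only [Pi.neg_apply] at h4
  linarith

lemma exp_small (A ε : ℝ) (hε : 0 < ε) : ∃ X : ℝ, ∀ x < X, A * Real.exp (6 * x) ≤ ε := by
  have h : Tendsto (fun x : ℝ => A * Real.exp (6 * x)) atBot (𝓝 (A * 0)) :=
    (Real.tendsto_exp_atBot.comp (tendsto_id.const_mul_atBot (by norm_num : (0:ℝ) < 6))).const_mul A
  rw [mul_zero] at h
  have := h.eventually (eventually_le_nhds hε)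
  obtain ⟨X, hX⟩ := eventually_atBot.1 this
  exact ⟨X, fun x hx => hX x hx.le⟩

lemma Jv_re {f : ℂ → ℝ} (x : ℝ) : Jv (fun z => (f z : ℂ)) x =
    ((∫ y in (0:ℝ)..(2 * Real.pi), f (pt x y) : ℝ) : ℂ) := by
  unfold Jv; exact intervalIntegral.integral_ofReal

lemma Jv_const_bound {H : ℂ → ℂ} {c x : ℝ} (h : ∀ y, ‖H (pt x y)‖ ≤ c) :
    ‖Jv H x‖ ≤ c * (2 * Real.pi) := by
  have := intervalIntegral.norm_integral_le_of_norm_le_const (a := (0:ℝ)) (b := 2 * Real.pi)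
    (f := fun y => H (pt x y)) (C := c) (fun y _ => h y)
  rwa [sub_zero, abs_of_pos (by positivity)] at this

lemma energy {Vr : ℂ → ℝ} {P Q E : ℂ → ℂ} {x1 C : ℝ}
    (hV : ∀ z ∈ hpl x1, HW (fun z => (Vr z : ℂ)) (P z) ((starRingEnd ℂ) (P z)) z)
    (hP : ∀ z ∈ hpl x1, HW P (Q z) (-E z / 4) z)
    (hQ : ContinuousOn Q (hpl x1)) (hE : ContinuousOn E (hpl x1))
    (hVp : ∀ z, Vr (z + 2 * Real.pi * Complex.I) = Vr z)
    (hPp : ∀ z, P (z + 2 * Real.pi * Complex.I) = P z)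
    (hVb : ∀ z ∈ hpl x1, |Vr z| ≤ C) (hEb : ∀ z ∈ hpl x1, ‖E z‖ ≤ C * Real.exp (6 * z.re))
    (δ X : ℝ) (hδ : 0 < δ) :
    ∃ x, x < x1 ∧ x < X ∧ (∫ y in (0:ℝ)..(2 * Real.pi), ‖P (pt x y)‖ ^ 2) < δ := by
  by_contra! hcon
  have cV : ContinuousOn (fun z => (Vr z : ℂ)) (hpl x1) :=
    fun z hz => (hV z hz).continuousAt.continuousWithinAt
  have cP : ContinuousOn P (hpl x1) := fun z hz => (hP z hz).continuousAt.continuousWithinAt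
  have cPb : ContinuousOn (fun z => (starRingEnd ℂ) (P z)) (hpl x1) :=
    Complex.continuous_conj.comp_continuousOn cP
  have hM : ∀ x < x1, HasDerivAt (Jv (fun z => (Vr z : ℂ) * Vr z)) (4 * Jv (fun z => Vr z * P z) x) x := by
    intro x hx
    have := (Jv_d (fun z hz => (hV z hz).mul (hV z hz)) (by fun_prop) (by fun_prop) hx
      (by intro z; simp only [hVp])).1
    convert! this using 1
    rw [show (fun z => P z * (Vr z : ℂ) + Vr z * P z) = fun z => 2 * (Vr z * P z) by ext; ring, Jv_mul]
    ring
  have hN : ∀ x < x1, HasDerivAt (Jv (fun z => (Vr z : ℂ) * P z))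
      (2 * Jv (fun z => (starRingEnd ℂ) (P z) * P z + Vr z * (-E z / 4)) x) x := by
    intro x hx
    exact (Jv_d (fun z hz => (hV z hz).mul (hP z hz)) (by fun_prop) (by fun_prop) hx
      (by intro z; simp only [hVp, hPp])).2
  obtain ⟨X2, hX2⟩ := exp_small (C * C / 4 * (2 * Real.pi)) (δ / 2) (by positivity)
  refine blow (M := fun x => (Jv (fun z => (Vr z : ℂ) * Vr z) x).re)
    (N := fun x => (4 * Jv (fun z => (Vr z : ℂ) * P z) x).re)
    (N' := fun x => (4 * (2 * Jv (fun z => (starRingEnd ℂ) (P z) * P z + Vr z * (-E z / 4)) x)).re)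
    (X := min x1 (min X X2)) (c := 4 * δ) (B := C * C * (2 * Real.pi)) (by positivity) ?_ ?_ ?_ ?_
  · intro x hx
    have := hM x (lt_of_lt_of_le hx (min_le_left _ _))
    exact Complex.reCLM.hasFDerivAt.comp_hasDerivAt x this
  · intro x hx
    have := (hN x (lt_of_lt_of_le hx (min_le_left _ _))).const_mul 4
    exact Complex.reCLM.hasFDerivAt.comp_hasDerivAt x this
  · intro x hx
    simp only [lt_min_iff] at hx
    obtain ⟨hx1, hxX, hxX2⟩ := hx
    have h1 := hcon x hx1 hxX
    have h2 := hX2 x hxX2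
    rw [Jv_add (x1 := x1) (by fun_prop) (by fun_prop) hx1]
    have e1 : Jv (fun z => (starRingEnd ℂ) (P z) * P z) x =
        ((∫ y in (0:ℝ)..(2 * Real.pi), ‖P (pt x y)‖ ^ 2 : ℝ) : ℂ) := by
      rw [← Jv_re (f := fun z => ‖P z‖ ^ 2)]
      congr 1; ext z
      rw [mul_comm, Complex.mul_conj, Complex.normSq_eq_norm_sq]
    have e2 : ‖Jv (fun z => (Vr z : ℂ) * (-E z / 4)) x‖ ≤ C * (C * Real.exp (6 * x) / 4) * (2 * Real.pi) := by
      refine Jv_const_bound fun y => ?_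
      have hz := pt_mem hx1 y
      have hEz := hEb _ hz
      rw [pt_re] at hEz
      have hVz := hVb _ hz
      rw [norm_mul, Complex.norm_real, norm_div, norm_neg, Real.norm_eq_abs]
      have : ‖(4:ℂ)‖ = 4 := by simp
      rw [this]
      gcongr
      exact (abs_nonneg _).trans hVz
    have e3 := (abs_le.1 ((Complex.abs_re_le_norm _).trans e2)).1
    rw [e1]
    simp only [Complex.mul_re, Complex.add_re, Complex.ofReal_re, Complex.re_ofNat, Complex.im_ofNat, zero_mul, sub_zero]
    nlinarith
  · intro x hx
    have hx1 := lt_of_lt_of_le hx (min_le_left _ _)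
    refine (Complex.abs_re_le_norm _).trans (Jv_const_bound fun y => ?_)
    have hVz := hVb _ (pt_mem hx1 y)
    rw [norm_mul, Complex.norm_real, Real.norm_eq_abs]
    exact mul_le_mul hVz hVz (abs_nonneg _) ((abs_nonneg _).trans hVz)

lemma energy2 {Vr : ℂ → ℝ} {P Q E K : ℂ → ℂ} {x1 C : ℝ}
    (hV : ∀ z ∈ hpl x1, HW (fun z => (Vr z : ℂ)) (P z) ((starRingEnd ℂ) (P z)) z)
    (hP : ∀ z ∈ hpl x1, HW P (Q z) (-E z / 4) z)
    (hQ : ContinuousOn Q (hpl x1)) (hE : ContinuousOn E (hpl x1))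
    (hVp : ∀ z, Vr (z + 2 * Real.pi * Complex.I) = Vr z)
    (hPp : ∀ z, P (z + 2 * Real.pi * Complex.I) = P z)
    (hQp : ∀ z, Q (z + 2 * Real.pi * Complex.I) = Q z)
    (hVb : ∀ z ∈ hpl x1, |Vr z| ≤ C) (hEb : ∀ z ∈ hpl x1, ‖E z‖ ≤ C * Real.exp (6 * z.re))
    (hG : DifferentiableOn ℂ (fun z => Q z - 3 * P z - P z ^ 2 / 2) (hpl x1))
    (hK : DifferentiableOn ℂ K (hpl x1)) (hKp : ∀ z, K (z + 2 * Real.pi * Complex.I) = K z)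
    (hKb : ∀ z ∈ hpl x1, ‖K z‖ ≤ C) (hKb' : ∀ z ∈ hpl x1, ‖deriv K z‖ ≤ C) (hC : 0 < C)
    (x0 : ℝ) (hx0 : x0 < x1) :
    Jv (fun z => (Q z - 3 * P z - P z ^ 2 / 2) * K z) x0 = 0 := by
  set G : ℂ → ℂ := fun z => Q z - 3 * P z - P z ^ 2 / 2 with hGd
  have cP : ContinuousOn P (hpl x1) := fun z hz => (hP z hz).continuousAt.continuousWithinAt
  have cK : ContinuousOn K (hpl x1) := hK.continuousOn
  have cK' : ContinuousOn (deriv K) (hpl x1) := (hK.deriv (hpl_open x1)).continuousOn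
  have hKd : ∀ z ∈ hpl x1, HasDerivAt K (deriv K z) z := fun z hz =>
    (hK.differentiableAt ((hpl_open x1).mem_nhds hz)).hasDerivAt
  have hGK : DifferentiableOn ℂ (fun z => G z * K z) (hpl x1) := hG.mul hK
  -- constancy
  have hconst : ∀ x < x1, Jv (fun z => G z * K z) x = Jv (fun z => G z * K z) x0 := by
    have hd : ∀ x < x1, HasDerivAt (Jv (fun z => G z * K z)) 0 x := by
      intro x hx
      have := (Jv_d (H := fun z => G z * K z) (a := deriv (fun z => G z * K z)) (b := fun _ => 0)
        (fun z hz => HW.of_deriv (hGK.differentiableAt ((hpl_open x1).mem_nhds hz)).hasDerivAt)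
        (hGK.deriv (hpl_open x1)).continuousOn continuousOn_const hx
        (by intro z; simp only [hGd, hPp, hQp, hKp])).2
      simpa [Jv] using this
    intro x hx
    exact isOpen_Iio.is_const_of_deriv_eq_zero isPreconnected_Iio
      (fun x hx => (hd x hx).differentiableAt.differentiableWithinAt)
      (fun x hx => (hd x hx).deriv) hx hx0
  -- identity
  have hid : ∀ x < x1, Jv (fun z => G z * K z) x =
      Jv (fun z => (-E z / 4) * K z - P z * deriv K z - 3 * P z * K z - P z ^ 2 / 2 * K z) x := by
    intro x hx
    have h1 := Jv_per (H := fun z => P z * K z) (a := fun z => Q z * K z + P z * deriv K z)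
      (b := fun z => (-E z / 4) * K z) (fun z hz => ((hP z hz).mul (HW.of_deriv (hKd z hz))).cast
        rfl (by ring)) (by fun_prop) (by fun_prop) hx (by intro z; simp only [hPp, hKp])
    set F : ℂ → ℂ := fun z => - P z * deriv K z - 3 * P z * K z - P z ^ 2 / 2 * K z with hF
    have cF : ContinuousOn F (hpl x1) := by fun_prop
    have e1 : Jv (fun z => G z * K z) x = Jv (fun z => (Q z * K z + P z * deriv K z) + F z) x := by
      congr 1; ext z; simp only [hGd, hF]; ring
    have e2 : Jv (fun z => (-E z / 4) * K z - P z * deriv K z - 3 * P z * K z - P z ^ 2 / 2 * K z) x =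
        Jv (fun z => ((-E z / 4) * K z) + F z) x := by
      congr 1; ext z; simp only [hF]; ring
    rw [e1, e2, Jv_add (x1 := x1) (by fun_prop) cF hx, Jv_add (x1 := x1) (by fun_prop) cF hx, h1]
  -- smallness
  rw [← norm_le_zero_iff]
  refine le_of_forall_pos_le_add fun ε hε => ?_
  rw [zero_add]
  set η := ε / (3 * (8 * Real.pi * C)) with hη
  have hη0 : 0 < η := by positivity
  obtain ⟨X, hX⟩ := exp_small (C * C * (2 * Real.pi)) (ε / 3) (by positivity)
  obtain ⟨x, hx1, hxX, hx⟩ := energy hV hP hQ hE hVp hPp hVb hEb (ε / 3 / (4 * C / η + C)) X (by positivity)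
  have hA := hX x hxX
  rw [← hconst x hx1, hid x hx1]
  have cn : ContinuousOn (fun z => ‖P z‖ ^ 2) (hpl x1) := by fun_prop
  have hb : ∀ y, ‖(-E (pt x y) / 4) * K (pt x y) - P (pt x y) * deriv K (pt x y) -
      3 * P (pt x y) * K (pt x y) - P (pt x y) ^ 2 / 2 * K (pt x y)‖ ≤
      (C * C * Real.exp (6 * x) + 4 * C * η) + (4 * C / η + C) * ‖P (pt x y)‖ ^ 2 := by
    intro y
    have hz := pt_mem hx1 y
    have hEz := hEb _ hz
    rw [pt_re] at hEz
    have b1 := hKb _ hz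
    have b2 := hKb' _ hz
    generalize pt x y = z at *
    have n1 : ‖(-E z / 4) * K z‖ ≤ (C * Real.exp (6 * x) / 4) * C := by
      rw [norm_mul, norm_div, norm_neg, show ‖(4:ℂ)‖ = 4 by simp]; gcongr
    have n2 : ‖P z * deriv K z‖ ≤ ‖P z‖ * C := by rw [norm_mul]; gcongr
    have n3 : ‖3 * P z * K z‖ ≤ 3 * ‖P z‖ * C := by
      rw [norm_mul, norm_mul, show ‖(3:ℂ)‖ = 3 by simp]; gcongr
    have n4 : ‖P z ^ 2 / 2 * K z‖ ≤ ‖P z‖ ^ 2 / 2 * C := by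
      rw [norm_mul, norm_div, norm_pow, show ‖(2:ℂ)‖ = 2 by simp]; gcongr
    have n5 : ‖P z‖ ≤ η + ‖P z‖ ^ 2 / η := by
      have : ‖P z‖ * η ≤ η * η + ‖P z‖ ^ 2 := by nlinarith [sq_nonneg (‖P z‖ - η), norm_nonneg (P z)]
      have h2 : η + ‖P z‖ ^ 2 / η = (η * η + ‖P z‖ ^ 2) / η := by field_simp
      rw [h2, le_div_iff₀ hη0]; exact this
    have n6 := (norm_sub_le ((-E z / 4) * K z - P z * deriv K z - 3 * P z * K z) (P z ^ 2 / 2 * K z))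
    have n7 := (norm_sub_le ((-E z / 4) * K z - P z * deriv K z) (3 * P z * K z))
    have n8 := (norm_sub_le ((-E z / 4) * K z) (P z * deriv K z))
    have n9 : 4 * C * ‖P z‖ ≤ 4 * C * (η + ‖P z‖ ^ 2 / η) := by gcongr
    have n10 : 4 * C * (η + ‖P z‖ ^ 2 / η) = 4 * C * η + 4 * C / η * ‖P z‖ ^ 2 := by ring
    have n11 : 0 ≤ C * Real.exp (6 * x) * C := by positivity
    have n12 : 0 ≤ C * ‖P z‖ ^ 2 := by positivity
    linarith
  refine (Jv_bound (x1 := x1) (k := fun z => (C * C * Real.exp (6 * x) + 4 * C * η) + (4 * C / η + C) * ‖P z‖ ^ 2)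
    (by fun_prop) hx1 hb).trans ?_
  have cc : Continuous fun y => ‖P (pt x y)‖ ^ 2 := by
    exact cn.comp_continuous (by unfold pt; fun_prop) (fun y => pt_mem hx1 y)
  rw [intervalIntegral.integral_add (by simp) ((cc.intervalIntegrable _ _).const_mul _),
    intervalIntegral.integral_const, intervalIntegral.integral_const_mul]
  rw [lt_div_iff₀ (by positivity)] at hx
  have h8 : 8 * Real.pi * C * η = ε / 3 := by rw [hη]; field_simp
  rw [smul_eq_mul]
  nlinarith

open Metric Set Filter Topology

lemma S_holo {v : ℂ → ℝ} {U : Set ℂ} (hU : IsOpen U)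
    (hv : ∀ z ∈ U, (∀ n : ℕ, ContDiffAt ℝ n v z) ∧ lapl v z + Real.exp (v z) = 0) :
    let p := wirt (fun z => (v z : ℂ))
    ∀ z ∈ U, DifferentiableAt ℂ (fun z => wirt p z - p z ^ 2 / 2) z := by
  intro p z hz
  obtain ⟨-, h2, h3⟩ := sol_pkg hU hv z hz
  have h4 := h3.sub ((h2.mul h2).mul (hw_const (1 / 2) z))
  have h5 : HW (fun z => wirt p z - p z ^ 2 / 2) _ 0 z :=
    (h4.cast rfl (by ring)).congr (Eventually.of_forall fun w => by simp only [p]; ring)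
  exact h5.hasDerivAt.differentiableAt

lemma hw_re (z : ℂ) : HW (fun z => ((4 * z.re : ℝ) : ℂ)) 2 2 z := by
  have h := HW.of_deriv (hasDerivAt_id z)
  have h2 := (((h.add h.conj).mul (hw_const 2 z)))
  refine (h2.cast (by simp) (by simp)).congr (Eventually.of_forall fun w => ?_)
  apply Complex.ext <;> simp <;> ring

lemma sing_local {v : ℂ → ℝ} {p0 : ℂ} {R C : ℝ} (hR : 0 < R)
    (hv : ∀ z ∈ ball p0 R, z ≠ p0 → (∀ n : ℕ, ContDiffAt ℝ n v z) ∧ lapl v z + Real.exp (v z) = 0)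
    (hb : ∀ z, z ≠ p0 → dist z p0 < R → |v z - 4 * Real.log (dist z p0)| ≤ C) :
    let p := wirt (fun z => (v z : ℂ))
    ∃ ψ : ℂ → ℂ, AnalyticAt ℂ ψ p0 ∧ ∀ᶠ z in 𝓝[≠] p0,
      wirt p z - p z ^ 2 / 2 + 4 / (z - p0) ^ 2 = ψ z / (z - p0) := by
  intro p
  set U : Set ℂ := ball p0 R \ {p0} with hUd
  have hU : IsOpen U := isOpen_ball.sdiff isClosed_singleton
  have hvU : ∀ z ∈ U, (∀ n : ℕ, ContDiffAt ℝ n v z) ∧ lapl v z + Real.exp (v z) = 0 :=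
    fun z hz => hv z hz.1 hz.2
  have pk := sol_pkg hU hvU
  have hS := S_holo hU hvU
  set s := wirt p with hs
  set S : ℂ → ℂ := fun z => s z - p z ^ 2 / 2 with hSd
  set x1 := Real.log R with hx1
  have hW : ∀ z ∈ hpl x1, p0 + Complex.exp z ∈ U := by
    intro z hz
    refine ⟨?_, by simp [Complex.exp_ne_zero]⟩
    rw [mem_ball, dist_eq_norm, add_sub_cancel_left, Complex.norm_exp]
    exact (Real.lt_log_iff_exp_lt hR).1 hz
  have hWd : ∀ z, HasDerivAt (fun z => p0 + Complex.exp z) (Complex.exp z) z :=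
    fun z => (Complex.hasDerivAt_exp z).const_add p0
  have hWc : Continuous (fun z => p0 + Complex.exp z) := by fun_prop
  set Vr : ℂ → ℝ := fun z => v (p0 + Complex.exp z) - 4 * z.re with hVr
  set P : ℂ → ℂ := fun z => Complex.exp z * p (p0 + Complex.exp z) - 2 with hPd
  set Q : ℂ → ℂ := fun z => Complex.exp z * p (p0 + Complex.exp z) +
    Complex.exp z ^ 2 * s (p0 + Complex.exp z) with hQd
  set E : ℂ → ℂ := fun z => Complex.exp z * (starRingEnd ℂ) (Complex.exp z) *
    Complex.exp (v (p0 + Complex.exp z)) with hEd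
  have hV : ∀ z ∈ hpl x1, HW (fun z => (Vr z : ℂ)) (P z) ((starRingEnd ℂ) (P z)) z := by
    intro z hz
    have h1 := ((pk _ (hW z hz)).1.compR (φ := fun z => p0 + Complex.exp z) (hWd z)).sub (hw_re z)
    refine (h1.cast ?_ ?_).congr (Eventually.of_forall fun w => ?_)
    · simp only [hPd]; ring_nf; rfl
    · simp only [hPd, map_sub, map_mul, Complex.conj_ofNat]; ring_nf; rfl
    · simp [hVr]
  have hP : ∀ z ∈ hpl x1, HW P (Q z) (-E z / 4) z := by
    intro z hz
    have h1 := ((HW.of_deriv (Complex.hasDerivAt_exp z)).mul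
      ((pk _ (hW z hz)).2.1.compR (φ := fun z => p0 + Complex.exp z) (hWd z))).sub (hw_const 2 z)
    refine h1.cast ?_ ?_
    · simp only [hQd]; ring_nf; rfl
    · simp only [hEd]; ring
  have cv : ContinuousOn (fun z => (v z : ℂ)) U := fun z hz =>
    (pk z hz).1.continuousAt.continuousWithinAt
  have cp : ContinuousOn p U := fun z hz => (pk z hz).2.1.continuousAt.continuousWithinAt
  have cs : ContinuousOn s U := fun z hz => (pk z hz).2.2.continuousAt.continuousWithinAt
  have cv' : ContinuousOn (fun z => (v (p0 + Complex.exp z) : ℂ)) (hpl x1) :=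
    cv.comp hWc.continuousOn hW
  have cp' : ContinuousOn (fun z => p (p0 + Complex.exp z)) (hpl x1) :=
    cp.comp hWc.continuousOn hW
  have cs' : ContinuousOn (fun z => s (p0 + Complex.exp z)) (hpl x1) :=
    cs.comp hWc.continuousOn hW
  have hQ : ContinuousOn Q (hpl x1) := 
    (Complex.continuous_exp.continuousOn.mul cp').add ((Complex.continuous_exp.pow 2).continuousOn.mul cs')
  have hE : ContinuousOn E (hpl x1) := by
    have : Continuous fun z => (starRingEnd ℂ) (Complex.exp z) :=
      Complex.continuous_conj.comp Complex.continuous_exp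
    simp only [hEd]; fun_prop
  have hper : ∀ z, Complex.exp (z + 2 * Real.pi * Complex.I) = Complex.exp z :=
    Complex.exp_periodic
  have hVp : ∀ z, Vr (z + 2 * Real.pi * Complex.I) = Vr z := by
    intro z; simp only [hVr, hper]; simp
  have hPp : ∀ z, P (z + 2 * Real.pi * Complex.I) = P z := by intro z; simp only [hPd, hper]
  have hQp : ∀ z, Q (z + 2 * Real.pi * Complex.I) = Q z := by intro z; simp only [hQd, hper]
  have hlog : ∀ z, Real.log (dist (p0 + Complex.exp z) p0) = z.re := by
    intro z
    rw [dist_eq_norm, add_sub_cancel_left, Complex.norm_exp, Real.log_exp]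
  have hVb0 : ∀ z ∈ hpl x1, |Vr z| ≤ C := by
    intro z hz
    have := hb _ (hW z hz).2 (hW z hz).1
    rwa [hlog] at this
  have hEb0 : ∀ z ∈ hpl x1, ‖E z‖ ≤ Real.exp C * Real.exp (6 * z.re) := by
    intro z hz
    have h1 := (abs_le.1 (hVb0 z hz)).2
    simp only [hVr] at h1
    simp only [hEd, norm_mul, RCLike.norm_conj, Complex.norm_exp, Complex.ofReal_re]
    rw [← Real.exp_add, ← Real.exp_add, ← Real.exp_add]
    exact Real.exp_le_exp.2 (by linarith)
  set D := max C (max (Real.exp C) 2) with hD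
  have hD2 : 2 ≤ D := (le_max_right _ _).trans (le_max_right _ _)
  have hD0 : 0 < D := by linarith
  have hGe : ∀ z, Q z - 3 * P z - P z ^ 2 / 2 = Complex.exp z ^ 2 * S (p0 + Complex.exp z) + 4 := by
    intro z; simp only [hQd, hPd, hSd]; ring
  have hI : ∀ x2 ≤ x1, ∀ K : ℂ → ℂ, DifferentiableOn ℂ K (hpl x2) →
      (∀ z, K (z + 2 * Real.pi * Complex.I) = K z) → (∀ z ∈ hpl x2, ‖K z‖ ≤ 2) →
      (∀ z ∈ hpl x2, ‖deriv K z‖ ≤ 2) → ∀ x < x2,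
      Jv (fun z => (Complex.exp z ^ 2 * S (p0 + Complex.exp z) + 4) * K z) x = 0 := by
    intro x2 hx2 K hK hKp hKb hKb' x hx
    have hsub : hpl x2 ⊆ hpl x1 := fun z hz => lt_of_lt_of_le hz hx2
    have := energy2 (Vr := Vr) (P := P) (Q := Q) (E := E) (K := K) (x1 := x2) (C := D)
      (fun z hz => hV z (hsub hz)) (fun z hz => hP z (hsub hz)) (hQ.mono hsub) (hE.mono hsub)
      hVp hPp hQp (fun z hz => (hVb0 z (hsub hz)).trans (le_max_left _ _))
      (fun z hz => (hEb0 z (hsub hz)).trans (by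
        gcongr; exact (le_max_left _ _).trans (le_max_right _ _))) ?_ hK hKp
      (fun z hz => (hKb z hz).trans hD2) (fun z hz => (hKb' z hz).trans hD2) hD0 x hx
    · simpa only [hGe] using this
    · simp only [hGe]
      intro z hz
      refine DifferentiableAt.differentiableWithinAt ?_
      have h1 : DifferentiableAt ℂ (fun z => S (p0 + Complex.exp z)) z :=
        DifferentiableAt.fun_comp' z (hS _ (hW z (hsub hz))) (hWd z).differentiableAt
      exact ((Complex.differentiable_exp z).pow 2).mul h1 |>.add_const 4
  set g : ℂ → ℂ := fun w => w ^ 2 * S (p0 + w) + 4 with hg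
  have hcirc : ∀ w0 x, (∮ w in C(0, Real.exp x), (w - w0)⁻¹ * g w) =
      Complex.I * Jv (fun z => (Complex.exp z ^ 2 * S (p0 + Complex.exp z) + 4) *
        (Complex.exp z * (Complex.exp z - w0)⁻¹)) x := by
    intro w0 x
    rw [circleIntegral, Jv, ← intervalIntegral.integral_const_mul]
    congr 1; ext θ
    have : circleMap 0 (Real.exp x) θ = Complex.exp (pt x θ) := by
      simp [circleMap, pt, Complex.exp_add]
    rw [deriv_circleMap, this, smul_eq_mul]
    simp only [hg]; ring
  obtain ⟨φ, hφ, hφ0, hφe⟩ := laurent (g := g) hR (by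
    intro w hw hw0
    have h1 : DifferentiableAt ℂ S (p0 + w) := hS _ ⟨by simpa [dist_eq_norm] using hw, by simpa using hw0⟩
    have h2 : DifferentiableAt ℂ (fun w => S (p0 + w)) w :=
      DifferentiableAt.fun_comp' w h1 (by fun_prop)
    exact ((differentiableAt_id.pow 2).mul h2).add_const 4) (by
    intro w0 hw0
    rcases eq_or_ne w0 0 with rfl | hne
    · refine ⟨Real.exp (x1 - 1), Real.exp_pos _, ?_, fun h => absurd rfl h, ?_⟩
      · rw [← Real.lt_log_iff_exp_lt hR]; linarith
      · rw [hcirc]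
        have := hI x1 le_rfl (fun _ => 1) (by fun_prop) (by simp) (by simp) (by simp) (x1 - 1) (by linarith)
        simp only [sub_zero, ne_eq, Complex.exp_ne_zero, not_false_eq_true, mul_inv_cancel₀]
        rw [this, mul_zero]
    · have hn : 0 < ‖w0‖ := norm_pos_iff.2 hne
      have hnR : ‖w0‖ < R := by simpa using hw0
      set x2 := Real.log (‖w0‖ / 2) with hx2
      have hx2e : Real.exp x2 = ‖w0‖ / 2 := Real.exp_log (by positivity)
      have hx21 : x2 ≤ x1 := Real.log_le_log (by positivity) (by linarith)
      have hlt : Real.exp (x2 - 1) < ‖w0‖ := by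
        have : Real.exp (x2 - 1) < Real.exp x2 := Real.exp_lt_exp.2 (by linarith)
        linarith
      refine ⟨Real.exp (x2 - 1), Real.exp_pos _, hlt.trans hnR, fun _ => hlt, ?_⟩
      have hlow : ∀ z ∈ hpl x2, ‖Complex.exp z‖ ≤ ‖w0‖ / 2 ∧ ‖w0‖ / 2 ≤ ‖Complex.exp z - w0‖ := by
        intro z hz
        have h1 : ‖Complex.exp z‖ ≤ ‖w0‖ / 2 := by
          rw [Complex.norm_exp, ← hx2e]; exact Real.exp_le_exp.2 (le_of_lt hz)
        refine ⟨h1, ?_⟩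
        have := norm_sub_norm_le w0 (Complex.exp z)
        rw [norm_sub_rev] at this; linarith
      have hne' : ∀ z ∈ hpl x2, Complex.exp z - w0 ≠ 0 := by
        intro z hz; rw [← norm_pos_iff]; linarith [(hlow z hz).2]
      have hKd : ∀ z ∈ hpl x2, HasDerivAt (fun z => Complex.exp z * (Complex.exp z - w0)⁻¹)
          (-w0 * Complex.exp z / (Complex.exp z - w0) ^ 2) z := by
        intro z hz
        have h1 := (Complex.hasDerivAt_exp z).mul (((Complex.hasDerivAt_exp z).sub_const w0).inv (hne' z hz))
        convert! h1 using 1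
        have := hne' z hz
        simp only [Pi.inv_apply]
        field_simp; ring
      rw [hcirc, hI x2 hx21 (fun z => Complex.exp z * (Complex.exp z - w0)⁻¹)
        (fun z hz => (hKd z hz).differentiableAt.differentiableWithinAt)
        (by intro z; simp only [hper]) ?_ ?_ _ (by linarith), mul_zero]
      · intro z hz
        obtain ⟨h1, h2⟩ := hlow z hz
        rw [norm_mul, norm_inv, ← div_eq_mul_inv, div_le_iff₀ (by linarith)]
        linarith
      · intro z hz
        obtain ⟨h1, h2⟩ := hlow z hz
        rw [(hKd z hz).deriv, norm_div, norm_mul, norm_neg, norm_pow, div_le_iff₀ (by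
          have : 0 < ‖Complex.exp z - w0‖ := by linarith
          positivity)]
        nlinarith)
  obtain ⟨ψ, hψ, hψe, -⟩ := analytic_factor hφ hφ0
  refine ⟨fun z => ψ (z - p0), AnalyticAt.fun_comp (f := fun z => z - p0) (g := ψ)
    (by simpa using hψ) (by fun_prop), ?_⟩
  have ht : Tendsto (fun z => z - p0) (𝓝[≠] p0) (𝓝[≠] 0) := by
    refine tendsto_nhdsWithin_iff.2 ⟨?_, ?_⟩
    · have : Tendsto (fun z : ℂ => z - p0) (𝓝 p0) (𝓝 (p0 - p0)) := by
        exact (continuous_id.sub continuous_const).tendsto p0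
      rw [sub_self] at this
      exact this.mono_left nhdsWithin_le_nhds
    · filter_upwards [self_mem_nhdsWithin] with z hz
      simpa [sub_eq_zero] using hz
  filter_upwards [ht.eventually hφe, self_mem_nhdsWithin] with z hz hz0
  have hz1 : z - p0 ≠ 0 := sub_ne_zero.2 hz0
  rw [hψe] at hz
  simp only [hg, hSd, sub_zero, add_sub_cancel] at hz
  field_simp
  linear_combination 2 * hz

open Metric Set Filter Topology

lemma wirt_neg' (g : ℂ → ℂ) (z : ℂ) : wirt (fun w => - g w) z = - wirt g z := by
  simp only [wirt, fderiv_fun_neg]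
  simp; ring

namespace PeriodPair
variable (L : PeriodPair)

noncomputable def dbl : PeriodPair where
  ω₁ := 2 * L.ω₁
  ω₂ := 2 * L.ω₂
  indep := by
    have := L.indep
    rw [LinearIndependent.pair_iff] at this ⊢
    intro s t h
    refine this s t ?_
    simp only [Complex.real_smul] at h ⊢
    linear_combination h / 2

structure EvSol (v : ℂ → ℝ) : Prop where
  even : ∀ z, v (-z) = v z
  per : ∀ l ∈ L.lattice, ∀ z, v (z + 2 * l) = v z
  pde : ∀ z ∉ L.lattice, (∀ n : ℕ, ContDiffAt ℝ n v z) ∧ lapl v z + Real.exp (v z) = 0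
  sing : ∀ p ∈ L.lattice, ∃ C ε : ℝ, 0 < ε ∧ ∀ z : ℂ, z ≠ p → dist z p < ε →
      |v z - 4 * Real.log (dist z p)| ≤ C

variable {L} {v : ℂ → ℝ}

lemma EvSol.p_per (h : L.EvSol v) {l : ℂ} (hl : l ∈ L.lattice) (z : ℂ) :
    wirt (fun z => (v z : ℂ)) (z + 2 * l) = wirt (fun z => (v z : ℂ)) z := by
  rw [← wirt_add]; simp only [h.per l hl]

lemma EvSol.s_per (h : L.EvSol v) {l : ℂ} (hl : l ∈ L.lattice) (z : ℂ) :
    wirt (wirt (fun z => (v z : ℂ))) (z + 2 * l) = wirt (wirt (fun z => (v z : ℂ))) z := by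
  rw [← wirt_add]; simp only [h.p_per hl]

lemma EvSol.v_refl (h : L.EvSol v) {l : ℂ} (hl : l ∈ L.lattice) (z : ℂ) :
    v (2 * l - z) = v z := by
  rw [sub_eq_neg_add, h.per l hl, h.even]

lemma EvSol.p_refl (h : L.EvSol v) {l : ℂ} (hl : l ∈ L.lattice) (z : ℂ) :
    wirt (fun z => (v z : ℂ)) (2 * l - z) = - wirt (fun z => (v z : ℂ)) z := by
  have := wirt_refl (fun z => (v z : ℂ)) (2 * l) z
  simp only [h.v_refl hl] at this
  rw [this, neg_neg]

lemma EvSol.s_refl (h : L.EvSol v) {l : ℂ} (hl : l ∈ L.lattice) (z : ℂ) :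
    wirt (wirt (fun z => (v z : ℂ))) (2 * l - z) = wirt (wirt (fun z => (v z : ℂ))) z := by
  have := wirt_refl (wirt (fun z => (v z : ℂ))) (2 * l) z
  simp only [h.p_refl hl] at this
  have e : wirt (fun w => -wirt (fun z => (v z : ℂ)) w) z = - wirt (wirt (fun z => (v z : ℂ))) z := by
    exact wirt_neg' _ _
  rw [e] at this
  exact (neg_injective this).symm

lemma wp_refl {p : ℂ} (hp : p ∈ L.lattice) (z : ℂ) :
    L.weierstrassP (2 * p - z) = L.weierstrassP z := by
  rw [show 2 * p - z = -z + (p + p) by ring, L.wp_add (add_mem hp hp), L.weierstrassP_neg]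

lemma EvSol.schwarz (h : L.EvSol v) : ∃ c, ∀ z ∉ L.lattice,
    wirt (wirt (fun z => (v z : ℂ))) z - wirt (fun z => (v z : ℂ)) z ^ 2 / 2
      + 4 * L.weierstrassP z = c := by
  set p := wirt (fun z => (v z : ℂ)) with hp
  set g : ℂ → ℂ := fun z => wirt p z - p z ^ 2 / 2 + 4 * L.weierstrassP z with hg
  have hS := S_holo L.isOpen_compl h.pde
  have han : ∀ z ∉ L.lattice, AnalyticAt ℂ g z := by
    intro z hz
    have h1 : AnalyticAt ℂ (fun z => wirt p z - p z ^ 2 / 2) z := by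
      rw [Complex.analyticAt_iff_eventually_differentiableAt]
      filter_upwards [L.isOpen_compl.mem_nhds hz] with w hw
      exact hS w hw
    exact h1.add (analyticAt_const.mul (L.wp_an hz))
  have hr : ∀ q, RemAt g q := by
    intro q
    by_cases hq : q ∈ L.lattice
    swap
    · exact RemAt.of_analytic (han q hq)
    obtain ⟨C, ε, hε, hb⟩ := h.sing q hq
    have hn : ∀ᶠ z in 𝓝 q, z ≠ q → z ∉ L.lattice := by
      have := L.punct q
      rwa [eventually_nhdsWithin_iff] at this
    obtain ⟨δ, hδ, hd⟩ := Metric.eventually_nhds_iff.1 hn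
    obtain ⟨ψ, h1, h2⟩ := sing_local (v := v) (p0 := q) (R := min ε δ) (C := C) (lt_min hε hδ)
      (fun z hz hne => h.pde z (hd (lt_of_lt_of_le hz (min_le_right _ _)) hne))
      (fun z hz hlt => hb z hz (lt_of_lt_of_le hlt (min_le_left _ _)))
    obtain ⟨φ, h3, h4⟩ := L.wp_rem hq
    refine RemAt.parity (φ := fun z => ψ z + 4 * (z - q) * φ z) (p := q) ?_ ?_ ?_
    · fun_prop
    · filter_upwards [h2, h4, self_mem_nhdsWithin] with z a b c
      have c' : z - q ≠ 0 := sub_ne_zero.mpr c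
      simp only [hg]
      rw [add_div, ← a, ← b]
      simp only [← hp]
      field_simp
      ring
    · refine .of_forall fun z => ?_
      simp only [hg, hp, h.s_refl hq, h.p_refl hq, wp_refl hq]
      ring
  have per : ∀ l ∈ L.lattice, ∀ z, g (z + 2 * l) = g z := by
    intro l hl z
    simp only [hg, hp, h.s_per hl, h.p_per hl]
    rw [two_mul, L.wp_add (add_mem hl hl)]
  obtain ⟨c, hc⟩ := L.dbl.liouville' hr (fun p => .of_forall (per _ L.ω₁_mem_lattice))
    (fun p => .of_forall (per _ L.ω₂_mem_lattice))
  exact ⟨c, fun z hz => hc z (han z hz).continuousAt⟩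

/-- everything we need about the ODE -/
lemma EvSol.ode (h : L.EvSol v) : ∃ a ∉ L.lattice, ∀ z ∉ L.lattice,
    deriv (deriv (L.py a)) z = -(wirt (wirt (fun z => (v z : ℂ))) z
      - wirt (fun z => (v z : ℂ)) z ^ 2 / 2) / 2 * L.py a z := by
  obtain ⟨c', hc'⟩ := h.schwarz
  obtain ⟨c, hc⟩ := L.py_ode
  obtain ⟨a, ha, hB⟩ := L.wp_surj (-c' / 2 - c)
  refine ⟨a, ha, fun z hz => ?_⟩
  rw [hc a ha z hz, hB, ← hc' z hz]
  ring

lemma EvSol.fns (h : L.EvSol v) {y : ℂ → ℂ} (hy : ∀ z ∉ L.lattice, AnalyticAt ℂ y z)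
    (hode : ∀ z ∉ L.lattice, deriv (deriv y) z = -(wirt (wirt (fun z => (v z : ℂ))) z
      - wirt (fun z => (v z : ℂ)) z ^ 2 / 2) / 2 * y z) :
    let u : ℂ → ℂ := fun z => (v z : ℂ)
    let p := wirt u
    let f : ℂ → ℂ := fun z => Complex.exp (-u z / 2) * (starRingEnd ℂ) (deriv y z + p z * y z / 2)
    ∀ z ∉ L.lattice, HasDerivAt f (-(p z * f z / 2)
        - Complex.exp (u z / 2) * (starRingEnd ℂ) (y z) / 8) z ∧
      HasDerivAt (fun z => f z * (deriv y z + p z * y z / 2) +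
        Complex.exp (u z / 2) * (starRingEnd ℂ) (y z) * y z / 8) 0 z := by
  intro u p f z hz
  obtain ⟨h1, h2, -⟩ := sol_pkg L.isOpen_compl h.pde z hz
  have y1 : HW y _ 0 z := HW.of_deriv (hy z hz).differentiableAt.hasDerivAt
  have y2 : HW (deriv y) _ 0 z := HW.of_deriv (hy z hz).deriv.differentiableAt.hasDerivAt
  rw [hode z hz] at y2
  have hs := y2.add ((h2.mul y1).mul (hw_const (1 / 2) z))
  set s : ℂ → ℂ := fun z => deriv y z + p z * y z / 2 with hsd
  have hs' : HW s (p z * s z / 2) (-Complex.exp (u z) * y z / 8) z := by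
    refine (hs.cast ?_ ?_).congr (.of_forall fun w => ?_)
    · simp only [hsd, p, u]; ring
    · simp only [u]; ring
    · simp only [hsd, p, u]; ring
  have cu : ∀ z, (starRingEnd ℂ) (u z) = u z := fun z => Complex.conj_ofReal _
  have hY : HW (fun z => Complex.exp (-u z / 2)) _ _ z :=
    ((h1.mul (hw_const (-1 / 2) z)).compL (Complex.hasDerivAt_exp _)).congr
      (.of_forall fun w => by simp only [u]; congr 1; ring)
  have hX : HW (fun z => Complex.exp (u z / 2)) _ _ z :=
    ((h1.mul (hw_const (1 / 2) z)).compL (Complex.hasDerivAt_exp _)).congr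
      (.of_forall fun w => by simp only [u]; congr 1; ring)
  have e1 : (v z : ℂ) * (-1 / 2) = -u z / 2 := by simp only [u]; ring
  have e2 : (v z : ℂ) * (1 / 2) = u z / 2 := by simp only [u]; ring
  rw [e1] at hY
  rw [e2] at hX
  set X := Complex.exp (u z / 2) with hXd
  set Y := Complex.exp (-u z / 2) with hYd
  have XX : Complex.exp (u z) = X * X := by rw [hXd, ← Complex.exp_add]; congr 1; ring
  have XY : X * Y = 1 := by
    rw [hXd, hYd, ← Complex.exp_add, show u z / 2 + -u z / 2 = 0 by ring, Complex.exp_zero]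
  have cX : (starRingEnd ℂ) X = X := by
    rw [hXd, ← Complex.exp_conj]; congr 1; simp [cu, Complex.conj_ofNat]
  have fz : f z = Y * (starRingEnd ℂ) (s z) := rfl
  have pz : wirt (fun z => (v z : ℂ)) z = p z := rfl
  rw [pz] at hX hY
  have hf : HW f (-(p z * f z / 2) - X * (starRingEnd ℂ) (y z) / 8) 0 z := by
    refine (hY.mul hs'.conj).cast ?_ ?_
    · rw [fz, XX]
      simp only [map_div₀, map_mul, map_neg, cX, Complex.conj_ofNat]
      linear_combination (X * (starRingEnd ℂ) (y z) / 8) * XY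
    · simp only [map_div₀, map_mul, Complex.conj_ofNat]
      ring
  refine ⟨hf.hasDerivAt, HW.hasDerivAt ?_⟩
  refine (((hf.mul hs').add (((hX.mul y1.conj).mul y1).mul (hw_const (1 / 8) z))).cast ?_ ?_).congr
    (.of_forall fun w => ?_)
  · simp only [hsd, map_zero]; ring
  · rw [fz, XX]
    simp only [hsd, map_add, map_mul, map_div₀, Complex.conj_ofNat]
    linear_combination (X * (starRingEnd ℂ) (deriv y z) * y z / 8 + X * (starRingEnd ℂ) (p z) * (starRingEnd ℂ) (y z) * y z / 16) * XY
  · simp only [hsd]; ring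

end PeriodPair

open Metric Set Filter Topology

namespace PeriodPair
variable {L : PeriodPair} {v : ℂ → ℝ}

lemma const_offS {S : Set ℂ} (hc : S.Countable) (ho : IsOpen Sᶜ) {f : ℂ → ℂ}
    (h : ∀ z ∉ S, HasDerivAt f 0 z) {z w : ℂ} (hz : z ∉ S) (hw : w ∉ S) : f z = f w :=
  ho.is_const_of_deriv_eq_zero (preconn hc)
    (fun x hx => (h x hx).differentiableAt.differentiableWithinAt) (fun x hx => (h x hx).deriv)
    hz hw

lemma pet_two {l : ℂ} (hl : l ∈ L.lattice) : L.pet (2 * l) = 2 * L.pet l := by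
  rw [two_mul, L.pet_add hl hl, two_mul]

lemma two_mem {l : ℂ} (hl : l ∈ L.lattice) : 2 * l ∈ L.lattice := by
  rw [two_mul]; exact add_mem hl hl

lemma deriv_py_add {a l : ℂ} (hl : l ∈ L.lattice) (z : ℂ) :
    deriv (L.py a) (z + l) = Complex.exp (L.pz a * l - L.pet l * a) * deriv (L.py a) z := by
  rw [← deriv_comp_add_const (L.py a) l z]
  have : (fun x => L.py a (x + l)) = fun x => Complex.exp (L.pz a * l - L.pet l * a) * L.py a x := by
    ext x; exact L.py_add hl x
  rw [this, deriv_const_mul_field]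

/-- first half: unitarity of multipliers; second: data for kappa -/
lemma EvSol.main (h : L.EvSol v) : ∃ a ∉ L.lattice,
    (∀ l ∈ L.lattice, (L.pz a * l - L.pet l * a).re = 0) ∧
    ∃ Ω : ℂ, Ω ≠ 0 ∧ ∃ f : ℂ → ℂ,
      (∀ z ∉ L.lattice, z - a ∉ L.lattice →
        HasDerivAt (fun z => f z / L.py a z) (-Ω / L.py a z ^ 2) z) ∧
      (∀ l ∈ L.lattice, ∀ z, f (z + 2 * l) =
        (starRingEnd ℂ) (Complex.exp (L.pz a * (2 * l) - L.pet (2 * l) * a)) * f z) := by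
  obtain ⟨a, ha, hode⟩ := h.ode
  have H := h.fns (fun z hz => L.py_an a hz) hode
  set u : ℂ → ℂ := fun z => (v z : ℂ) with hu
  set p := wirt u with hp
  set y := L.py a with hy
  set f : ℂ → ℂ := fun z => Complex.exp (-u z / 2) * (starRingEnd ℂ) (deriv y z + p z * y z / 2)
    with hf
  set W : ℂ → ℂ := fun z => f z * (deriv y z + p z * y z / 2) +
        Complex.exp (u z / 2) * (starRingEnd ℂ) (y z) * y z / 8 with hW
  have H1 : ∀ z ∉ L.lattice, HasDerivAt f (-(p z * f z / 2)
        - Complex.exp (u z / 2) * (starRingEnd ℂ) (y z) / 8) z := fun z hz => (H z hz).1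
  have H2 : ∀ z ∉ L.lattice, HasDerivAt W 0 z := fun z hz => (H z hz).2
  have Wc : ∀ z ∉ L.lattice, W z = W a := fun z hz => L.const_off H2 hz ha
  have Wa : W a ≠ 0 := by
    have e : y a = 0 := L.py_self a
    have d : deriv y a ≠ 0 := L.deriv_py_self ha
    simp only [hW, hf, e, mul_zero, zero_div, add_zero]
    refine mul_ne_zero (mul_ne_zero (Complex.exp_ne_zero _) ?_) d
    simpa using d
  have uper : ∀ l ∈ L.lattice, ∀ z, u (z + 2 * l) = u z := by
    intro l hl z; simp only [hu, h.per l hl]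
  have pper : ∀ l ∈ L.lattice, ∀ z, p (z + 2 * l) = p z := fun l hl z => h.p_per hl z
  have yper : ∀ l ∈ L.lattice, ∀ z, y (z + 2 * l) =
      Complex.exp (L.pz a * (2 * l) - L.pet (2 * l) * a) * y z :=
    fun l hl z => L.py_add (two_mem hl) z
  have dper : ∀ l ∈ L.lattice, ∀ z, deriv y (z + 2 * l) =
      Complex.exp (L.pz a * (2 * l) - L.pet (2 * l) * a) * deriv y z :=
    fun l hl z => deriv_py_add (two_mem hl) z
  have fper : ∀ l ∈ L.lattice, ∀ z, f (z + 2 * l) =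
        (starRingEnd ℂ) (Complex.exp (L.pz a * (2 * l) - L.pet (2 * l) * a)) * f z := by
    intro l hl z
    simp only [hf, uper l hl, pper l hl, yper l hl, dper l hl]
    simp only [map_add, map_mul, map_div₀]
    ring
  refine ⟨a, ha, ?_, W a, Wa, f, ?_, fper⟩
  · intro l hl
    have e1 : W (a + 2 * l) = W a := Wc _ (L.add_nmem (two_mem hl) ha)
    set w := L.pz a * (2 * l) - L.pet (2 * l) * a with hw
    have e2 : W (a + 2 * l) = (starRingEnd ℂ) (Complex.exp w) * Complex.exp w * W a := by
      simp only [hW, fper l hl, uper l hl, pper l hl, yper l hl, dper l hl, ← hw]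
      simp only [map_mul]
      ring
    have e3 : (starRingEnd ℂ) (Complex.exp w) * Complex.exp w = 1 := by
      rw [e1] at e2
      exact mul_right_cancel₀ Wa (by rw [← e2, one_mul])
    rw [mul_comm, Complex.mul_conj, Complex.normSq_eq_norm_sq, Complex.norm_exp] at e3
    have e4 : Real.exp w.re ^ 2 = 1 := by exact_mod_cast e3
    have e5 : w.re = 0 := by
      rw [← Real.exp_nat_mul, Real.exp_eq_one_iff] at e4
      push_cast at e4; linarith
    have e6 : w = 2 * (L.pz a * l - L.pet l * a) := by rw [hw, pet_two hl]; ring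
    rw [e6] at e5
    simpa using e5
  · intro z hz hza
    have hy0 : y z ≠ 0 := L.py_ne hz hza
    have := (H1 z hz).fun_div (L.py_an a hz).differentiableAt.hasDerivAt hy0
    refine this.congr_deriv ?_
    rw [← Wc z hz]
    congr 1
    simp only [hW, hy]
    ring

lemma py_sq_even {a : ℂ} (ha : a ∉ L.lattice) (h2 : 2 * a ∈ L.lattice) (z : ℂ) :
    L.py a (-z) ^ 2 = L.py a z ^ 2 := by
  obtain ⟨K, hK, hs⟩ := L.ps_add h2
  have key : ∀ z, L.py a (-z) = K * Complex.exp (-2 * L.pz a * a) * L.py a z := by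
    intro z
    simp only [py]
    rw [show -z - a = -(z + a) by ring, L.ps_neg, L.ps_neg, show z + a = z - a + 2 * a by ring, hs,
      L.pet_eq h2 ha, mul_neg, neg_div_neg_eq]
    have : Complex.exp (L.pz a * -z) * (Complex.exp (2 * L.pz a * (z - a))) =
      Complex.exp (-2 * L.pz a * a) * Complex.exp (L.pz a * z) := by
      rw [← Complex.exp_add, ← Complex.exp_add]; congr 1; ring
    linear_combination (K * L.ps (z - a) / L.ps z) * this
  by_cases h0 : L.py a z = 0
  · rw [key, h0]; simp
  · have k1 := key (-z)
    rw [neg_neg, key z] at k1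
    rw [key, mul_pow]
    have : (K * Complex.exp (-2 * L.pz a * a)) ^ 2 = 1 := by
      apply mul_right_cancel₀ h0
      linear_combination -k1
    rw [this, one_mul]

lemma py_mult {a : ℂ} (ha : a ∉ L.lattice) (h2 : 2 * a ∈ L.lattice) {l : ℂ} (hl : l ∈ L.lattice) :
    Complex.exp (L.pz a * l - L.pet l * a) ^ 2 = 1 := by
  have := L.legendre h2 hl
  rw [L.pet_eq h2 ha] at this
  rw [← this, ← Complex.exp_nat_mul]
  congr 1
  push_cast
  ring

/-- the inverse square of `py` -/
lemma py_inv_sq {a : ℂ} (ha : a ∉ L.lattice) (h2 : 2 * a ∈ L.lattice) :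
    ∃ b e : ℂ, b ≠ 0 ∧ ∀ z ∉ L.lattice, z - a ∉ L.lattice →
      1 / L.py a z ^ 2 = b * L.weierstrassP (z - a) + e := by
  set q : ℂ → ℂ := fun z => Complex.exp (-L.pz a * z) * L.ps z with hq
  have q_an : ∀ z, AnalyticAt ℂ q z := by
    intro z
    have := L.ps_diff
    have : Differentiable ℂ q := by fun_prop
    exact this.analyticAt z
  have e1 : ∀ z, 1 / L.py a z ^ 2 = (q z / L.ps (z - a)) ^ 2 := by
    intro z
    simp only [py, hq, neg_mul, Complex.exp_neg]
    have := Complex.exp_ne_zero (L.pz a * z)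
    simp only [div_pow, mul_pow, one_div, inv_div, inv_pow]
    rw [div_mul_eq_div_div, div_eq_mul_inv (L.ps z ^ 2), mul_comm (L.ps z ^ 2)]
  have D_an : ∀ z, z - a ∉ L.lattice → AnalyticAt ℂ (fun z => 1 / L.py a z ^ 2) z := by
    intro z hz
    have h1 : AnalyticAt ℂ (fun z : ℂ => z - a) z := by fun_prop
    have h2 := AnalyticAt.fun_comp (f := fun z : ℂ => z - a) (L.ps_an (z - a)) h1
    simp only [e1]
    exact ((q_an z).div h2 (L.ps_ne hz)).pow 2
  have Dper : ∀ l ∈ L.lattice, ∀ z, 1 / L.py a (z + l) ^ 2 = 1 / L.py a z ^ 2 := by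
    intro l hl z
    rw [L.py_add hl, mul_pow, py_mult ha h2 hl, one_mul]
  set N : ℂ → ℂ := fun z => (q z / L.pg (z - a)) ^ 2 with hN
  have sh : AnalyticAt ℂ (fun z : ℂ => z - a) a := by fun_prop
  have pg_an := AnalyticAt.fun_comp (f := fun z : ℂ => z - a) (g := L.pg)
    (L.pg_diff.analyticAt _) sh
  have N_an : AnalyticAt ℂ N a :=
    ((q_an a).div pg_an (by simp [L.pg_zero])).pow 2
  have hb : N a ≠ 0 := by
    simp only [hN, hq, sub_self, L.pg_zero, div_one]
    exact pow_ne_zero _ (mul_ne_zero (Complex.exp_ne_zero _) (L.ps_ne ha))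
  obtain ⟨ψ, ψ1, ψ2, -⟩ := analytic_factor (φ := fun z => N z - N a) (N_an.sub analyticAt_const)
    (sub_self _)
  set g : ℂ → ℂ := fun z => 1 / L.py a z ^ 2 - N a * L.weierstrassP (z - a) with hg
  have gper : ∀ l ∈ L.lattice, ∀ z, g (z + l) = g z := by
    intro l hl z
    simp only [hg, Dper l hl]
    rw [show z + l - a = z - a + l by ring, L.wp_add hl]
  have g_an : ∀ z, z - a ∉ L.lattice → AnalyticAt ℂ g z := by
    intro z hz
    have h1 : AnalyticAt ℂ (fun z : ℂ => z - a) z := by fun_prop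
    exact (D_an z hz).sub (analyticAt_const.mul
      (AnalyticAt.fun_comp (f := fun z : ℂ => z - a) (L.wp_an hz) h1))
  have ga : RemAt g a := by
    obtain ⟨φ, p1, p2⟩ := L.wp_rem (zero_mem L.lattice)
    have t := tendsto_punct_comp (f := fun z : ℂ => z - a) (by fun_prop) (sub_left_injective) a
    simp only [sub_self] at t
    have p1' : AnalyticAt ℂ (fun z => φ (z - a)) a :=
      AnalyticAt.fun_comp (f := fun z : ℂ => z - a) (by simpa using p1) sh
    refine RemAt.parity (φ := fun z => ψ z - N a * (z - a) * φ (z - a)) ?_ ?_ ?_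
    · exact ψ1.sub ((analyticAt_const.mul sh).mul p1')
    · filter_upwards [t.eventually p2, self_mem_nhdsWithin] with z c d
      have d' : z - a ≠ 0 := sub_ne_zero.mpr d
      have c' := ψ2 z
      simp only [sub_zero] at c
      have e3 : q z / L.ps (z - a) = (q z / L.pg (z - a)) / (z - a) := by
        simp only [ps]
        rw [div_div, mul_comm]
      have e4 : (1 / L.py a z ^ 2) = N z / (z - a) ^ 2 := by
        rw [e1, e3, div_pow]
      simp only [hg, e4]
      rw [← c]
      have : N z = N a + (z - a) * ψ z := by linear_combination c'
      rw [this]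
      field_simp
      ring
    · refine .of_forall fun z => ?_
      simp only [hg]
      rw [show 2 * a - z - a = -(z - a) by ring, L.weierstrassP_neg,
        show 2 * a - z = -z + 2 * a by ring, Dper _ h2, py_sq_even ha h2]
  have hr : ∀ p, RemAt g p := by
    intro p
    by_cases hp : p - a ∈ L.lattice
    · have : RemAt (fun z => g (z + -(p - a))) p := by
        apply RemAt.comp_add
        rwa [show p + -(p - a) = a by ring]
      refine this.congr (.of_forall fun z => ?_)
      rw [gper _ (neg_mem hp)]
    · exact RemAt.of_analytic (g_an p hp)
  obtain ⟨c, hc⟩ := L.liouville' hr (fun p => .of_forall (gper _ L.ω₁_mem_lattice))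
    (fun p => .of_forall (gper _ L.ω₂_mem_lattice))
  refine ⟨N a, c, hb, fun z hz hza => ?_⟩
  have := hc z (g_an z hza).continuousAt
  simp only [hg] at this
  linear_combination this

/-- The necessary direction. -/
theorem EvSol.nec (h : L.EvSol v) : ∃ a, 2 * a ∉ L.lattice ∧
    (∀ l ∈ L.lattice, (L.pz a * l - L.pet l * a).re = 0) := by
  obtain ⟨a, ha, hre, Ω, hΩ, f, hf, fper⟩ := h.main
  refine ⟨a, fun h2 => ?_, hre⟩
  obtain ⟨b, e, hb, hD⟩ := py_inv_sq ha h2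
  have mul1 : ∀ l ∈ L.lattice, Complex.exp (L.pz a * (2 * l) - L.pet (2 * l) * a) = 1 := by
    intro l hl
    rw [← py_mult ha h2 hl, pet_two hl, ← Complex.exp_nat_mul]
    congr 1
    push_cast
    ring
  set S : Set ℂ := L.lattice ∪ (fun z => z - a) ⁻¹' L.lattice with hS
  have hSm : ∀ z, z ∉ S ↔ z ∉ L.lattice ∧ z - a ∉ L.lattice := by
    intro z; simp [hS]
  have hSc : S.Countable := L.countable_lat.union (L.countable_lat.preimage sub_left_injective)
  have hSo : IsOpen Sᶜ := by
    rw [hS, compl_union, ← preimage_compl]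
    exact L.isOpen_compl.inter (L.isOpen_compl.preimage (by fun_prop))
  set κ : ℂ → ℂ := fun z => f z / L.py a z with hκ
  have κper : ∀ l ∈ L.lattice, ∀ z, κ (z + 2 * l) = κ z := by
    intro l hl z
    simp only [hκ, fper l hl, L.py_add (two_mem hl), mul1 l hl, map_one, one_mul]
  have hd : ∀ z ∉ S, HasDerivAt (fun z => κ z - Ω * b * L.pz (z - a) + Ω * e * z) 0 z := by
    intro z hz
    obtain ⟨z1, z2⟩ := (hSm z).1 hz
    have d1 := hf z z1 z2
    have d2 := ((L.pz_hasDerivAt z2).comp_sub_const z a).const_mul (Ω * b)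
    have d3 := (hasDerivAt_id z).const_mul (Ω * e)
    refine ((d1.sub d2).add d3).congr_deriv ?_
    have := hD z z1 z2
    rw [div_eq_mul_one_div, this]
    ring
  obtain ⟨w, hw⟩ : ∃ w, w ∉ S := by
    have := (L.punct 0).and (L.punct' 0 a)
    obtain ⟨w, h1⟩ := this.exists
    exact ⟨w, (hSm w).2 h1⟩
  have fin : ∀ l ∈ L.lattice, L.pet l = (e / b) * l := by
    intro l hl
    obtain ⟨w1, w2⟩ := (hSm w).1 hw
    have hw' : w + 2 * l ∉ S := by
      refine (hSm _).2 ⟨L.add_nmem (two_mem hl) w1, ?_⟩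
      rw [show w + 2 * l - a = w - a + 2 * l by ring]
      exact L.add_nmem (two_mem hl) w2
    have := const_offS hSc hSo hd hw' hw
    simp only [κper l hl] at this
    rw [show w + 2 * l - a = w - a + 2 * l by ring, L.pz_add (two_mem hl) w2, pet_two hl] at this
    field_simp
    apply mul_left_cancel₀ hΩ
    linear_combination -this / 2
  exact L.nonprop (e / b) (fin _ L.ω₁_mem_lattice) (fin _ L.ω₂_mem_lattice)

end PeriodPair

open Metric Set Filter Topology

lemma lapl_of {v : ℂ → ℝ} {z : ℂ} (hv : ∀ᶠ w in 𝓝 z, ∀ n : ℕ, ContDiffAt ℝ n v w)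
    {P Q : ℂ → ℂ} {a b : ℂ} (h1 : ∀ᶠ w in 𝓝 z, HW (fun z => (v z : ℂ)) (P w) (Q w) w)
    (h2 : HW P a b z) : (lapl v z : ℂ) = 4 * b := by
  set u : ℂ → ℂ := fun z => (v z : ℂ) with hu
  have hcd : ContDiffAt ℝ (2 : ℕ) u z :=
    Complex.ofRealCLM.contDiff.contDiffAt.comp z (hv.self_of_nhds 2)
  have hfd : ∀ᶠ w in 𝓝 z, ∀ a, fderiv ℝ u w a = (fderiv ℝ v w a : ℂ) := by
    filter_upwards [hv] with w hw a
    have h1 := (hw 1).differentiableAt (by norm_num)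
    have : HasFDerivAt u _ w := Complex.ofRealCLM.hasFDerivAt.comp w h1.hasFDerivAt
    rw [this.fderiv]
    simp
  have hr : ∀ a, fderiv ℝ (fun w => fderiv ℝ u w a) z a =
      (fderiv ℝ (fun w => fderiv ℝ v w a) z a : ℂ) := by
    intro a
    have ev : (fun w => fderiv ℝ u w a) =ᶠ[𝓝 z] fun w => (fderiv ℝ v w a : ℂ) := by
      filter_upwards [hfd] with w hw using hw a
    rw [ev.fderiv_eq]
    have h2 : DifferentiableAt ℝ (fun w => fderiv ℝ v w a) z := by
      have := (hv.self_of_nhds 2).fderiv_right (m := 1) (by norm_num)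
      exact (this.clm_apply contDiffAt_const).differentiableAt (by norm_num)
    have : HasFDerivAt (fun w => (fderiv ℝ v w a : ℂ)) _ z :=
      Complex.ofRealCLM.hasFDerivAt.comp z h2.hasFDerivAt
    rw [this.fderiv]
    simp
  have e1 := (wirt_comm hcd).1
  rw [hr, hr] at e1
  have ev : wirt u =ᶠ[𝓝 z] P := by
    filter_upwards [h1] with w hw
    exact (hw.unique (hw_wirt (HasFDerivAt.differentiableAt hw))).1.symm
  have h3 : HW (wirt u) a b z := h2.congr ev
  have h4 := (h3.unique (hw_wirt (HasFDerivAt.differentiableAt h3))).2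
  rw [h4, e1]
  simp only [lapl]
  push_cast
  ring

/-- Liouville formula -/
lemma liouv {U : Set ℂ} (hU : IsOpen U) {y₁ y₂ : ℂ → ℂ} (h1 : ∀ z ∈ U, AnalyticAt ℂ y₁ z)
    (h2 : ∀ z ∈ U, AnalyticAt ℂ y₂ z) {c : ℂ} (hc : c ≠ 0)
    (hw : ∀ z ∈ U, deriv y₁ z * y₂ z - y₁ z * deriv y₂ z = c)
    (h0 : ∀ z ∈ U, 0 < ‖y₁ z‖ ^ 2 + ‖y₂ z‖ ^ 2) :
    let v : ℂ → ℝ := fun z => Real.log (8 * ‖c‖ ^ 2) - 2 * Real.log (‖y₁ z‖ ^ 2 + ‖y₂ z‖ ^ 2)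
    ∀ z ∈ U, (∀ n : ℕ, ContDiffAt ℝ n v z) ∧ lapl v z + Real.exp (v z) = 0 := by
  intro v
  have cd : ∀ z ∈ U, ∀ n : ℕ, ContDiffAt ℝ n v z := by
    intro z hz n
    have a1 : ContDiffAt ℝ n y₁ z := (h1 z hz).contDiffAt.restrict_scalars ℝ
    have a2 : ContDiffAt ℝ n y₂ z := (h2 z hz).contDiffAt.restrict_scalars ℝ
    exact contDiffAt_const.sub (contDiffAt_const.mul
      (((a1.norm_sq ℝ).add (a2.norm_sq ℝ)).log (h0 z hz).ne'))
  set F : ℂ → ℂ := fun z => y₁ z * (starRingEnd ℂ) (y₁ z) + y₂ z * (starRingEnd ℂ) (y₂ z) with hF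
  have Fr : ∀ z, F z = ((‖y₁ z‖ ^ 2 + ‖y₂ z‖ ^ 2 : ℝ) : ℂ) := by
    intro z
    simp only [hF, Complex.mul_conj, Complex.normSq_eq_norm_sq]
    push_cast; ring
  set Fz : ℂ → ℂ := fun z => deriv y₁ z * (starRingEnd ℂ) (y₁ z) + deriv y₂ z * (starRingEnd ℂ) (y₂ z)
    with hFz
  set Fb : ℂ → ℂ := fun z => y₁ z * (starRingEnd ℂ) (deriv y₁ z) + y₂ z * (starRingEnd ℂ) (deriv y₂ z)
    with hFb
  have F0 : ∀ z ∈ U, F z ≠ 0 := by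
    intro z hz
    rw [Fr]; exact_mod_cast (h0 z hz).ne'
  have k1 : ∀ z ∈ U, HW F (Fz z) (Fb z) z := by
    intro z hz
    have a1 := HW.of_deriv (h1 z hz).differentiableAt.hasDerivAt
    have a2 := HW.of_deriv (h2 z hz).differentiableAt.hasDerivAt
    refine ((a1.mul a1.conj).add (a2.mul a2.conj)).cast ?_ ?_
    · simp [hFz]
    · simp [hFb]
  have k2 : ∀ z ∈ U, HW (fun z => (v z : ℂ)) (-2 * Fz z / F z) (-2 * Fb z / F z) z := by
    intro z hz
    have l := Complex.hasDerivAt_log (z := F z) (by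
      rw [Fr]; exact Complex.ofReal_mem_slitPlane.2 (h0 z hz))
    have a1 := (hw_const (Real.log (8 * ‖c‖ ^ 2)) z).sub ((hw_const 2 z).mul ((k1 z hz).compL l))
    refine (a1.cast ?_ ?_).congr (.of_forall fun w => ?_)
    · ring
    · ring
    · simp only [v, Fr]
      rw [← Complex.ofReal_log (by positivity)]
      push_cast; ring
  have k3 : ∀ z ∈ U, ∃ e, HW (fun z => -2 * Fz z / F z) e (-2 * (c * (starRingEnd ℂ) c) / F z ^ 2) z := by
    intro z hz
    have a1 := HW.of_deriv (h1 z hz).differentiableAt.hasDerivAt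
    have a2 := HW.of_deriv (h2 z hz).differentiableAt.hasDerivAt
    have b1 := HW.of_deriv (h1 z hz).deriv.differentiableAt.hasDerivAt
    have b2 := HW.of_deriv (h2 z hz).deriv.differentiableAt.hasDerivAt
    have f1 := (b1.mul a1.conj).add (b2.mul a2.conj)
    have f2 := (k1 z hz).compL (hasDerivAt_inv (F0 z hz))
    refine ⟨_, (((hw_const (-2) z).mul (f1.mul f2)).cast rfl ?_).congr (.of_forall fun w => ?_)⟩
    · have := F0 z hz
      simp only [zero_mul, zero_add]
      rw [← hw z hz]
      field_simp
      simp only [hFb, hF, map_sub, map_mul]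
      ring
    · simp only [hFz]; ring
  intro z hz
  refine ⟨cd z hz, ?_⟩
  obtain ⟨e, he⟩ := k3 z hz
  have nz : ∀ᶠ w in 𝓝 z, w ∈ U := hU.mem_nhds hz
  have L := lapl_of (v := v) (z := z) (nz.mono fun w hw => cd w hw) (nz.mono fun w hw => k2 w hw) he
  have hc' : 0 < 8 * ‖c‖ ^ 2 := by positivity
  have hexp : Real.exp (v z) = 8 * ‖c‖ ^ 2 / (‖y₁ z‖ ^ 2 + ‖y₂ z‖ ^ 2) ^ 2 := by
    simp only [v]
    rw [Real.exp_sub, Real.exp_log hc', two_mul (Real.log _), Real.exp_add, Real.exp_log (h0 z hz), sq]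
    ring
  have L2 : (lapl v z : ℂ) = ((-(8 * ‖c‖ ^ 2 / (‖y₁ z‖ ^ 2 + ‖y₂ z‖ ^ 2) ^ 2) : ℝ) : ℂ) := by
    rw [L, Fr, Complex.mul_conj, Complex.normSq_eq_norm_sq]
    push_cast; ring
  rw [Complex.ofReal_inj.1 L2, hexp]
  ring

namespace PeriodPair
variable {L : PeriodPair}

lemma py_neg (a z : ℂ) : L.py a (-z) = L.py (-a) z := by
  simp only [py]
  rw [show -z - a = -(z - -a) by ring, L.ps_neg, L.ps_neg, L.pz_neg, mul_neg, neg_div_neg_eq]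
  congr 3; ring

lemma wronsk {a : ℂ} (h2 : 2 * a ∉ L.lattice) : ∃ c : ℂ, c ≠ 0 ∧ ∀ z ∉ L.lattice,
    deriv (L.py a) z * L.py (-a) z - L.py a z * deriv (L.py (-a)) z = c := by
  have ha : a ∉ L.lattice := fun h => h2 (two_mem h)
  have ha' := L.neg_nmem ha
  obtain ⟨c, hc⟩ := L.py_ode
  set W := fun z => deriv (L.py a) z * L.py (-a) z - L.py a z * deriv (L.py (-a)) z with hW
  have hd : ∀ z ∉ L.lattice, HasDerivAt W 0 z := by
    intro z hz
    have a1 := (L.py_an a hz).differentiableAt.hasDerivAt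
    have a2 := (L.py_an (-a) hz).differentiableAt.hasDerivAt
    have b1 := (L.py_an a hz).deriv.differentiableAt.hasDerivAt
    have b2 := (L.py_an (-a) hz).deriv.differentiableAt.hasDerivAt
    refine ((b1.mul a2).sub (a1.mul b2)).congr_deriv ?_
    rw [hc a ha z hz, hc (-a) ha' z hz, L.weierstrassP_neg]
    ring
  refine ⟨W a, ?_, fun z hz => L.const_off hd hz ha⟩
  simp only [hW, L.py_self a, zero_mul, sub_zero]
  refine mul_ne_zero (L.deriv_py_self ha) (L.py_ne ha ?_)
  rwa [sub_neg_eq_add, ← two_mul]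

/-- The sufficient direction. -/
theorem suff {a : ℂ} (h2 : 2 * a ∉ L.lattice)
    (hre : ∀ l ∈ L.lattice, (L.pz a * l - L.pet l * a).re = 0) :
    ∃ v, L.EvSol v ∧ ∀ l ∈ L.lattice, ∀ z, v (z + l) = v z := by
  have ha : a ∉ L.lattice := fun h => h2 (two_mem h)
  obtain ⟨c, hc, hw⟩ := L.wronsk h2
  have h0 : ∀ z ∉ L.lattice, 0 < ‖L.py a z‖ ^ 2 + ‖L.py (-a) z‖ ^ 2 := by
    intro z hz
    by_cases hza : z - a ∈ L.lattice
    · have hza' : z - -a ∉ L.lattice := by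
        intro h
        apply h2
        have := sub_mem h hza
        rwa [show z - -a - (z - a) = 2 * a by ring] at this
      have := norm_pos_iff.2 (L.py_ne hz hza')
      positivity
    · have := norm_pos_iff.2 (L.py_ne hz hza)
      positivity
  have key := liouv L.isOpen_compl (fun z hz => L.py_an a hz) (fun z hz => L.py_an (-a) hz) hc
    (fun z hz => hw z hz) (fun z hz => h0 z hz)
  set v : ℂ → ℝ := fun z => Real.log (8 * ‖c‖ ^ 2) -
    2 * Real.log (‖L.py a z‖ ^ 2 + ‖L.py (-a) z‖ ^ 2) with hv
  have per : ∀ l ∈ L.lattice, ∀ z, v (z + l) = v z := by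
    intro l hl z
    have n1 : ‖L.py a (z + l)‖ = ‖L.py a z‖ := by
      rw [L.py_add hl, norm_mul, Complex.norm_exp, hre l hl, Real.exp_zero, one_mul]
    have n2 : ‖L.py (-a) (z + l)‖ = ‖L.py (-a) z‖ := by
      rw [L.py_add hl, norm_mul, Complex.norm_exp, L.pz_neg,
        show -L.pz a * l - L.pet l * -a = -(L.pz a * l - L.pet l * a) by ring, Complex.neg_re,
        hre l hl, neg_zero, Real.exp_zero, one_mul]
    simp only [hv, n1, n2]
  refine ⟨v, ⟨?_, fun l hl => per _ (two_mem hl), fun z hz => key z hz, ?_⟩, per⟩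
  · intro z
    simp only [hv, py_neg, neg_neg]
    rw [add_comm]
  · intro p hp
    obtain ⟨ψ, ψ1, ψ2, ψ3⟩ := analytic_factor (L.ps_an p) (L.ps_eq_zero hp)
    have hψ : ψ p ≠ 0 := by rw [ψ3]; exact L.deriv_ps_ne hp
    set A : ℂ → ℂ := fun z => Complex.exp (L.pz a * z) * L.ps (z - a) with hA
    set B : ℂ → ℂ := fun z => Complex.exp (L.pz (-a) * z) * L.ps (z - -a) with hB
    have cs := L.ps_diff.continuous
    have hAp : A p ≠ 0 := mul_ne_zero (Complex.exp_ne_zero _) (L.ps_ne (by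
      intro h
      have := sub_mem hp h
      rw [sub_sub_cancel] at this
      exact ha this))
    have cA : Continuous A := by fun_prop
    have cB : Continuous B := by fun_prop
    set R : ℂ → ℝ := fun z => Real.log (8 * ‖c‖ ^ 2) - 2 * Real.log (‖A z‖ ^ 2 + ‖B z‖ ^ 2)
      + 4 * Real.log ‖ψ z‖ with hR
    have G0 : 0 < ‖A p‖ ^ 2 + ‖B p‖ ^ 2 := by
      have := norm_pos_iff.2 hAp
      positivity
    have cR : ContinuousAt R p := by
      have c1 : ContinuousAt (fun z => ‖A z‖ ^ 2 + ‖B z‖ ^ 2) p := by fun_prop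
      have c2 := ψ1.continuousAt.norm
      exact (continuousAt_const.sub (continuousAt_const.mul (c1.log G0.ne'))).add
        (continuousAt_const.mul (c2.log (norm_ne_zero_iff.2 hψ)))
    have e1 : ∀ᶠ z in 𝓝 p, |R z| < |R p| + 1 := cR.abs.eventually_lt continuousAt_const (by simp)
    have e2 : ∀ᶠ z in 𝓝 p, ψ z ≠ 0 := ψ1.continuousAt.eventually_ne hψ
    have e3 : ∀ᶠ z in 𝓝 p, A z ≠ 0 := cA.continuousAt.eventually_ne hAp
    obtain ⟨ε, hε, H⟩ := Metric.eventually_nhds_iff.1 (e1.and (e2.and e3))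
    refine ⟨|R p| + 1, ε, hε, fun z hz hd => ?_⟩
    obtain ⟨f1, f2, f3⟩ := H hd
    have hzp : 0 < ‖z - p‖ := norm_pos_iff.2 (sub_ne_zero.2 hz)
    have f2' := norm_pos_iff.2 f2
    have f3' := norm_pos_iff.2 f3
    have G1 : 0 < ‖A z‖ ^ 2 + ‖B z‖ ^ 2 := by positivity
    have : v z - 4 * Real.log (dist z p) = R z := by
      have q1 : ‖L.py a z‖ = ‖A z‖ / (‖z - p‖ * ‖ψ z‖) := by
        simp only [py, norm_div, hA]
        rw [ψ2 z, norm_mul (z - p)]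
      have q2 : ‖L.py (-a) z‖ = ‖B z‖ / (‖z - p‖ * ‖ψ z‖) := by
        simp only [py, norm_div, hB]
        rw [ψ2 z, norm_mul (z - p)]
      simp only [hv, hR]
      rw [q1, q2, div_pow, div_pow, ← add_div, Real.log_div G1.ne' (by positivity), Real.log_pow,
        Real.log_mul hzp.ne' f2'.ne', dist_eq_norm]
      push_cast; ring
    rw [this]
    exact f1.le

end PeriodPair

open Metric Set Filter Topology

/-- local part of being a solution -/
def SolOn (S : Set ℂ) (v : ℂ → ℝ) : Prop :=
  (∀ z ∉ S, (∀ n : ℕ, ContDiffAt ℝ n v z) ∧ lapl v z + Real.exp (v z) = 0) ∧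
  ∀ p ∈ S, ∃ C ε : ℝ, 0 < ε ∧ ∀ z : ℂ, z ≠ p → dist z p < ε → |v z - 4 * Real.log (dist z p)| ≤ C

lemma lapl_scale (v : ℂ → ℝ) (t K : ℝ) (z : ℂ) :
    lapl (fun w => v (t • w) + K) z = t ^ 2 * lapl v (t • z) := by
  have e : ∀ a : ℂ, fderiv ℝ (fun w => fderiv ℝ (fun w => v (t • w) + K) w a) z a =
      t ^ 2 * fderiv ℝ (fun w => fderiv ℝ v w a) (t • z) a := by
    intro a
    have e1 : (fun w => fderiv ℝ (fun w => v (t • w) + K) w a) =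
        fun w => t • (fun x => fderiv ℝ v x a) (t • w) := by
      ext w
      rw [fderiv_add_const, fderiv_comp_smul]
      simp
    have e2 := congrFun (fderiv_const_smul_field (𝕜 := ℝ) (f := fun w : ℂ => (fun x => fderiv ℝ v x a) (t • w)) t) z
    have e3 : (fun w => t • (fun x => fderiv ℝ v x a) (t • w)) =
      t • fun w : ℂ => (fun x => fderiv ℝ v x a) (t • w) := rfl
    have e4 := fderiv_comp_smul (𝕜 := ℝ) (f := fun x => fderiv ℝ v x a) t (x := z)
    rw [e1, e3, e2, Pi.smul_apply, e4]
    simp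
    ring
  simp only [lapl, e]
  ring

lemma SolOn.scale {S : Set ℂ} {v : ℂ → ℝ} (h : SolOn S v) {t : ℝ} (ht : 0 < t) :
    SolOn {z | (t : ℂ) * z ∈ S} (fun z => v (t * z) + 2 * Real.log t) := by
  have hsm : ∀ w : ℂ, t • w = (t : ℂ) * w := fun w => Complex.real_smul
  constructor
  · intro z hz
    obtain ⟨h1, h2⟩ := h.1 (t * z) hz
    constructor
    · intro n
      have : ContDiffAt ℝ n (fun z : ℂ => (t : ℂ) * z) z := by fun_prop
      exact ((h1 n).comp z this).add contDiffAt_const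
    · have := lapl_scale v t (2 * Real.log t) z
      simp only [hsm] at this
      rw [this, Real.exp_add, two_mul (Real.log t), Real.exp_add, Real.exp_log ht]
      linear_combination t ^ 2 * h2
  · intro p hp
    obtain ⟨C, ε, hε, H⟩ := h.2 _ hp
    refine ⟨C + |6 * Real.log t|, ε / t, by positivity, fun z hz hd => ?_⟩
    have ed : dist ((t : ℂ) * z) (t * p) = t * dist z p := by
      rw [dist_eq_norm, dist_eq_norm, ← mul_sub, norm_mul, Complex.norm_real, Real.norm_eq_abs,
        abs_of_pos ht]
    have htc : (t : ℂ) ≠ 0 := by exact_mod_cast ht.ne'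
    have := H (t * z) (fun e => hz (mul_left_cancel₀ htc e)) (by
      rw [ed, mul_comm]; exact (lt_div_iff₀ ht).1 hd)
    rw [ed, Real.log_mul ht.ne' (dist_ne_zero.2 hz)] at this
    calc |v (t * z) + 2 * Real.log t - 4 * Real.log (dist z p)|
        = |(v (t * z) - 4 * (Real.log t + Real.log (dist z p))) + 6 * Real.log t| := by
          congr 1; ring
      _ ≤ _ := (abs_add_le _ _).trans (by linarith)

lemma curv_iff (τ : ℂ) (k : ℕ) (v : ℂ → ℝ) : IsCurvatureSolution τ (starM k) v ↔
    (∀ z, v (z + 1) = v z) ∧ (∀ z, v (z + τ) = v z) ∧ SolOn (singSet τ (starM k)) v := by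
  have one : ∀ j, 1 ≤ starM k j → starM k j = 1 := by
    intro j h
    simp only [starM] at h ⊢
    split_ifs at h ⊢ with h1
    · rfl
    · omega
  constructor
  · rintro ⟨h1, h2, h3, h4⟩
    refine ⟨h1, h2, h3, ?_⟩
    rintro p ⟨j, hj, l, hl, rfl⟩
    have := h4 j hj l hl
    rw [one j hj] at this
    simpa using this
  · rintro ⟨h1, h2, h3, h4⟩
    refine ⟨h1, h2, h3, ?_⟩
    intro j hj l hl
    have := h4 _ ⟨j, hj, l, hl, rfl⟩
    rw [one j hj]
    simpa using this

lemma mem_sing {τ : ℂ} {k : ℕ} (hk : k = 1 ∨ k = 2 ∨ k = 3) {z : ℂ} :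
    z ∈ singSet τ (starM k) ↔ z ∈ lat τ ∨ ∃ l ∈ lat τ, z = per τ k / 2 + l := by
  have hk4 : k < 4 := by omega
  constructor
  · rintro ⟨j, hj, l, hl, rfl⟩
    have : (j : ℕ) = 0 ∨ (j : ℕ) = k := by
      by_contra h
      simp only [starM, if_neg h] at hj
      omega
    rcases this with h | h
    · left; rw [h]; simpa [per] using hl
    · right; exact ⟨l, hl, by rw [h]⟩
  · rintro (h | ⟨l, hl, rfl⟩)
    · exact ⟨0, by simp [starM], z, h, by simp [per]⟩
    · exact ⟨⟨k, hk4⟩, by simp [starM], l, hl, rfl⟩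

lemma even_iff (τ : ℂ) (m : Fin 4 → ℕ) : HasEvenFamily τ m ↔
    ∃ v, IsCurvatureSolution τ m v ∧ ∀ z, v (-z) = v z := by
  constructor
  · rintro ⟨-, -, -, -, -, -, v, h, -, h'⟩
    exact ⟨v, h, h'⟩
  · rintro ⟨v, h, h'⟩
    have dev : ∀ f : ℂ → ℂ, f = (fun _ => 0) → IsDevelopingMapOf v f := by
      rintro f rfl
      refine ⟨fun z => analyticAt_const.meromorphicAt, fun z _ hd => ?_⟩
      simp at hd
    refine ⟨v, fun _ => 0, h, dev _ rfl, ⟨0, 0, by simp, by simp⟩, 0, v, h, dev _ (by simp), h'⟩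

lemma per_lat {v : ℂ → ℝ} {τ : ℂ} (h1 : ∀ z, v (z + 1) = v z) (h2 : ∀ z, v (z + τ) = v z) (m n : ℤ)
    (z : ℂ) : v (z + (m + n * τ)) = v z := by
  have p1 : Function.Periodic v 1 := h1
  have p2 : Function.Periodic v τ := h2
  have := (p1.int_mul m).add_period (p2.int_mul n)
  simpa using this z

/-- the standard period pair -/
noncomputable def stdL (τ : ℂ) (h : 0 < τ.im) : PeriodPair where
  ω₁ := 1
  ω₂ := τ
  indep := by
    rw [LinearIndependent.pair_iff]
    intro s t e
    have e2 := congrArg Complex.im e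
    have e1 := congrArg Complex.re e
    simp at e1 e2
    rcases e2 with e2 | e2
    · subst e2; simpa using e1
    · exact absurd e2 h.ne'

section
variable {τ : ℂ} (h : 0 < τ.im)

lemma mem_std {z : ℂ} : z ∈ (stdL τ h).lattice ↔ z ∈ lat τ := by
  rw [PeriodPair.mem_lattice]
  simp only [stdL, lat, mem_ofPred_eq, mul_one, eq_comm]

lemma wzeta_eq (z : ℂ) : wzeta τ z = (stdL τ h).pz z := by
  have hs := (stdL τ h).hasSum_pz z
  have h2 := ((stdL τ h).latticeEquivProd.symm.toEquiv.hasSum_iff).2 hs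
  have e : ∀ p : ℤ × ℤ, ((stdL τ h).latticeEquivProd.symm p : ℂ) = latPt τ p := by
    intro p
    rw [PeriodPair.latticeEquiv_symm_apply]
    simp [stdL, latPt]
  have h3 : HasSum (fun p : ℤ × ℤ => 1 / (z - latPt τ p) + 1 / latPt τ p + z / latPt τ p ^ 2)
      ((stdL τ h).pz z) := by
    have e5 : (fun p : ℤ × ℤ => 1 / (z - latPt τ p) + 1 / latPt τ p + z / latPt τ p ^ 2) =
        (fun l : (stdL τ h).lattice => 1 / (z - l) + 1 / (l : ℂ) + z / (l : ℂ) ^ 2) ∘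
          (stdL τ h).latticeEquivProd.symm.toEquiv := by
      ext p
      simp [← e]
    rw [e5]; exact h2
  have h4 := h3.summable.sum_add_tsum_subtype_compl {(0 : ℤ × ℤ)}
  rw [h3.tsum_eq] at h4
  rw [← h4, wzeta, Finset.sum_singleton]
  have e6 : (∑' p : {p : ℤ × ℤ // p ≠ 0},
    (1 / (z - latPt τ p.1) + 1 / latPt τ p.1 + z / latPt τ p.1 ^ 2)) =
    ∑' p : {p : ℤ × ℤ // p ∉ ({0} : Finset (ℤ × ℤ))},
    (1 / (z - latPt τ p.1) + 1 / latPt τ p.1 + z / latPt τ p.1 ^ 2) := by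
    refine (Equiv.subtypeEquivRight (fun p => by simp)).tsum_eq (fun p :
      {p : ℤ × ℤ // p ∉ ({0} : Finset (ℤ × ℤ))} =>
      (1 / (z - latPt τ p.1) + 1 / latPt τ p.1 + z / latPt τ p.1 ^ 2))
  rw [e6]
  simp [latPt]

end

section
variable {τ : ℂ} (h : 0 < τ.im)

lemma eta1_eq : eta1 τ = (stdL τ h).pet 1 := by
  have := (stdL τ h).pet_eq (a := 1 / 2) (by
    rw [mul_one_div_cancel two_ne_zero]; exact (stdL τ h).ω₁_mem_lattice)
    (stdL τ h).ω₁_div_two_notMem_lattice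
  rw [eta1, wzeta_eq h, ← this, mul_one_div_cancel two_ne_zero]

lemma eta2_eq : eta2 τ = (stdL τ h).pet τ := by
  have e : 2 * (τ / 2) = τ := by ring
  have := (stdL τ h).pet_eq (a := τ / 2) (by rw [e]; exact (stdL τ h).ω₂_mem_lattice)
    (stdL τ h).ω₂_div_two_notMem_lattice
  rw [eta2, wzeta_eq h, ← this, e]

lemma heckeZ_eq (r s : ℂ) : heckeZ r s τ = (stdL τ h).pz (r + s * τ) - r * (stdL τ h).pet 1
    - s * (stdL τ h).pet τ := by
  rw [heckeZ, wzeta_eq h, eta1_eq h, eta2_eq h]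

lemma leg_re : ((stdL τ h).pet 1 * τ - (stdL τ h).pet τ).re = 0 := by
  have := (stdL τ h).legendre (stdL τ h).ω₁_mem_lattice (stdL τ h).ω₂_mem_lattice
  have e : (stdL τ h).ω₁ = 1 := rfl
  have e' : (stdL τ h).ω₂ = τ := rfl
  rw [e, e', mul_one] at this
  have := congrArg norm this
  rw [Complex.norm_exp, norm_one, Real.exp_eq_one_iff] at this
  exact this

lemma half_iff (r s : ℝ) : IsHalfIntPair (r : ℂ) (s : ℂ) ↔ 2 * ((r : ℂ) + s * τ) ∈ (stdL τ h).lattice := by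
  rw [mem_std h]
  constructor
  · rintro ⟨m, n, e1, e2⟩
    exact ⟨m, n, by rw [e1, e2]; ring⟩
  · rintro ⟨m, n, e⟩
    have i := congrArg Complex.im e
    have q := congrArg Complex.re e
    simp at i q
    have hs : 2 * s = n := mul_right_cancel₀ h.ne' (by linarith)
    refine ⟨m, n, ?_, ?_⟩
    · have : r = (m : ℝ) / 2 := by
        have e3 : 2 * s * τ.re = n * τ.re := by rw [hs]
        linarith
      rw [this]; push_cast; ring
    · have : s = (n : ℝ) / 2 := by linarith
      rw [this]; push_cast; ring

lemma crit : (∃ a, 2 * a ∉ (stdL τ h).lattice ∧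
    ∀ l ∈ (stdL τ h).lattice, ((stdL τ h).pz a * l - (stdL τ h).pet l * a).re = 0) ↔
    ∃ r s : ℝ, ¬ IsHalfIntPair (r : ℂ) (s : ℂ) ∧ heckeZ r s τ = 0 := by
  set L := stdL τ h with hL
  have leg := leg_re h
  rw [← hL] at leg
  have o1 : (1 : ℂ) ∈ L.lattice := L.ω₁_mem_lattice
  have o2 : τ ∈ L.lattice := L.ω₂_mem_lattice
  have i1 : ∀ r s : ℝ, L.pz (r + s * τ) * 1 - L.pet 1 * (r + s * τ) =
      heckeZ r s τ - s * (L.pet 1 * τ - L.pet τ) := by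
    intro r s; rw [heckeZ_eq h]; ring
  have i2 : ∀ r s : ℝ, L.pz (r + s * τ) * τ - L.pet τ * (r + s * τ) =
      heckeZ r s τ * τ + r * (L.pet 1 * τ - L.pet τ) := by
    intro r s; rw [heckeZ_eq h]; ring
  constructor
  · rintro ⟨a, ha, hre⟩
    obtain ⟨r, s, rfl⟩ := L.coords a
    have e : (L.ω₁ : ℂ) = 1 := rfl
    have e' : (L.ω₂ : ℂ) = τ := rfl
    rw [e, e', mul_one] at ha hre
    refine ⟨r, s, fun hh => ha ((half_iff h r s).1 hh), ?_⟩
    have k1 := hre 1 o1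
    have k2 := hre τ o2
    rw [i1] at k1
    rw [i2] at k2
    rw [Complex.sub_re, Complex.re_ofReal_mul, leg, mul_zero, sub_zero] at k1
    rw [Complex.add_re, Complex.re_ofReal_mul, leg, mul_zero, add_zero, Complex.mul_re, k1] at k2
    apply Complex.ext
    · exact k1
    · have : (heckeZ r s τ).im * τ.im = 0 := by linarith
      exact (mul_eq_zero.1 this).resolve_right h.ne'
  · rintro ⟨r, s, hh, hz⟩
    refine ⟨r + s * τ, fun h' => hh ((half_iff h r s).2 h'), ?_⟩
    set φ : L.lattice →+ ℝ := AddMonoidHom.mk' (fun l => (L.pz (r + s * τ) * l - L.pet l * (r + s * τ)).re)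
      (by
        intro l m
        rw [Submodule.coe_add, L.pet_add l.2 m.2, ← Complex.add_re]
        congr 1; ring) with hφ
    have f1 : φ ⟨1, o1⟩ = 0 := by
      simp only [hφ, AddMonoidHom.mk'_apply]
      rw [i1, hz, Complex.sub_re, Complex.re_ofReal_mul, leg]; simp
    have f2 : φ ⟨τ, o2⟩ = 0 := by
      simp only [hφ, AddMonoidHom.mk'_apply]
      rw [i2, hz, Complex.add_re, Complex.re_ofReal_mul, leg]; simp
    intro l hl
    obtain ⟨m, n, e⟩ := (mem_std h).1 hl
    have : (⟨l, hl⟩ : L.lattice) = m • ⟨1, o1⟩ + n • ⟨τ, o2⟩ := by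
      apply Subtype.ext
      simp [e]
    have f3 : φ ⟨l, hl⟩ = 0 := by
      rw [this, map_add, map_zsmul, map_zsmul, f1, f2]; simp
    exact f3

/-- reduction: existence of local solution data on the lattice of `τ` -/
lemma crit2 : (∃ v, (stdL τ h).EvSol v) ↔
    ∃ r s : ℝ, ¬ IsHalfIntPair (r : ℂ) (s : ℂ) ∧ heckeZ r s τ = 0 := by
  rw [← crit h]
  constructor
  · rintro ⟨v, hv⟩
    exact hv.nec
  · rintro ⟨a, h1, h2⟩
    obtain ⟨v, hv, -⟩ := PeriodPair.suff h1 h2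
    exact ⟨v, hv⟩

lemma evsol_iff {v : ℂ → ℝ} : (stdL τ h).EvSol v ↔
    (∀ z, v (-z) = v z) ∧ (∀ m n : ℤ, ∀ z, v (z + 2 * (m + n * τ)) = v z) ∧ SolOn (lat τ) v := by
  constructor
  · rintro ⟨h1, h2, h3, h4⟩
    exact ⟨h1, fun m n z => h2 _ ((mem_std h).2 ⟨m, n, rfl⟩) z,
      fun z hz => h3 z fun h' => hz ((mem_std h).1 h'), fun p hp => h4 p ((mem_std h).2 hp)⟩
  · rintro ⟨h1, h2, h3, h4⟩
    refine ⟨h1, ?_, fun z hz => h3 z fun h' => hz ((mem_std h).2 h'),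
      fun p hp => h4 p ((mem_std h).1 hp)⟩
    intro l hl z
    obtain ⟨m, n, rfl⟩ := (mem_std h).1 hl
    exact h2 m n z
end

lemma sing1 (τ₀ : ℂ) : {z | ((2 : ℝ) : ℂ) * z ∈ lat (2 * τ₀)} = singSet τ₀ (starM 1) := by
  ext z
  rw [mem_sing (Or.inl rfl)]
  simp only [lat, per, mem_ofPred_eq]
  constructor
  · rintro ⟨m, n, e⟩
    obtain ⟨j, rfl | rfl⟩ := Int.even_or_odd' m
    · left; refine ⟨j, n, ?_⟩; push_cast at e; linear_combination e / 2
    · right; refine ⟨_, ⟨j, n, rfl⟩, ?_⟩; push_cast at e; linear_combination e / 2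
  · rintro (⟨m, n, e⟩ | ⟨_, ⟨m, n, rfl⟩, e⟩)
    · exact ⟨2 * m, n, by rw [e]; push_cast; ring⟩
    · exact ⟨2 * m + 1, n, by rw [e]; push_cast; ring⟩

lemma sing2 (τ₀ : ℂ) : lat (τ₀ / 2) = singSet τ₀ (starM 2) := by
  ext z
  rw [mem_sing (by simp)]
  simp only [lat, per, mem_ofPred_eq]
  constructor
  · rintro ⟨m, n, e⟩
    obtain ⟨j, rfl | rfl⟩ := Int.even_or_odd' n
    · left; refine ⟨m, j, ?_⟩; push_cast at e; linear_combination e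
    · right; refine ⟨_, ⟨m, j, rfl⟩, ?_⟩; push_cast at e; linear_combination e
  · rintro (⟨m, n, e⟩ | ⟨_, ⟨m, n, rfl⟩, e⟩)
    · exact ⟨m, 2 * n, by rw [e]; push_cast; ring⟩
    · exact ⟨m, 2 * n + 1, by rw [e]; push_cast; ring⟩

lemma sing3 (τ₀ : ℂ) : lat ((1 + τ₀) / 2) = singSet τ₀ (starM 3) := by
  ext z
  rw [mem_sing (by simp)]
  simp only [lat, per, mem_ofPred_eq]
  constructor
  · rintro ⟨m, n, e⟩
    obtain ⟨j, rfl | rfl⟩ := Int.even_or_odd' n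
    · left; refine ⟨m + j, j, ?_⟩; push_cast at e ⊢; linear_combination e
    · right; refine ⟨_, ⟨m + j, j, rfl⟩, ?_⟩; push_cast at e ⊢; linear_combination e
  · rintro (⟨m, n, e⟩ | ⟨_, ⟨m, n, rfl⟩, e⟩)
    · exact ⟨m - n, 2 * n, by rw [e]; push_cast; ring⟩
    · exact ⟨m - n, 2 * n + 1, by rw [e]; push_cast; ring⟩

open Metric Set Filter Topology

theorem statement1 (τ₀ : ℂ) (hτ₀ : 0 < τ₀.im) (k : ℕ) (hk : k = 1 ∨ k = 2 ∨ k = 3) :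
    HasEvenFamily τ₀ (starM k) ↔
      ∃ r s : ℝ, ¬ IsHalfIntPair (r : ℂ) (s : ℂ) ∧
        heckeZ (r : ℂ) (s : ℂ)
          (if k = 1 then 2 * τ₀ else if k = 2 then τ₀ / 2 else (1 + τ₀) / 2) = 0 := by
  rw [even_iff]
  simp only [curv_iff]
  rcases hk with rfl | rfl | rfl
  · have hi : 0 < (2 * τ₀).im := by simpa using hτ₀
    rw [if_pos rfl]
    constructor
    · rintro ⟨v, ⟨p1, p2, hs⟩, he⟩
      rw [← crit2 hi]
      have hsc := hs.scale (t := 1 / 2) (by norm_num)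
      refine ⟨fun z => v (((1 / 2 : ℝ) : ℂ) * z) + 2 * Real.log (1 / 2), (evsol_iff hi).2 ⟨?_, ?_, ?_⟩⟩
      · intro z; simp only [mul_neg, he]
      · intro m n z
        have := per_lat p1 p2 m (2 * n) (((1 / 2 : ℝ) : ℂ) * z)
        rw [← this]
        congr 2
        push_cast; ring
      · convert! hsc using 1
        rw [← sing1]
        ext z
        simp only [mem_ofPred_eq]
        rw [← mul_assoc]
        norm_num
    · intro hrs
      obtain ⟨a, h1, h2⟩ := (crit hi).2 hrs
      obtain ⟨v, hv, hper⟩ := PeriodPair.suff h1 h2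
      obtain ⟨he, -, hs⟩ := (evsol_iff hi).1 hv
      have hsc := hs.scale (t := 2) (by norm_num)
      rw [sing1] at hsc
      refine ⟨_, ⟨?_, ?_, hsc⟩, ?_⟩
      · intro z
        have := hper 2 ((mem_std hi).2 ⟨2, 0, by simp⟩) (((2 : ℝ) : ℂ) * z)
        rw [← this]
        congr 2
        push_cast; ring
      · intro z
        have := hper (2 * τ₀) ((mem_std hi).2 ⟨0, 1, by simp⟩) (((2 : ℝ) : ℂ) * z)
        rw [← this]
        congr 2
        push_cast; ring
      · intro z; simp only [mul_neg, he]
  · have hi : 0 < (τ₀ / 2).im := by simpa using hτ₀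
    rw [if_neg (by norm_num), if_pos rfl, ← sing2]
    constructor
    · rintro ⟨v, ⟨p1, p2, hs⟩, he⟩
      rw [← crit2 hi]
      refine ⟨v, (evsol_iff hi).2 ⟨he, ?_, hs⟩⟩
      intro m n z
      rw [← per_lat p1 p2 (2 * m) n z]
      congr 1
      push_cast; ring
    · intro hrs
      obtain ⟨a, h1, h2⟩ := (crit hi).2 hrs
      obtain ⟨v, hv, hper⟩ := PeriodPair.suff h1 h2
      obtain ⟨he, -, hs⟩ := (evsol_iff hi).1 hv
      exact ⟨v, ⟨hper 1 ((mem_std hi).2 ⟨1, 0, by simp⟩),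
        hper τ₀ ((mem_std hi).2 ⟨0, 2, by push_cast; ring⟩), hs⟩, he⟩
  · have hi : 0 < ((1 + τ₀) / 2).im := by simpa using hτ₀
    rw [if_neg (by norm_num), if_neg (by norm_num), ← sing3]
    constructor
    · rintro ⟨v, ⟨p1, p2, hs⟩, he⟩
      rw [← crit2 hi]
      refine ⟨v, (evsol_iff hi).2 ⟨he, ?_, hs⟩⟩
      intro m n z
      rw [← per_lat p1 p2 (2 * m + n) n z]
      congr 1
      push_cast; ring
    · intro hrs
      obtain ⟨a, h1, h2⟩ := (crit hi).2 hrs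
      obtain ⟨v, hv, hper⟩ := PeriodPair.suff h1 h2
      obtain ⟨he, -, hs⟩ := (evsol_iff hi).1 hv
      exact ⟨v, ⟨hper 1 ((mem_std hi).2 ⟨1, 0, by simp⟩),
        hper τ₀ ((mem_std hi).2 ⟨-1, 2, by push_cast; ring⟩), hs⟩, he⟩
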